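/- Let F be a field of characteristic p > 0 and n ≥ 2. Then the Poincaré series θ(ℤ, n, t) = Σ_s dim_F H_s(K(ℤ,n);F) t^s is not bounded on [0,1): sup_{t∈[0,1)} θ(ℤ,n,t) = ∞. -/

import Mathlib

open CategoryTheory AlgebraicTopology

/-- The singular chain complex of a topological space with coefficients in a
field `F`: the alternating-face-map complex of the levelwise free `F`-module
on the singular simplicial set of `X`. -/
noncomputable def singularChains (F : Type) [Field F] (X : TopCat) :
    ChainComplex (ModuleCat F) ℕ :=
  (alternatingFaceMapComplex (ModuleCat F)).obj
    (((SimplicialObject.whiskering _ _).obj (ModuleCat.free F)).obj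
      (TopCat.toSSet.obj X))

/-- Singular homology `H_s(X; F)` with coefficients in the field `F`. -/
noncomputable def singularHomologyF (F : Type) [Field F] (X : TopCat) (s : ℕ) :
    ModuleCat F :=
  (singularChains F X).homology s

/-- `X` is an Eilenberg–MacLane space `K(ℤ^q, n)` (`n ≥ 1`): it is
path-connected, all homotopy groups in degrees `≠ n` are trivial, and the
`n`-th homotopy group is (the multiplicative version of) the free abelian
group `ℤ^q`. -/
def IsEilenbergMacLane (X : TopCat) (q n : ℕ) : Prop :=
  Nonempty X ∧ PathConnectedSpace X ∧
    (∀ (x : X) (i : ℕ), i ≠ n → Nonempty (HomotopyGroup (Fin i) X x ≃ PUnit.{1})) ∧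
    (∀ x : X, ∃ m : ℕ, n = m + 1 ∧
      Nonempty (HomotopyGroup (Fin (m + 1)) X x ≃* Multiplicative (Fin q → ℤ)))

namespace EMSpace

open Opposite Simplicial

section Homological

variable {F : Type} [Field F]

/-- Simplicial modules over `F`. -/
abbrev SMod (F : Type) [Field F] := SimplicialObject (ModuleCat.{0} F)

/-- Homology of simplicial modules as a functor. -/
noncomputable def homologyFun (F : Type) [Field F] (s : ℕ) : SMod F ⥤ ModuleCat.{0} F :=
  alternatingFaceMapComplex (ModuleCat.{0} F) ⋙ HomologicalComplex.homologyFunctor _ _ s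

lemma homologyFun_map_zero {P Q : SMod F} (s : ℕ) :
    (homologyFun F s).map (0 : P ⟶ Q) = 0 := by
  have : (alternatingFaceMapComplex (ModuleCat.{0} F)).map (0 : P ⟶ Q) = 0 := by
    ext n : 1
    rw [alternatingFaceMapComplex_map_f]
    rfl
  change (HomologicalComplex.homologyFunctor _ _ s).map _ = 0
  rw [this, Functor.map_zero]
  rfl

/-- A short exact sequence of simplicial modules. -/
structure IsSES {A B C : SMod F} (f : A ⟶ B) (g : B ⟶ C) : Prop where
  inj : ∀ a, Function.Injective (f.app a).hom
  exact : ∀ a, Function.Exact (f.app a).hom (g.app a).hom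
  surj : ∀ a, Function.Surjective (g.app a).hom

section SES

variable {A B C : SMod F} {f : A ⟶ B} {g : B ⟶ C}

lemma IsSES.comp_zero (h : IsSES f g) : f ≫ g = 0 := by
  ext a x
  exact (h.exact a).apply_apply_eq_zero x

/-- The short complex of chain complexes of a short exact sequence. -/
noncomputable def IsSES.shortComplex (h : IsSES f g) :
    ShortComplex (ChainComplex (ModuleCat.{0} F) ℕ) :=
  ShortComplex.mk ((alternatingFaceMapComplex (ModuleCat.{0} F)).map f)
    ((alternatingFaceMapComplex (ModuleCat.{0} F)).map g) (by
      rw [← Functor.map_comp, h.comp_zero]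
      ext n : 1
      rw [alternatingFaceMapComplex_map_f]
      rfl)

lemma IsSES.shortExact (h : IsSES f g) : h.shortComplex.ShortExact := by
  apply HomologicalComplex.shortExact_of_degreewise_shortExact
  intro i
  have := h.exact (op ⦋i⦌)
  refine ShortComplex.ShortExact.mk' ?_ ?_ ?_
  · rw [ShortComplex.moduleCat_exact_iff]
    intro x hx
    exact (this x).1 hx
  · rw [ModuleCat.mono_iff_injective]
    exact h.inj (op ⦋i⦌)
  · rw [ModuleCat.epi_iff_surjective]
    exact h.surj (op ⦋i⦌)

/-- The connecting map. -/
noncomputable def IsSES.conn (h : IsSES f g) (s : ℕ) :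
    (homologyFun F (s + 1)).obj C ⟶ (homologyFun F s).obj A :=
  h.shortExact.δ (s + 1) s rfl

lemma IsSES.exact₁ (h : IsSES f g) (s : ℕ) :
    Function.Exact (h.conn s).hom ((homologyFun F s).map f).hom := by
  have := h.shortExact.homology_exact₁ (s + 1) s rfl
  exact (ShortComplex.ShortExact.moduleCat_exact_iff_function_exact _).1 this

lemma IsSES.exact₂ (h : IsSES f g) (s : ℕ) :
    Function.Exact ((homologyFun F s).map f).hom ((homologyFun F s).map g).hom := by
  have := h.shortExact.homology_exact₂ s
  exact (ShortComplex.ShortExact.moduleCat_exact_iff_function_exact _).1 this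

lemma IsSES.exact₃ (h : IsSES f g) (s : ℕ) :
    Function.Exact ((homologyFun F (s + 1)).map g).hom (h.conn s).hom := by
  have := h.shortExact.homology_exact₃ (s + 1) s rfl
  exact (ShortComplex.ShortExact.moduleCat_exact_iff_function_exact _).1 this

lemma IsSES.surj_zero (h : IsSES f g) :
    Function.Surjective ((homologyFun F 0).map g).hom := by
  rw [← ModuleCat.epi_iff_surjective]
  have : Epi (((alternatingFaceMapComplex (ModuleCat.{0} F)).map g).f 0) := by
    rw [ModuleCat.epi_iff_surjective]
    exact h.surj (op ⦋0⦌)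
  exact HomologicalComplex.epi_homologyMap_of_epi_of_not_rel
    ((alternatingFaceMapComplex (ModuleCat.{0} F)).map g) 0 (by simp)

end SES

/-- The kernel of a morphism of simplicial modules. -/
noncomputable def kerS {P M : SMod F} (f : P ⟶ M) : SMod F where
  obj a := ModuleCat.of F (LinearMap.ker (f.app a).hom)
  map {a b} θ := ModuleCat.ofHom ((P.map θ).hom.restrict (p := LinearMap.ker (f.app a).hom)
    (q := LinearMap.ker (f.app b).hom) (by
      intro x hx
      have := ConcreteCategory.congr_hom (f.naturality θ) x
      simp only [LinearMap.mem_ker] at hx ⊢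
      simp only [ConcreteCategory.comp_apply] at this
      exact this.trans ((congrArg _ hx).trans (map_zero _))))
  map_id a := by
    ext x
    exact ConcreteCategory.congr_hom (P.map_id a) x.1
  map_comp u v := by
    ext x
    exact ConcreteCategory.congr_hom (P.map_comp u v) x.1

/-- The inclusion of the kernel. -/
noncomputable def kerS.incl {P M : SMod F} (f : P ⟶ M) : kerS f ⟶ P where
  app a := ModuleCat.ofHom (Submodule.subtype _)

/-- The lift to the kernel. -/
noncomputable def kerS.lift {N P M : SMod F} (f : P ⟶ M) (d : N ⟶ P) (h : d ≫ f = 0) :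
    N ⟶ kerS f where
  app a := ModuleCat.ofHom ((d.app a).hom.codRestrict _ fun x => by
    have := ConcreteCategory.congr_hom (congrArg (fun k => NatTrans.app k a) h) x
    exact this)
  naturality a b θ := by
    ext x
    apply Subtype.ext
    exact ConcreteCategory.congr_hom (d.naturality θ) x

lemma kerS.isSES {P M : SMod F} (f : P ⟶ M)
    (hf : ∀ a, Function.Surjective (f.app a).hom) : IsSES (kerS.incl f) f where
  inj a := Subtype.val_injective
  exact a x := ⟨fun h => ⟨⟨x, h⟩, rfl⟩, by rintro ⟨y, rfl⟩; exact y.2⟩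
  surj := hf

/-- A morphism inducing an isomorphism on homology. -/
def IsHIso {P Q : SMod F} (f : P ⟶ Q) : Prop :=
  ∀ s, Function.Bijective ((homologyFun F s).map f).hom

/-- A resolution of a simplicial module `M` by simplicial modules `P i`, homology equivalent
to `Q i` through maps killing the differential. -/
structure Resolution (M : SMod F) (P Q : ℕ → SMod F) where
  d : ∀ i, P (i + 1) ⟶ P i
  π : P 0 ⟶ M
  ε : ∀ i, P i ⟶ Q i
  surj : ∀ a, Function.Surjective (π.app a).hom
  exact_zero : ∀ a, Function.Exact ((d 0).app a).hom (π.app a).hom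
  exact_succ : ∀ i a, Function.Exact ((d (i + 1)).app a).hom ((d i).app a).hom
  hIso : ∀ i, IsHIso (ε i)
  comp_zero : ∀ i, d i ≫ ε i = 0

namespace Resolution

variable {M : SMod F} {P Q : ℕ → SMod F} (R : Resolution M P Q)

include R in
lemma d_comp_π : R.d 0 ≫ R.π = 0 := by
  ext a x
  exact (R.exact_zero a).apply_apply_eq_zero x

/-- The shifted resolution of the first syzygy. -/
noncomputable def shift : Resolution (kerS R.π) (fun i => P (i + 1)) (fun i => Q (i + 1)) where
  d i := R.d (i + 1)
  π := kerS.lift R.π (R.d 0) R.d_comp_π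
  ε i := R.ε (i + 1)
  surj a x := by
    obtain ⟨y, hy⟩ := (R.exact_zero a x.1).1 x.2
    exact ⟨y, Subtype.ext hy⟩
  exact_zero a x := by
    refine Iff.trans ?_ (R.exact_succ 0 a x)
    exact ⟨fun h => congrArg Subtype.val h, fun h => Subtype.ext h⟩
  exact_succ i a := R.exact_succ (i + 1) a
  hIso i := R.hIso (i + 1)
  comp_zero i := R.comp_zero (i + 1)

lemma incl_comp_ε : kerS.incl R.π ≫ R.ε 0 = 0 := by
  ext a x
  obtain ⟨y, hy⟩ := (R.exact_zero a x.1).1 x.2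
  have h := ConcreteCategory.congr_hom (congrArg (fun k => NatTrans.app k a) (R.comp_zero 0)) y
  change (R.ε 0).app a x.1 = 0
  rw [← hy]
  exact h

lemma homology_incl (s : ℕ) (x) : ((homologyFun F s).map (kerS.incl R.π)).hom x = 0 := by
  apply (R.hIso 0 s).injective
  have h := congrArg (homologyFun F s).map R.incl_comp_ε
  rw [Functor.map_comp] at h
  rw [homologyFun_map_zero] at h
  rw [map_zero]
  exact ConcreteCategory.congr_hom h x

lemma injective_π (s : ℕ) : Function.Injective ((homologyFun F s).map R.π).hom := by
  rw [injective_iff_map_eq_zero]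
  intro x hx
  obtain ⟨y, rfl⟩ := ((kerS.isSES R.π R.surj).exact₂ s x).1 hx
  exact R.homology_incl s y

lemma surjective_conn (s : ℕ) :
    Function.Surjective ((kerS.isSES R.π R.surj).conn s).hom := by
  intro x
  exact ((kerS.isSES R.π R.surj).exact₁ s x).1 (R.homology_incl s x)

lemma nontrivial (i j : ℕ) : ∀ {M : SMod F} {P Q : ℕ → SMod F} (_ : Resolution M P Q),
    Nontrivial ((homologyFun F j).obj (Q i)) → Nontrivial ((homologyFun F (i + j)).obj M) := by
  induction i with
  | zero =>
    intro M P Q R h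
    rw [zero_add]
    have : Nontrivial ((homologyFun F j).obj (P 0)) := (R.hIso 0 j).surjective.nontrivial
    exact (R.injective_π j).nontrivial
  | succ i ih =>
    intro M P Q R h
    have := ih R.shift h
    have h2 := (R.surjective_conn (i + j)).nontrivial
    rwa [show i + 1 + j = i + j + 1 by omega]

lemma finite (s : ℕ) : ∀ {M : SMod F} {P Q : ℕ → SMod F} (_ : Resolution M P Q),
    (∀ i s, Module.Finite F ((homologyFun F s).obj (Q i))) →
      Module.Finite F ((homologyFun F s).obj M) := by
  have aux : ∀ (s : ℕ) {M : SMod F} {P Q : ℕ → SMod F} (R : Resolution M P Q),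
    (∀ i s, Module.Finite F ((homologyFun F s).obj (Q i))) →
      Module.Finite F ((homologyFun F s).obj (P 0)) := by
    intro s M P Q R h
    have := h 0 s
    exact Module.Finite.of_injective _ (R.hIso 0 s).injective
  induction s with
  | zero =>
    intro M P Q R h
    have := aux 0 R h
    exact Module.Finite.of_surjective _ (kerS.isSES R.π R.surj).surj_zero
  | succ s ih =>
    intro M P Q R h
    have h1 := aux (s + 1) R h
    have h2 := ih R.shift fun i s => h (i + 1) s
    have h3 := (kerS.isSES R.π R.surj).exact₃ s
    let g := ((kerS.isSES R.π R.surj).conn s).hom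
    have hk : (LinearMap.ker g).FG := by
      rw [LinearMap.exact_iff.1 h3]
      exact Module.Finite.iff_fg.1 inferInstance
    have hr : (Submodule.map g ⊤).FG := IsNoetherian.noetherian _
    exact ⟨Submodule.fg_of_fg_map_of_fg_inf_ker g hr (by simpa using hk)⟩

end Resolution

lemma finite_homology (P : SMod F) (s : ℕ) (h : Module.Finite F (P.obj (op ⦋s⦌))) :
    Module.Finite F ((homologyFun F s).obj P) := by
  let K := (alternatingFaceMapComplex (ModuleCat.{0} F)).obj P
  have h1 : Module.Finite F (K.cycles s) := by
    have : Module.Finite F (K.X s) := h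
    exact Module.Finite.of_injective (K.iCycles s).hom
      ((ModuleCat.mono_iff_injective _).1 inferInstance)
  exact Module.Finite.of_surjective (K.homologyπ s).hom
    ((ModuleCat.epi_iff_surjective _).1 inferInstance)

end Homological

end EMSpace

namespace EMSpace

open Opposite Simplicial

section Family

variable {F : Type} [Field F]

/-- The map `⦋n⦌ ⟶ ⦋1⦌` which is `0` up to `i` and then `1`. -/
def jump {n : ℕ} (i : Fin n) : (⦋n⦌ : SimplexCategory) ⟶ ⦋1⦌ :=
  SimplexCategory.mkHom ⟨fun j => if j ≤ i.castSucc then 0 else 1, by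
    intro a b hab
    dsimp only
    split_ifs with h1 h2
    · exact le_rfl
    · exact Fin.zero_le _
    · exact absurd (hab.trans ‹_›) h1
    · exact le_rfl⟩

lemma jump_apply {n : ℕ} (i : Fin n) (j : Fin (n + 1)) :
    (jump i).toOrderHom j = if j ≤ i.castSucc then 0 else 1 := rfl

/-- A natural family of endomorphisms of `P`, indexed by the simplices of `Δ[1]`. -/
structure HFamily (P : SMod F) where
  H : ∀ {a : SimplexCategory}, (a ⟶ ⦋1⦌) → (P.obj (op a) ⟶ P.obj (op a))
  nat : ∀ {a b : SimplexCategory} (θ : b ⟶ a) (φ : a ⟶ ⦋1⦌),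
    H φ ≫ P.map θ.op = P.map θ.op ≫ H (θ ≫ φ)

lemma HFamily.δ_comm {P : SMod F} (h : HFamily P) {n : ℕ} (φ : (⦋n + 1⦌ : SimplexCategory) ⟶ ⦋1⦌)
    (i : Fin (n + 2)) :
    h.H φ ≫ P.δ i = P.δ i ≫ h.H (SimplexCategory.δ i ≫ φ) := h.nat _ _

lemma HFamily.σ_comm {P : SMod F} (h : HFamily P) {n : ℕ} (φ : (⦋n⦌ : SimplexCategory) ⟶ ⦋1⦌)
    (i : Fin (n + 1)) :
    h.H φ ≫ P.σ i = P.σ i ≫ h.H (SimplexCategory.σ i ≫ φ) := h.nat _ _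

lemma hom_one_ext {a : SimplexCategory} {φ ψ : a ⟶ ⦋1⦌}
    (h : ∀ k, φ.toOrderHom k = 0 ↔ ψ.toOrderHom k = 0) : φ = ψ := by
  apply SimplexCategory.Hom.ext
  ext k : 2
  have := h k
  generalize φ.toOrderHom k = x at *
  generalize ψ.toOrderHom k = y at *
  change x = y
  change Fin 2 at x y
  fin_cases x <;> fin_cases y <;> simp_all

lemma jump_eq_zero_iff {n : ℕ} (i : Fin n) (j : Fin (n + 1)) :
    (jump i).toOrderHom j = 0 ↔ j.1 ≤ i.1 := by
  rw [jump_apply]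
  split_ifs with h
  · simpa [Fin.le_def] using h
  · simpa [Fin.le_def] using h

lemma δ_jump_eq_zero_iff {n : ℕ} (i : Fin (n + 1)) (k : Fin (n + 2)) (j : Fin (n + 1)) :
    (SimplexCategory.δ k ≫ jump i).toOrderHom j = 0 ↔
      (if j.1 < k.1 then j.1 else j.1 + 1) ≤ i.1 := by
  refine (jump_eq_zero_iff i (Fin.succAbove k j)).trans ?_
  rw [Fin.succAbove]
  simp only [Fin.lt_def, Fin.val_castSucc]
  split_ifs <;> simp

lemma σ_jump_eq_zero_iff {n : ℕ} (i : Fin n) (k : Fin (n + 1)) (j : Fin (n + 2)) :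
    (SimplexCategory.σ k ≫ jump i).toOrderHom j = 0 ↔
      (if k.1 < j.1 then j.1 - 1 else j.1) ≤ i.1 := by
  refine (jump_eq_zero_iff i (Fin.predAbove k j)).trans ?_
  rw [Fin.predAbove]
  simp only [Fin.lt_def, Fin.val_castSucc]
  split_ifs <;> simp

/-- The homotopy given by a family. -/
def HFamily.homotopy {P : SMod F} (h : HFamily P) {f g : P ⟶ P}
    (hf : ∀ a : SimplexCategory, f.app (op a) = h.H (SimplexCategory.const a ⦋1⦌ 0))
    (hg : ∀ a : SimplexCategory, g.app (op a) = h.H (SimplexCategory.const a ⦋1⦌ 1)) :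
    SimplicialObject.Homotopy f g where
  h i := P.σ i ≫ h.H (jump i)
  h_zero_comp_δ_zero n := by
    rw [Category.assoc, h.δ_comm, ← Category.assoc, hg]
    have h1 := P.δ_comp_σ_self (n := n) (i := 0)
    rw [Fin.castSucc_zero] at h1
    rw [h1, Category.id_comp]
    congr 1
  h_last_comp_δ_last n := by
    rw [Category.assoc, h.δ_comm, ← Category.assoc, hf]
    have h1 := P.δ_comp_σ_succ (n := n) (i := Fin.last n)
    rw [Fin.succ_last] at h1
    rw [h1, Category.id_comp]
    congr 1
    apply hom_one_ext
    intro k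
    rw [δ_jump_eq_zero_iff]
    have := k.2
    simp only [SimplexCategory.len_mk] at this
    refine iff_of_true ?_ rfl
    simp only [Fin.val_last]
    split_ifs
    omega
  h_succ_comp_δ_castSucc_of_lt i j hij := by
    rw [Category.assoc, h.δ_comm, ← Category.assoc, P.δ_comp_σ_of_le hij, Category.assoc]
    congr 3
    apply hom_one_ext
    intro k
    rw [δ_jump_eq_zero_iff, jump_eq_zero_iff]
    simp only [Fin.le_def, Fin.val_castSucc, Fin.val_succ] at *
    split_ifs <;> omega
  h_succ_comp_δ_castSucc_succ j := by
    rw [Category.assoc, h.δ_comm, ← Category.assoc, Category.assoc (P.σ j.castSucc), h.δ_comm,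
      ← Category.assoc (P.σ j.castSucc)]
    rw [P.δ_comp_σ_succ, P.δ_comp_σ_self' (by simp)]
    congr 2
    apply hom_one_ext
    intro k
    rw [δ_jump_eq_zero_iff, δ_jump_eq_zero_iff]
    simp only [Fin.val_castSucc, Fin.val_succ] at *
    split_ifs <;> omega
  h_castSucc_comp_δ_succ_of_lt i j hji := by
    rw [Category.assoc, h.δ_comm, ← Category.assoc, P.δ_comp_σ_of_gt hji, Category.assoc]
    congr 3
    apply hom_one_ext
    intro k
    rw [δ_jump_eq_zero_iff, jump_eq_zero_iff]
    simp only [Fin.lt_def, Fin.val_castSucc, Fin.val_succ] at *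
    split_ifs <;> omega
  h_comp_σ_castSucc_of_le i j hij := by
    rw [Category.assoc, h.σ_comm, ← Category.assoc, P.σ_comp_σ hij, Category.assoc]
    congr 3
    apply hom_one_ext
    intro k
    rw [σ_jump_eq_zero_iff, jump_eq_zero_iff]
    simp only [Fin.le_def, Fin.val_castSucc, Fin.val_succ] at *
    split_ifs <;> omega
  h_comp_σ_succ_of_lt i j hji := by
    rw [Category.assoc, h.σ_comm, ← Category.assoc, ← P.σ_comp_σ hji, Category.assoc]
    congr 3
    apply hom_one_ext
    intro k
    rw [σ_jump_eq_zero_iff, jump_eq_zero_iff]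
    simp only [Fin.le_def, Fin.val_castSucc, Fin.val_succ] at *
    split_ifs <;> omega

/-- A retraction onto a simplicial module which is homotopic to the identity through a natural
family is a homology isomorphism. -/
lemma HFamily.isHIso {P Q : SMod F} (h : HFamily P) (ε : P ⟶ Q) (s : Q ⟶ P)
    (hs : s ≫ ε = 𝟙 Q)
    (h1 : ∀ a : SimplexCategory, h.H (SimplexCategory.const a ⦋1⦌ 1) = 𝟙 _)
    (h0 : ∀ a : SimplexCategory,
      h.H (SimplexCategory.const a ⦋1⦌ 0) = ε.app (op a) ≫ s.app (op a)) :
    IsHIso ε := by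
  intro d
  have e := (h.homotopy (f := ε ≫ s) (g := 𝟙 P) (fun a => (h0 a).symm)
    (fun a => (h1 a).symm)).map_homology_eq d
  change (homologyFun F d).map (ε ≫ s) = (homologyFun F d).map (𝟙 P) at e
  rw [Functor.map_comp, CategoryTheory.Functor.map_id] at e
  have e' := congrArg (homologyFun F d).map hs
  rw [Functor.map_comp, CategoryTheory.Functor.map_id] at e'
  constructor
  · exact Function.LeftInverse.injective (g := ((homologyFun F d).map s).hom)
      fun x => ConcreteCategory.congr_hom e x
  · exact Function.RightInverse.surjective (g := ((homologyFun F d).map s).hom)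
      fun x => ConcreteCategory.congr_hom e' x

/-- Contractibility from a natural family. -/
lemma HFamily.subsingleton {P : SMod F} (h : HFamily P)
    (h1 : ∀ a : SimplexCategory, h.H (SimplexCategory.const a ⦋1⦌ 1) = 𝟙 _)
    (h0 : ∀ a : SimplexCategory, h.H (SimplexCategory.const a ⦋1⦌ 0) = 0) (d : ℕ) :
    Subsingleton ((homologyFun F d).obj P) := by
  have e := (h.homotopy (f := 0) (g := 𝟙 P) (fun a => (h0 a).symm)
    (fun a => (h1 a).symm)).map_homology_eq d
  change (homologyFun F d).map 0 = (homologyFun F d).map (𝟙 P) at e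
  rw [homologyFun_map_zero, CategoryTheory.Functor.map_id] at e
  exact subsingleton_of_forall_eq 0 fun x => (ConcreteCategory.congr_hom e x).symm

end Family
end EMSpace

namespace EMSpace

open Opposite Simplicial MonoidalCategory

section TrivFib

open SSet

/-- The two ends of a cylinder. -/
def cylEnds (A : SSet.{0}) : (A ⊗ Δ[1] : SSet.{0}).Subcomplex where
  obj m := {x | ∀ k, (stdSimplex.objEquiv x.2).toOrderHom k =
    (stdSimplex.objEquiv x.2).toOrderHom 0}
  map {m m'} θ x hx := by
    intro k
    exact (hx _).trans (hx _).symm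

open Classical in
/-- A map on the ends of a cylinder. -/
noncomputable def cylDesc {A B : SSet.{0}} (f g : A ⟶ B) : (cylEnds A : SSet.{0}) ⟶ B where
  app m := ↾fun x => if (stdSimplex.objEquiv x.1.2).toOrderHom 0 = 0 then f.app m x.1.1
    else g.app m x.1.1
  naturality m m' θ := by
    ext x
    have h : (stdSimplex.objEquiv (((cylEnds A : SSet.{0}).map θ x).1.2)).toOrderHom 0 =
      (stdSimplex.objEquiv x.1.2).toOrderHom 0 := x.2 _
    change (if (stdSimplex.objEquiv (((cylEnds A : SSet.{0}).map θ x).1.2)).toOrderHom 0 = 0 then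
      f.app m' (A.map θ x.1.1) else g.app m' (A.map θ x.1.1)) = B.map θ (if _ then _ else _)
    rw [h]
    split_ifs
    · exact NatTrans.naturality_apply f θ x.1.1
    · exact NatTrans.naturality_apply g θ x.1.1

/-- A trivial fibration induces isomorphisms on homology. -/
lemma exists_homologyIso_of_rlp (F : Type) [Field F] {A B : SSet.{0}} (p : A ⟶ B)
    (hp : modelCategoryQuillen.I.rlp p) (d : ℕ) :
    Function.Bijective ((homologyFun F d).map (((SimplicialObject.whiskering _ _).obj
      (ModuleCat.free F)).map p)).hom := by
  rw [← SSet.rlp_monomorphisms] at hp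
  have sq1 : CommSq (Limits.initial.to A) (Limits.initial.to B) p (𝟙 B) := ⟨by simp⟩
  have : HasLiftingProperty (Limits.initial.to B) p :=
    hp _ (inferInstance : Mono (Limits.initial.to B))
  let s := sq1.lift
  have hs : s ≫ p = 𝟙 B := sq1.fac_right
  have hlp : HasLiftingProperty (cylEnds A).ι p := hp _ (inferInstance : Mono (cylEnds A).ι)
  have sq2 : CommSq (cylDesc (p ≫ s) (𝟙 A)) (cylEnds A).ι p
      (SemiCartesianMonoidalCategory.fst A Δ[1] ≫ p) := ⟨by
    ext m x
    change p.app m (if _ then _ else _) = p.app m x.1.1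
    split_ifs
    · change (p ≫ s ≫ p).app m x.1.1 = _
      rw [hs, Category.comp_id]
    · rfl⟩
  let H : SSet.Homotopy (p ≫ s) (𝟙 A) :=
    { h := sq2.lift
      h₀ := by
        ext m x
        let y : (cylEnds A : SSet.{0}).obj m := ⟨ι₀.app m x, fun _ => rfl⟩
        refine (ConcreteCategory.congr_hom (NatTrans.congr_app sq2.fac_left m) y).trans ?_
        change (if (0 : Fin 2) = 0 then (p ≫ s).app m x else x) = (p ≫ s).app m x
        simp
      h₁ := by
        ext m x
        let y : (cylEnds A : SSet.{0}).obj m := ⟨ι₁.app m x, fun _ => rfl⟩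
        refine (ConcreteCategory.congr_hom (NatTrans.congr_app sq2.fac_left m) y).trans ?_
        change (if (1 : Fin 2) = 0 then (p ≫ s).app m x else x) = x
        simp
      rel := by
        ext m x
        exact x.1.2.elim }
  let W := (SimplicialObject.whiskering (Type) (ModuleCat.{0} F)).obj (ModuleCat.free F)
  have e := (H.toSimplicialObjectHomotopy.whiskerRight (ModuleCat.free F)).map_homology_eq d
  change (homologyFun F d).map (W.map (p ≫ s)) = (homologyFun F d).map (W.map (𝟙 A)) at e
  have e' : (homologyFun F d).map (W.map (s ≫ p)) = (homologyFun F d).map (W.map (𝟙 B)) := by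
    rw [hs]
  rw [Functor.map_comp, Functor.map_comp, CategoryTheory.Functor.map_id,
    CategoryTheory.Functor.map_id] at e e'
  constructor
  · exact Function.LeftInverse.injective (g := ((homologyFun F d).map (W.map s)).hom)
      fun x => ConcreteCategory.congr_hom e x
  · exact Function.RightInverse.surjective (g := ((homologyFun F d).map (W.map s)).hom)
      fun x => ConcreteCategory.congr_hom e' x

end TrivFib
end EMSpace

namespace EMSpace

open Opposite Simplicial

section Faces

open SSet

/-- Faces `f i` of an `(m+1)`-simplex agree on their overlaps. -/
def FaceCompat (A : SSet.{0}) {m : ℕ} (f : Fin (m + 2) → A.obj (op ⦋m⦌)) : Prop :=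
  ∀ (c : SimplexCategory) (u v : c ⟶ ⦋m⦌) (i j : Fin (m + 2)),
    u ≫ SimplexCategory.δ i = v ≫ SimplexCategory.δ j → A.map u.op (f i) = A.map v.op (f j)

/-- A trivial fibration, in terms of simplices and their faces. -/
lemma rlp_of_faces {A B : SSet.{0}} (p : A ⟶ B)
    (h0 : ∀ b : B.obj (op ⦋0⦌), ∃ a, p.app _ a = b)
    (h1 : ∀ (m : ℕ) (b : B.obj (op ⦋m + 1⦌)) (f : Fin (m + 2) → A.obj (op ⦋m⦌)),
      FaceCompat A f → (∀ i, p.app _ (f i) = B.map (SimplexCategory.δ i).op b) →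
      ∃ a : A.obj (op ⦋m + 1⦌), (∀ i, A.map (SimplexCategory.δ i).op a = f i) ∧ p.app _ a = b) :
    modelCategoryQuillen.I.rlp p := by
  intro S T g hg
  obtain ⟨n⟩ := hg
  constructor
  intro top bot sq
  rcases n with _ | m
  · obtain ⟨a, ha⟩ := h0 (SSet.yonedaEquiv bot)
    refine ⟨⟨⟨SSet.yonedaEquiv.symm a, boundary.hom_ext₀, ?_⟩⟩⟩
    apply SSet.yonedaEquiv.injective
    rw [SSet.yonedaEquiv_comp, Equiv.apply_symm_apply, ha]
  · obtain ⟨a, ha, hb⟩ := h1 m (SSet.yonedaEquiv bot) (fun i => SSet.yonedaEquiv (boundary.ι i ≫ top))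
      (by
        intro c u v i j h
        induction c using SimplexCategory.rec with | _ c =>
        rw [SSet.yonedaEquiv_naturality, SSet.yonedaEquiv_naturality, ← Category.assoc, ← Category.assoc]
        congr 2
        rw [← cancel_mono (∂Δ[m + 1]).ι, Category.assoc, Category.assoc, boundary.ι_ι,
          boundary.ι_ι]
        change SSet.stdSimplex.map _ ≫ SSet.stdSimplex.map _ = SSet.stdSimplex.map _ ≫ SSet.stdSimplex.map _
        exact (SSet.stdSimplex.map_comp u (SimplexCategory.δ i)).symm.trans ((congrArg
          (fun w => SSet.stdSimplex.map w) h).trans (SSet.stdSimplex.map_comp v _)))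
      (by
        intro i
        rw [← SSet.yonedaEquiv_comp, Category.assoc, sq.w, SSet.yonedaEquiv_naturality]
        rfl)
    refine ⟨⟨⟨SSet.yonedaEquiv.symm a, ?_, ?_⟩⟩⟩
    · apply boundary.hom_ext
      intro i
      apply SSet.yonedaEquiv.injective
      rw [← ha i, ← Category.assoc, boundary.ι_ι]
      conv_rhs => rw [← Equiv.apply_symm_apply SSet.yonedaEquiv a]
      rw [SSet.yonedaEquiv_naturality]
      rfl
    · apply SSet.yonedaEquiv.injective
      rw [SSet.yonedaEquiv_comp, Equiv.apply_symm_apply, hb]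

end Faces

section Sing

/-- The affine map of simplices induced by a map of vertices. -/
noncomputable def simpMap {k l : ℕ} (θ : Fin k → Fin l) :
    C(stdSimplex ℝ (Fin k), stdSimplex ℝ (Fin l)) :=
  ⟨stdSimplex.map θ, stdSimplex.continuous_map θ⟩

lemma simpMap_comp {k l m : ℕ} (θ : Fin k → Fin l) (η : Fin l → Fin m) :
    (simpMap η).comp (simpMap θ) = simpMap (η ∘ θ) := by
  ext1 x
  exact stdSimplex.map_comp_apply θ η x

lemma simpMap_id {k : ℕ} : simpMap (id : Fin k → Fin k) = ContinuousMap.id _ := by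
  ext1 x
  exact stdSimplex.map_id_apply x

lemma simpMap_apply {k l : ℕ} (θ : Fin k → Fin l) (x) (j : Fin l) :
    simpMap θ x j = ∑ i with θ i = j, x i := by
  change stdSimplex.map θ x j = _
  rw [stdSimplex.map_coe, FunOnFinite.linearMap_apply_apply]

/-- The singular simplicial set, with simplices continuous maps on standard simplices. -/
noncomputable def sing (X : Type) [TopologicalSpace X] : SSet.{0} where
  obj a := C(stdSimplex ℝ (Fin (a.unop.len + 1)), X)
  map θ := ↾fun f => f.comp (simpMap θ.unop.toOrderHom)
  map_id a := by
    refine ConcreteCategory.hom_ext _ _ fun f => ?_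
    change f.comp (simpMap id) = f
    rw [simpMap_id, ContinuousMap.comp_id]
  map_comp θ η := by
    refine ConcreteCategory.hom_ext _ _ fun f => ?_
    change f.comp (simpMap (θ.unop.toOrderHom ∘ η.unop.toOrderHom)) = _
    rw [← simpMap_comp]
    rfl

/-- Mathlib's singular simplicial set agrees with `sing`. -/
noncomputable def toSSetIso (X : TopCat.{0}) : TopCat.toSSet.obj X ≅ sing X :=
  NatIso.ofComponents (fun a => (TopCat.toSSetObjEquiv X a).toIso) (by
    intro a b θ
    ext f
    rfl)

end Sing

end EMSpace

namespace EMSpace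

open Opposite Simplicial

open scoped unitInterval

section Glue

/-- The standard topological simplex of dimension `k`. -/
abbrev Sim (k : ℕ) : Type := _root_.stdSimplex ℝ (Fin (k + 1))

/-- The inclusion of the `i`-th face. -/
noncomputable abbrev dl {k : ℕ} (i : Fin (k + 2)) : C(Sim k, Sim (k + 1)) :=
  simpMap (Fin.succAbove i)

lemma dl_apply_succAbove {k : ℕ} (i : Fin (k + 2)) (x : Sim k) (j : Fin (k + 1)) :
    dl i x (i.succAbove j) = x j := by
  rw [simpMap_apply, Finset.sum_eq_single_of_mem j (by simp)]
  intro b hb hne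
  exact absurd (Fin.succAbove_right_injective (Finset.mem_filter.1 hb).2) hne

lemma dl_apply_self {k : ℕ} (i : Fin (k + 2)) (x : Sim k) : dl i x i = 0 := by
  rw [simpMap_apply]
  apply Finset.sum_eq_zero
  intro b hb
  exact absurd (Finset.mem_filter.1 hb).2 (Fin.succAbove_ne i b)

lemma dl_injective {k : ℕ} (i : Fin (k + 2)) : Function.Injective (dl i) := by
  intro x y h
  ext j
  rw [← dl_apply_succAbove i x, h, dl_apply_succAbove]

lemma exists_dl_eq {k : ℕ} (i : Fin (k + 2)) (p : Sim (k + 1)) (h : p i = 0) :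
    ∃ x, dl i x = p := by
  refine ⟨⟨fun j => p (i.succAbove j), fun j => p.2.1 _, ?_⟩, ?_⟩
  · have := p.2.2
    rw [Fin.sum_univ_succAbove _ i] at this
    change p i + _ = 1 at this
    rwa [h, zero_add] at this
  · ext j
    rcases Fin.eq_self_or_eq_succAbove i j with rfl | ⟨j, rfl⟩
    · rw [dl_apply_self, h]
    · rw [dl_apply_succAbove]
      rfl

lemma continuous_coord {k : ℕ} (i : Fin k) :
    Continuous fun p : _root_.stdSimplex ℝ (Fin k) => p i :=
  (continuous_apply i).comp continuous_subtype_val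

/-- Pointwise compatibility of the faces in a set `T`. -/
def Compat {X : Type*} {m : ℕ} (T : Set (Fin (m + 2))) (f : Fin (m + 2) → Sim m → X) : Prop :=
  ∀ i ∈ T, ∀ j ∈ T, ∀ x y, dl i x = dl j y → f i x = f j y

lemma exists_glue {X : Type*} [TopologicalSpace X] [Nonempty X] {m : ℕ} (T : Set (Fin (m + 2)))
    (f : Fin (m + 2) → C(Sim m, X)) (hf : Compat T fun i => f i) :
    ∃ F : Sim (m + 1) → X, ContinuousOn F {p | ∃ i ∈ T, p i = 0} ∧
      ∀ i ∈ T, ∀ x, F (dl i x) = f i x := by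
  classical
  let ρ (i : Fin (m + 2)) : Fin (m + 2) → Fin (m + 1) := Function.invFun i.succAbove
  have hρ (i : Fin (m + 2)) (x) : simpMap (ρ i) (dl i x) = x := by
    have h : ρ i ∘ i.succAbove = id :=
      Function.invFun_comp Fin.succAbove_right_injective
    have := congrArg (fun g => g x) (simpMap_comp i.succAbove (ρ i))
    simpa [h, simpMap_id] using this
  let F : Sim (m + 1) → X := fun p => if h : ∃ i ∈ T, p i = 0 then
    f h.choose (simpMap (ρ h.choose) p) else Classical.arbitrary X
  have hF (i) (hi : i ∈ T) (x) : F (dl i x) = f i x := by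
    have h : ∃ j ∈ T, dl i x j = 0 := ⟨i, hi, dl_apply_self i x⟩
    simp only [F, dif_pos h]
    obtain ⟨y, hy⟩ := exists_dl_eq h.choose (dl i x) h.choose_spec.2
    have h2 : f h.choose y = f i x := hf _ h.choose_spec.1 i hi y x hy
    rw [← h2]
    exact (congrArg _ (congrArg _ hy.symm)).trans (congrArg _ (hρ h.choose y))
  refine ⟨F, ?_, hF⟩
  have : (Set.ofPred fun p : Sim (m + 1) => ∃ i ∈ T, p i = 0) =
      ⋃ i : T, Set.ofPred fun p : Sim (m + 1) => p i.1 = 0 := by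
    ext p; simp
  rw [this]
  refine (locallyFinite_of_finite _).continuousOn_iUnion
    (fun i => isClosed_eq (continuous_coord i.1) continuous_const) ?_
  rintro ⟨i, hi⟩
  refine ((f i).continuous.comp (simpMap (ρ i)).continuous).continuousOn.congr ?_
  intro p hp
  obtain ⟨x, rfl⟩ := exists_dl_eq i p hp
  simp [hF i hi, hρ]

lemma FaceCompat.compat {X : Type} [TopologicalSpace X] {m : ℕ}
    {f : Fin (m + 2) → C(Sim m, X)} (hf : FaceCompat (sing X) f) :
    Compat Set.univ fun i => f i := by
  intro i _ j _ x y h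
  set p := dl i x with hp
  let S : Finset (Fin (m + 2)) := Finset.univ.filter fun k => p k ≠ 0
  have hS : S.Nonempty := by
    by_contra hS
    have := p.2.2
    rw [Finset.sum_eq_zero] at this
    · exact zero_ne_one this
    · intro k _
      by_contra hk
      exact hS ⟨k, Finset.mem_filter.2 ⟨Finset.mem_univ _, hk⟩⟩
  obtain ⟨c, hc⟩ := Nat.exists_eq_succ_of_ne_zero hS.card_pos.ne'
  let e := S.orderEmbOfFin hc
  let w : ⦋c⦌ ⟶ ⦋m + 1⦌ := SimplexCategory.Hom.mk e.toOrderHom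
  have hw (k) (hk : p k = 0) (l : Fin (c + 1)) : w.toOrderHom l ≠ k := by
    rintro rfl
    exact (Finset.mem_filter.1 (S.orderEmbOfFin_mem hc l)).2 hk
  have hpi : p i = 0 := dl_apply_self i x
  have hpj : p j = 0 := h ▸ dl_apply_self j y
  obtain ⟨u, hu⟩ := SimplexCategory.eq_comp_δ_of_not_surjective' w i (hw i hpi)
  obtain ⟨v, hv⟩ := SimplexCategory.eq_comp_δ_of_not_surjective' w j (hw j hpj)
  have himg : Finset.univ.image e = S := Finset.image_orderEmbOfFin_univ S hc
  let q : Sim c := ⟨fun l => p (e l), fun l => p.2.1 _, by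
    have : ∑ k ∈ Finset.univ.image e, p k = 1 := by
      rw [himg, ← p.2.2]
      exact Finset.sum_filter_ne_zero Finset.univ
    rwa [Finset.sum_image (fun a _ b _ hab => e.injective hab)] at this⟩
  have hq : simpMap w.toOrderHom q = p := by
    ext k
    rw [simpMap_apply]
    by_cases hk : p k = 0
    · rw [hk]
      exact Finset.sum_eq_zero fun l hl => absurd (Finset.mem_filter.1 hl).2 (hw k hk l)
    · have : k ∈ Finset.univ.image e := himg ▸ Finset.mem_filter.2 ⟨Finset.mem_univ _, hk⟩
      obtain ⟨l, -, rfl⟩ := Finset.mem_image.1 this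
      refine Finset.sum_eq_single_of_mem (f := fun b => q b) l
        (Finset.mem_filter.2 ⟨Finset.mem_univ _, rfl⟩) ?_
      · intro b hb hne
        exact absurd (e.injective (Finset.mem_filter.1 hb).2) hne
  have hx : simpMap u.toOrderHom q = x := by
    apply dl_injective i
    rw [← hp, ← hq, hu]
    exact congrArg (fun g => g q) (simpMap_comp u.toOrderHom i.succAbove)
  have hy : simpMap v.toOrderHom q = y := by
    apply dl_injective j
    rw [← h, ← hq, hv]
    exact congrArg (fun g => g q) (simpMap_comp v.toOrderHom j.succAbove)
  have := hf _ u v i j (hu.symm.trans hv)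
  rw [← hx, ← hy]
  exact congrArg (fun g : C(Sim c, X) => g q) this

end Glue

section Gauge

/-- A radial structure on a space, with boundary `{g = 1}`. -/
structure Gauge (D : Type) [TopologicalSpace D] where
  /-- the gauge function -/
  g : D → ℝ
  cont : Continuous g
  le_one : ∀ x, g x ≤ 1
  nonneg : ∀ x, 0 ≤ g x
  /-- radial rescaling by `μ⁻¹` -/
  sc : D × ℝ → D
  sc_cont : ContinuousOn sc {y | g y.1 ≤ y.2 ∧ 0 < y.2}
  sc_g : ∀ x μ, g x ≤ μ → 0 < μ → g (sc (x, μ)) = g x / μ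
  sc_one : ∀ x, sc (x, 1) = x

variable {D : Type} [TopologicalSpace D]

/-- The homotopy extension property for the boundary. -/
lemma Gauge.extend (G : Gauge D) {X : Type} [TopologicalSpace X] (b : C(D, X)) (f : D → C(I, X))
    (hf : ContinuousOn f {x | G.g x = 1}) (hb : ∀ x, G.g x = 1 → f x 0 = b x) :
    ∃ H : C(D × I, X), (∀ x, H (x, 0) = b x) ∧ ∀ x s, G.g x = 1 → H (x, s) = f x s := by
  classical
  let μ : D × I → ℝ := fun y => max (G.g y.1) ((2 - y.2) / 2)
  have hμc : Continuous μ := by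
    have := G.cont
    fun_prop
  have hs (s : I) : (0 : ℝ) ≤ s ∧ (s : ℝ) ≤ 1 := s.2
  have hμ0 (y) : 0 < μ y := lt_max_of_lt_right (by linarith [(hs y.2).2])
  have hμg (y) : G.g y.1 ≤ μ y := le_max_left _ _
  have hμ1 (y) : μ y ≤ 1 := max_le (G.le_one _) (by linarith [(hs y.2).1])
  have hht (y : D × I) : 2 - (2 - (y.2 : ℝ)) / μ y ∈ I := by
    have h1 : (2 - (y.2 : ℝ)) / 2 ≤ μ y := le_max_right _ _
    constructor
    · rw [sub_nonneg, div_le_iff₀ (hμ0 y)]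
      linarith
    · rw [sub_le_comm, le_div_iff₀ (hμ0 y)]
      linarith [hμ1 y, (hs y.2).2]
  let r : D × I → D × I := fun y => (G.sc (y.1, μ y), ⟨_, hht y⟩)
  have hr : Continuous r := by
    refine Continuous.prodMk ?_ (Continuous.subtype_mk ?_ _)
    · exact G.sc_cont.comp_continuous (f := fun y : D × I => (y.1, μ y)) (by fun_prop)
        fun y => ⟨hμg y, hμ0 y⟩
    · exact continuous_const.sub (Continuous.div (by fun_prop) hμc fun y => (hμ0 y).ne')
  let A : Set (D × I) := {y | G.g y.1 = 1}
  let B : Set (D × I) := {y | y.2 = 0}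
  have hrAB (y) : r y ∈ A ∪ B := by
    rcases max_choice (G.g y.1) ((2 - (y.2 : ℝ)) / 2) with h | h
    · left
      change G.g (G.sc (y.1, μ y)) = 1
      rw [G.sc_g _ _ (hμg y) (hμ0 y), div_eq_one_iff_eq (hμ0 y).ne']
      exact h.symm
    · right
      refine Subtype.ext ?_
      change 2 - (2 - (y.2 : ℝ)) / μ y = 0
      have h' : μ y = (2 - (y.2 : ℝ)) / 2 := h
      have := hs y.2
      rw [h']
      have : 2 - (y.2 : ℝ) ≠ 0 := by linarith
      field_simp
      ring
  let K : D × I → X := fun y => if G.g y.1 = 1 then f y.1 y.2 else b y.1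
  have hK : ContinuousOn K (A ∪ B) := by
    refine ContinuousOn.union_of_isClosed ?_ ?_
      (isClosed_eq (G.cont.comp continuous_fst) continuous_const)
      (isClosed_eq continuous_snd continuous_const)
    · have h1 : ContinuousOn (fun y : D × I => f y.1 y.2) A := by
        have : ContinuousOn (fun y : D × I => (f y.1, y.2)) A :=
          (hf.comp continuousOn_fst fun y hy => hy).prodMk continuousOn_snd
        exact (ContinuousEval.continuous_eval (F := C(I, X))).comp_continuousOn this
      exact h1.congr fun y hy => if_pos hy
    · refine (b.continuous.comp continuous_fst).continuousOn.congr fun y hy => ?_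
      have hy : y.2 = 0 := hy
      simp only [K, hy]
      split_ifs with h
      · exact hb _ h
      · rfl
  refine ⟨⟨fun y => K (r y), hK.comp_continuous hr hrAB⟩, fun x => ?_, fun x s hx => ?_⟩
  · have h1 : μ (x, 0) = 1 := by simp [μ, G.le_one]
    have h2 : r (x, 0) = (x, 0) := by
      refine Prod.ext ?_ (Subtype.ext ?_)
      · simp [r, h1, G.sc_one]
      · simp [r, h1]
    change K (r (x, 0)) = _
    rw [h2]
    simp only [K]
    split_ifs with h
    · exact hb _ h
    · rfl
  · have h1 : μ (x, s) = 1 := by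
      simp only [μ, hx, sup_eq_left]
      linarith [(hs s).1]
    have h2 : r (x, s) = (x, s) := by
      refine Prod.ext ?_ (Subtype.ext ?_)
      · simp [r, h1, G.sc_one]
      · simp [r, h1]
    change K (r (x, s)) = _
    rw [h2]
    exact if_pos hx

end Gauge

end EMSpace

namespace EMSpace

open scoped unitInterval

section SimGauge

/-- The gauge function of the simplex, centred at the barycentre. -/
noncomputable def simG {k : ℕ} (p : Sim k) : ℝ :=
  Finset.univ.sup' Finset.univ_nonempty fun i => 1 - (k + 1) * p i

lemma le_simG {k : ℕ} (p : Sim k) (i) : 1 - (k + 1) * p i ≤ simG p :=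
  Finset.le_sup' (fun i => 1 - (k + 1) * p i) (Finset.mem_univ i)

lemma exists_simG {k : ℕ} (p : Sim k) : ∃ i, simG p = 1 - (k + 1) * p i := by
  obtain ⟨i, -, h⟩ := Finset.exists_mem_eq_sup' Finset.univ_nonempty
    fun i => 1 - ((k : ℝ) + 1) * p i
  exact ⟨i, h⟩

lemma continuous_simG {k : ℕ} : Continuous (simG : Sim k → ℝ) := by
  exact Continuous.finset_sup'_apply _ fun i _ =>
    continuous_const.sub (continuous_const.mul (continuous_coord i))

lemma simG_eq_one {k : ℕ} {p : Sim k} : simG p = 1 ↔ ∃ i, p i = 0 := by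
  constructor
  · intro h
    obtain ⟨i, hi⟩ := exists_simG p
    refine ⟨i, ?_⟩
    have : ((k : ℝ) + 1) * p i = 0 := by linarith
    rcases mul_eq_zero.1 this with h | h
    · exact absurd h (by positivity)
    · exact h
  · rintro ⟨i, hi⟩
    refine le_antisymm ?_ (by simpa [hi] using le_simG p i)
    obtain ⟨j, hj⟩ := exists_simG p
    have : 0 ≤ ((k : ℝ) + 1) * p j := mul_nonneg (by positivity) (p.2.1 j)
    linarith

/-- Rescaling of points of the simplex. -/
noncomputable def simSc {k : ℕ} (p : Sim k) (μ : ℝ) (h : simG p ≤ μ ∧ 0 < μ) : Sim k :=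
  ⟨fun i => 1 / (k + 1) + (p i - 1 / (k + 1)) / μ, fun i => by
    have h1 := (le_simG p i).trans h.1
    have hk : (0 : ℝ) < k + 1 := by positivity
    have : 1 / ((k : ℝ) + 1) + (p i - 1 / (k + 1)) / μ =
      (μ - (1 - (k + 1) * p i)) / ((k + 1) * μ) := by
      have := h.2
      field_simp
      ring
    exact (div_nonneg (by linarith) (mul_pos hk h.2).le).trans_eq this.symm, by
    rw [Finset.sum_add_distrib, ← Finset.sum_div, ← Finset.sum_div, Finset.sum_sub_distrib]
    have h2 : ∑ i, p i = 1 := p.2.2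
    have hk : (k : ℝ) + 1 ≠ 0 := by positivity
    simp [h2, hk]⟩

open Classical in
/-- The gauge of the simplex. -/
noncomputable def simGauge (k : ℕ) : Gauge (Sim k) where
  g := simG
  cont := continuous_simG
  le_one p := by
    obtain ⟨j, hj⟩ := exists_simG p
    have : 0 ≤ ((k : ℝ) + 1) * p j := mul_nonneg (by positivity) (p.2.1 j)
    linarith
  nonneg p := by
    have h : ∑ i : Fin (k + 1), (1 - ((k : ℝ) + 1) * p i) ≤ ∑ i : Fin (k + 1), simG p :=
      Finset.sum_le_sum fun i _ => le_simG p i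
    have h2 : ∑ i, p i = 1 := p.2.2
    rw [Finset.sum_sub_distrib, ← Finset.mul_sum, h2] at h
    simp only [Finset.sum_const, Finset.card_univ, Fintype.card_fin, nsmul_eq_mul] at h
    push_cast at h
    have hk : (0 : ℝ) < k + 1 := by positivity
    nlinarith
  sc y := if h : simG y.1 ≤ y.2 ∧ 0 < y.2 then simSc y.1 y.2 h else y.1
  sc_cont := by
    rw [continuousOn_iff_continuous_domRestrict]
    have : Continuous fun y : {y : Sim k × ℝ | simG y.1 ≤ y.2 ∧ 0 < y.2} =>
        simSc y.1.1 y.1.2 y.2 := by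
      refine Continuous.subtype_mk (continuous_pi fun i => ?_) _
      have h1 : Continuous fun y : {y : Sim k × ℝ | simG y.1 ≤ y.2 ∧ 0 < y.2} => y.1.1 i :=
        (continuous_coord i).comp (by fun_prop)
      exact continuous_const.add (Continuous.div (h1.sub continuous_const) (by fun_prop)
        fun y => y.2.2.ne')
    exact this.congr fun y => (dif_pos y.2).symm
  sc_g p μ h1 h2 := by
    rw [dif_pos ⟨h1, h2⟩]
    have hk : (0 : ℝ) < k + 1 := by positivity
    have key (i) : 1 - (k + 1) * simSc p μ ⟨h1, h2⟩ i = (1 - (k + 1) * p i) / μ := by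
      change 1 - ((k : ℝ) + 1) * (1 / (k + 1) + (p i - 1 / (k + 1)) / μ) = _
      field_simp
      ring
    apply le_antisymm
    · obtain ⟨i, hi⟩ := exists_simG (simSc p μ ⟨h1, h2⟩)
      rw [hi, key]
      exact div_le_div_of_nonneg_right (le_simG p i) h2.le
    · obtain ⟨i, hi⟩ := exists_simG p
      refine (congrArg (· / μ) hi).trans_le ?_
      dsimp only
      rw [← key]
      exact le_simG _ i
  sc_one p := by
    dsimp only
    split_ifs with h
    · ext i
      change 1 / ((k : ℝ) + 1) + (p i - 1 / (k + 1)) / 1 = p i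
      ring
    · rfl

/-- The gauge of a cylinder. -/
noncomputable def Gauge.cyl {D : Type} [TopologicalSpace D] (G : Gauge D) : Gauge (D × I) where
  g y := max (G.g y.1) |2 * (y.2 : ℝ) - 1|
  cont := by
    have := G.cont
    fun_prop
  le_one y := by
    refine max_le (G.le_one _) (abs_le.2 ⟨?_, ?_⟩) <;> linarith [y.2.2.1, y.2.2.2]
  nonneg y := le_max_of_le_left (G.nonneg _)
  sc y := (G.sc (y.1.1, y.2), Set.projIcc 0 1 zero_le_one (1 / 2 + (y.1.2 - 1 / 2) / y.2))
  sc_cont := by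
    refine ContinuousOn.prodMk ?_ ?_
    · refine G.sc_cont.comp (f := fun y : (D × I) × ℝ => (y.1.1, y.2)) (by fun_prop) ?_
      exact fun y hy => ⟨(le_max_left _ _).trans hy.1, hy.2⟩
    · refine continuous_projIcc.comp_continuousOn ?_
      exact continuousOn_const.add (ContinuousOn.div (by fun_prop) (by fun_prop)
        fun y hy => hy.2.ne')
  sc_g y μ h1 h2 := by
    have h3 := abs_le.1 ((le_max_right _ _).trans h1)
    have h4 : 1 / 2 + ((y.2 : ℝ) - 1 / 2) / μ = (μ + (2 * y.2 - 1)) / (2 * μ) := by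
      field_simp
    have h5 : 1 / 2 + ((y.2 : ℝ) - 1 / 2) / μ ∈ Set.Icc (0 : ℝ) 1 := by
      rw [h4]
      constructor
      · exact div_nonneg (by linarith) (by linarith)
      · rw [div_le_one (by linarith)]
        linarith
    simp only [Set.projIcc_of_mem _ h5]
    rw [G.sc_g _ _ ((le_max_left _ _).trans h1) h2, h4,
      show 2 * ((μ + (2 * (y.2 : ℝ) - 1)) / (2 * μ)) - 1 = (2 * y.2 - 1) / μ by field_simp; ring,
      abs_div, abs_of_pos h2, max_div_div_right h2.le]
  sc_one y := by
    refine Prod.ext (G.sc_one _) ?_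
    have : 1 / 2 + ((y.2 : ℝ) - 1 / 2) / 1 = y.2 := by ring
    simp only [this]
    exact Set.projIcc_val _ _

lemma Gauge.cyl_eq_one {D : Type} [TopologicalSpace D] (G : Gauge D) {y : D × I} :
    G.cyl.g y = 1 ↔ G.g y.1 = 1 ∨ y.2 = 0 ∨ y.2 = 1 := by
  have h1 := G.le_one y.1
  have h2 := y.2.2.1
  have h3 := y.2.2.2
  have h4 : |2 * (y.2 : ℝ) - 1| ≤ 1 := abs_le.2 ⟨by linarith, by linarith⟩
  have h5 : |2 * (y.2 : ℝ) - 1| = 1 ↔ y.2 = 0 ∨ y.2 = 1 := by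
    rw [abs_eq zero_le_one, or_comm]
    refine or_congr ⟨fun h => Subtype.ext ?_, fun h => ?_⟩ ⟨fun h => Subtype.ext ?_, fun h => ?_⟩
    · change (y.2 : ℝ) = 0
      linarith
    · rw [h]; simp
    · change (y.2 : ℝ) = 1
      linarith
    · rw [h]; norm_num
  change max _ _ = 1 ↔ _
  rw [← h5]
  constructor
  · intro h
    rcases max_choice (G.g y.1) |2 * (y.2 : ℝ) - 1| with h' | h'
    · exact Or.inl (h'.symm.trans h)
    · exact Or.inr (h'.symm.trans h)
  · rintro (h | h)
    · rw [h, max_eq_left h4]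
    · rw [h, max_eq_right h1]

end SimGauge

section Horn

/-- Horns extend. -/
lemma exists_horn {X : Type} [TopologicalSpace X] [Nonempty X] {m : ℕ} (k : Fin (m + 2))
    (f : Fin (m + 2) → C(Sim m, X)) (hf : Compat {i | i ≠ k} fun i => f i) :
    ∃ K : C(Sim (m + 1), X), ∀ i, i ≠ k → ∀ x, K (dl i x) = f i x := by
  obtain ⟨F, hF, hFi⟩ := exists_glue _ f hf
  have hne : (Finset.univ.erase k).Nonempty :=
    ⟨k.succAbove 0, by simp [Fin.succAbove_ne]⟩
  let c (p : Sim (m + 1)) : ℝ := (Finset.univ.erase k).inf' hne fun i => p i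
  have hc1 (p) (i) (hi : i ≠ k) : c p ≤ p i :=
    Finset.inf'_le (fun i => p i) (Finset.mem_erase.2 ⟨hi, Finset.mem_univ _⟩)
  have hc2 (p) : ∃ i, i ≠ k ∧ c p = p i := by
    obtain ⟨i, hi, h⟩ := Finset.exists_mem_eq_inf' hne fun i => p i
    exact ⟨i, (Finset.mem_erase.1 hi).1, h⟩
  have hc0 (p) : 0 ≤ c p := by
    obtain ⟨i, -, hi⟩ := hc2 p
    rw [hi]; exact p.2.1 i
  have hcc : Continuous c :=
    Continuous.finset_inf'_apply hne fun i _ => continuous_coord i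
  let r (p : Sim (m + 1)) : Sim (m + 1) :=
    ⟨fun i => p i - c p + (if i = k then (m + 2) * c p else 0), fun i => by
      have h5 := hc0 p
      dsimp only
      split_ifs with h
      · have h3 : 0 ≤ (m : ℝ) * c p := by positivity
        have h4 : 0 ≤ p i := p.2.1 i
        linarith
      · have := hc1 p i h
        linarith, by
      rw [Finset.sum_add_distrib, Finset.sum_sub_distrib]
      have h2 : ∑ i, p i = 1 := p.2.2
      simp [h2]
      ring⟩
  have hr : Continuous r := by
    refine Continuous.subtype_mk (continuous_pi fun i => ?_) _
    refine ((continuous_coord i).sub hcc).add ?_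
    split_ifs
    · exact continuous_const.mul hcc
    · exact continuous_const
  refine ⟨⟨fun p => F (r p), hF.comp_continuous hr fun p => ?_⟩, fun i hi x => ?_⟩
  · obtain ⟨i, hi, h⟩ := hc2 p
    refine ⟨i, hi, ?_⟩
    change p i - c p + (if i = k then (m + 2) * c p else 0) = 0
    rw [if_neg hi, h]
    ring
  · have h0 : c (dl i x) = 0 :=
      le_antisymm ((hc1 _ i hi).trans (dl_apply_self i x).le) (hc0 _)
    have : r (dl i x) = dl i x := by
      ext j
      change dl i x j - c (dl i x) + (if j = k then (m + 2) * c (dl i x) else 0) = _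
      rw [h0]
      simp
    change F (r (dl i x)) = _
    rw [this, hFi i hi]

end Horn

end EMSpace

namespace EMSpace

open scoped unitInterval

section QMap

/-- The collapse of the cube onto the simplex, in coordinates. -/
noncomputable def qfun : (k : ℕ) → (Fin k → I) → Fin (k + 1) → ℝ
  | 0, _ => fun _ => 1
  | k + 1, t => Fin.cons (1 - (t 0 : ℝ)) fun j => t 0 * qfun k (fun i => t i.succ) j

lemma qfun_nonneg : ∀ (k : ℕ) (t : Fin k → I) (i), 0 ≤ qfun k t i
  | 0, _, _ => zero_le_one
  | k + 1, t, i => by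
    refine Fin.cases ?_ (fun i => ?_) i
    · exact sub_nonneg.2 (t 0).2.2
    · exact mul_nonneg (t 0).2.1 (qfun_nonneg k _ i)

lemma qfun_sum : ∀ (k : ℕ) (t : Fin k → I), ∑ i, qfun k t i = 1
  | 0, _ => by simp [qfun]
  | k + 1, t => by
    rw [Fin.sum_univ_succ]
    simp only [qfun, Fin.cons_zero, Fin.cons_succ]
    rw [← Finset.mul_sum, qfun_sum k]
    ring

lemma continuous_qfun : ∀ k : ℕ, Continuous (qfun k)
  | 0 => continuous_const
  | k + 1 => by
    refine continuous_pi fun i => ?_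
    refine Fin.cases ?_ (fun i => ?_) i
    · change Continuous fun t : Fin (k + 1) → I => 1 - (t 0 : ℝ)
      fun_prop
    · change Continuous fun t : Fin (k + 1) → I => (t 0 : ℝ) * qfun k (fun i => t i.succ) i
      have h : Continuous fun t : Fin (k + 1) → I => qfun k (fun i => t i.succ) :=
        (continuous_qfun k).comp (by fun_prop)
      have h2 := (continuous_apply i).comp h
      exact Continuous.mul (by fun_prop) h2

/-- The collapse of the cube onto the simplex. -/
noncomputable def qmap (k : ℕ) : C(Fin k → I, Sim k) :=
  ⟨fun t => ⟨qfun k t, qfun_nonneg k t, qfun_sum k t⟩,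
    Continuous.subtype_mk (continuous_qfun k) _⟩

lemma qfun_surj : ∀ (k : ℕ) (p : Fin (k + 1) → ℝ), (∀ i, 0 ≤ p i) → ∑ i, p i = 1 →
    ∃ t, qfun k t = p
  | 0, p, _, h => ⟨fun _ => 0, by
      ext i
      obtain rfl : i = 0 := Fin.fin_one_eq_zero i
      simpa [qfun] using h.symm⟩
  | k + 1, p, h0, h1 => by
    rw [Fin.sum_univ_succ] at h1
    have hs : 0 ≤ ∑ i : Fin (k + 1), p i.succ := Finset.sum_nonneg fun i _ => h0 _
    by_cases hp : ∑ i : Fin (k + 1), p i.succ = 0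
    · refine ⟨fun _ => 0, ?_⟩
      ext i
      refine Fin.cases ?_ (fun i => ?_) i
      · simp only [qfun, Fin.cons_zero]
        rw [hp, add_zero] at h1
        simp [h1]
      · have := (Finset.sum_eq_zero_iff_of_nonneg fun i _ => h0 (Fin.succ i)).1 hp i
          (Finset.mem_univ _)
        simp [qfun, this]
    · obtain ⟨t, ht⟩ := qfun_surj k (fun i => p i.succ / ∑ i : Fin (k + 1), p i.succ)
        (fun i => div_nonneg (h0 _) hs) (by rw [← Finset.sum_div, div_self hp])
      have h2 := h0 0
      refine ⟨Fin.cons ⟨∑ i : Fin (k + 1), p i.succ, hs, by linarith⟩ t, ?_⟩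
      ext i
      refine Fin.cases ?_ (fun i => ?_) i
      · simp only [qfun, Fin.cons_zero]
        linarith
      · simp only [qfun, Fin.cons_zero, Fin.cons_succ, ht]
        field_simp

lemma qmap_surjective (k : ℕ) : Function.Surjective (qmap k) := fun p => by
  obtain ⟨t, ht⟩ := qfun_surj k p p.2.1 p.2.2
  exact ⟨t, Subtype.ext ht⟩

lemma qfun_fiber : ∀ (k : ℕ) (t t' : Fin k → I), qfun k t = qfun k t' →
    t = t' ∨ ((∃ j, j.val + 1 < k ∧ t j = 0) ∧ ∃ j, j.val + 1 < k ∧ t' j = 0)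
  | 0, t, t', _ => Or.inl (Subsingleton.elim _ _)
  | k + 1, t, t', h => by
    have h0 : t 0 = t' 0 := by
      have := congrFun h 0
      simp only [qfun, Fin.cons_zero, sub_right_inj] at this
      exact Subtype.ext this
    by_cases ht : t 0 = 0
    · rcases k with _ | k
      · left
        ext i
        rw [Fin.fin_one_eq_zero i, h0]
      · exact Or.inr ⟨⟨0, by simp, ht⟩, ⟨0, by simp, h0 ▸ ht⟩⟩
    · have hk : qfun k (fun i => t i.succ) = qfun k (fun i => t' i.succ) := by
        ext i
        have := congrFun h i.succ
        simp only [qfun, Fin.cons_succ, h0] at this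
        exact mul_left_cancel₀ (fun h => ht (h0.trans (Subtype.ext h))) this
      rcases qfun_fiber k _ _ hk with h1 | ⟨⟨j, hj, hj'⟩, l, hl, hl'⟩
      · left
        ext i
        refine Fin.cases (by rw [h0]) (fun i => ?_) i
        exact congrArg Subtype.val (congrFun h1 i)
      · exact Or.inr ⟨⟨j.succ, by simpa using hj, hj'⟩, l.succ, by simpa using hl, hl'⟩

lemma qfun_eq_zero_of_zero : ∀ (k : ℕ) (t : Fin k → I) (j : Fin k) (i : Fin (k + 1)),
    t j = 0 → j.val < i.val → qfun k t i = 0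
  | k + 1, t, j, i, h, hji => by
    obtain ⟨i, rfl⟩ := Fin.exists_succ_eq.2 (fun h0 : i = 0 => by simp [h0] at hji)
    simp only [qfun, Fin.cons_succ]
    rcases Fin.eq_zero_or_eq_succ j with rfl | ⟨j, rfl⟩
    · simp [h]
    · rw [qfun_eq_zero_of_zero k _ j i h (by simpa using hji), mul_zero]

lemma boundary_of_qfun : ∀ (k : ℕ) (t : Fin k → I) (i : Fin (k + 1)),
    qfun k t i = 0 → ∃ j, t j = 0 ∨ t j = 1
  | 0, t, i, h => absurd h one_ne_zero
  | k + 1, t, i, h => by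
    rcases Fin.eq_zero_or_eq_succ i with rfl | ⟨i, rfl⟩
    · refine ⟨0, Or.inr (Subtype.ext ?_)⟩
      simp only [qfun, Fin.cons_zero] at h
      exact (sub_eq_zero.1 h).symm
    · simp only [qfun, Fin.cons_succ] at h
      rcases mul_eq_zero.1 h with h | h
      · exact ⟨0, Or.inl (Subtype.ext h)⟩
      · obtain ⟨j, hj⟩ := boundary_of_qfun k _ i h
        exact ⟨j.succ, hj⟩

lemma coe_dl {k : ℕ} (i : Fin (k + 2)) (x : Sim k) :
    (dl i x : Fin (k + 2) → ℝ) = i.insertNth (α := fun _ => ℝ) 0 x := by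
  ext j
  rcases Fin.eq_self_or_eq_succAbove i j with rfl | ⟨j, rfl⟩
  · rw [Fin.insertNth_apply_same]
    exact dl_apply_self _ x
  · rw [Fin.insertNth_apply_succAbove]
    exact dl_apply_succAbove _ x j

lemma qfun_one : ∀ (k : ℕ) (t : Fin (k + 1) → I) (j : Fin (k + 1)), t j = 1 →
    qfun (k + 1) t =
      j.castSucc.insertNth (α := fun _ => ℝ) 0 (qfun k fun i => t (j.succAbove i)) := by
  intro k t j
  induction k with
  | zero =>
    intro h
    obtain rfl : j = 0 := Fin.fin_one_eq_zero j
    ext i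
    fin_cases i <;> simp [qfun, h]
  | succ k ih =>
    intro h
    rcases Fin.eq_zero_or_eq_succ j with rfl | ⟨j, rfl⟩
    · ext i
      refine Fin.cases ?_ (fun i => ?_) i
      · simp [qfun, h]
      · rw [Fin.castSucc_zero, Fin.insertNth_zero']
        rw [qfun]
        simp [h]
    · ext i
      rw [qfun, ih (fun i => t i.succ) j h, Fin.castSucc_succ]
      rcases Fin.eq_zero_or_eq_succ i with rfl | ⟨i, rfl⟩
      · rw [show (0 : Fin (k + 1 + 1 + 1)) = j.castSucc.succ.succAbove 0 by simp,
          Fin.insertNth_apply_succAbove]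
        simp [qfun]
      · rw [Fin.cons_succ]
        rcases Fin.eq_self_or_eq_succAbove j.castSucc i with rfl | ⟨i, rfl⟩
        · simp
        · rw [← Fin.succ_succAbove_succ, Fin.insertNth_apply_succAbove,
            Fin.insertNth_apply_succAbove]
          simp [qfun]

lemma qfun_last : ∀ (k : ℕ) (t : Fin (k + 1) → I), t (Fin.last k) = 0 →
    qfun (k + 1) t =
      (Fin.last (k + 1)).insertNth (α := fun _ => ℝ) 0 (qfun k fun i => t i.castSucc) := by
  intro k t
  induction k with
  | zero =>
    intro h
    have h : t 0 = 0 := h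
    ext i
    rcases Fin.eq_self_or_eq_succAbove (Fin.last 1) i with rfl | ⟨i, rfl⟩
    · rw [Fin.insertNth_apply_same, show Fin.last 1 = Fin.succ 0 from rfl]
      simp [qfun, h]
    · rw [Fin.insertNth_apply_succAbove]
      obtain rfl : i = 0 := Subsingleton.elim _ _
      rw [Fin.succAbove_last]
      simp [qfun, h]
  | succ k ih =>
    intro h
    ext i
    rw [qfun, ih (fun i => t i.succ) h]
    rcases Fin.eq_zero_or_eq_succ i with rfl | ⟨i, rfl⟩
    · rw [show (0 : Fin (k + 1 + 1 + 1)) = (Fin.last (k + 2)).succAbove 0 by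
        rw [Fin.succAbove_last]; rfl, Fin.insertNth_apply_succAbove]
      rw [Fin.succAbove_last]
      simp [qfun]
    · rw [Fin.cons_succ]
      rcases Fin.eq_self_or_eq_succAbove (Fin.last (k + 1)) i with rfl | ⟨i, rfl⟩
      · rw [Fin.insertNth_apply_same, Fin.succ_last, Fin.insertNth_apply_same, mul_zero]
      · rw [← Fin.succ_succAbove_succ, Fin.succ_last, Fin.insertNth_apply_succAbove,
          Fin.insertNth_apply_succAbove]
        simp [qfun]

lemma qmap_one {k : ℕ} (t : Fin (k + 1) → I) (j : Fin (k + 1)) (h : t j = 1) :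
    qmap (k + 1) t = dl j.castSucc (qmap k fun i => t (j.succAbove i)) := by
  ext1
  rw [coe_dl]
  exact qfun_one k t j h

lemma qmap_last {k : ℕ} (t : Fin (k + 1) → I) (h : t (Fin.last k) = 0) :
    qmap (k + 1) t = dl (Fin.last _) (qmap k fun i => t i.castSucc) := by
  ext1
  rw [coe_dl]
  exact qfun_last k t h

/-- A point of the simplex is on the boundary. -/
def OnBd {k : ℕ} (p : Sim k) : Prop := ∃ i, p i = 0

lemma onBd_qmap {k : ℕ} {t : Fin k → I} : OnBd (qmap k t) ↔ t ∈ Cube.boundary (Fin k) := by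
  constructor
  · rintro ⟨i, hi⟩
    exact boundary_of_qfun k t i hi
  · rintro ⟨j, hj | hj⟩
    · exact ⟨Fin.last k, qfun_eq_zero_of_zero k t j _ hj j.2⟩
    · rcases k with _ | k
      · exact j.elim0
      · rw [qmap_one t j hj]
        exact ⟨_, dl_apply_self _ _⟩

/-- Maps from the cube descend to the simplex. -/
lemma exists_descend {X Z : Type} [TopologicalSpace X] [TopologicalSpace Z] [CompactSpace Z]
    [T2Space Z] {k : ℕ} (g : C((Fin k → I) × Z, X))
    (hg : ∀ t t' z, (∃ j, j.val + 1 < k ∧ t j = 0) → (∃ j, j.val + 1 < k ∧ t' j = 0) →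
      g (t, z) = g (t', z)) :
    ∃ w : C(Sim k × Z, X), ∀ t z, w (qmap k t, z) = g (t, z) := by
  let Q : C((Fin k → I) × Z, Sim k × Z) := (qmap k).prodMap (ContinuousMap.id Z)
  have hQ : Topology.IsQuotientMap Q :=
    Topology.IsQuotientMap.of_surjective_continuous
      ((qmap_surjective k).prodMap Function.surjective_id) Q.continuous
  have h : ∀ a b, Q a = Q b → g a = g b := by
    rintro ⟨t, z⟩ ⟨t', z'⟩ e
    obtain ⟨e1, e2⟩ := Prod.ext_iff.1 e
    obtain rfl : z = z' := e2
    rcases qfun_fiber k t t' (congrArg Subtype.val e1) with rfl | ⟨h1, h2⟩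
    · rfl
    · exact hg _ _ _ h1 h2
  refine ⟨hQ.lift g h, fun t z => ?_⟩
  exact congrArg (fun f : C((Fin k → I) × Z, X) => f (t, z)) (hQ.lift_comp g h)

end QMap

end EMSpace

namespace EMSpace

open scoped unitInterval

section Fill

variable {X : Type} [TopologicalSpace X]

/-- A map on the simplex which is constant on the boundary. -/
def BdConst {m : ℕ} (x : X) (e : C(Sim m, X)) : Prop := ∀ p, OnBd p → e p = x

/-- The generalized loop of a map on the simplex which is constant on the boundary. -/
noncomputable def loopOf {m : ℕ} {x : X} (e : C(Sim m, X)) (h : BdConst x e) :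
    GenLoop (Fin m) X x :=
  ⟨e.comp (qmap m), fun _ ht => h _ (onBd_qmap.2 ht)⟩

/-- The homotopy class of a map on the simplex which is constant on the boundary. -/
noncomputable def clsOf {m : ℕ} {x : X} (e : C(Sim m, X)) (h : BdConst x e) :
    HomotopyGroup (Fin m) X x :=
  Quotient.mk _ (loopOf e h)

lemma onBd_of_collapse {m : ℕ} {t : Fin m → I} (h : ∃ j : Fin m, j.val + 1 < m ∧ t j = 0) :
    t ∈ Cube.boundary (Fin m) := by
  obtain ⟨j, -, hj⟩ := h
  exact ⟨j, Or.inl hj⟩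

lemma exists_homotopy_of_cls_eq {m : ℕ} {x : X} {e e' : C(Sim m, X)} (h : BdConst x e)
    (h' : BdConst x e') (hc : clsOf e h = clsOf e' h') :
    ∃ H : C(Sim m × I, X), (∀ p, H (p, 0) = e p) ∧ (∀ p, H (p, 1) = e' p) ∧
      ∀ p s, OnBd p → H (p, s) = x := by
  obtain ⟨K⟩ : GenLoop.Homotopic (loopOf e h) (loopOf e' h') := Quotient.exact hc
  have hK (t : Fin m → I) (s) (ht : t ∈ Cube.boundary (Fin m)) : K (s, t) = x :=
    (K.eq_fst s ht).trans ((loopOf e h).2 t ht)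
  obtain ⟨w, hw⟩ := exists_descend (k := m) (Z := I)
    (⟨fun y => K (y.2, y.1), by fun_prop⟩ : C((Fin m → I) × I, X))
    (fun t t' z ht ht' => (hK t z (onBd_of_collapse ht)).trans
      (hK t' z (onBd_of_collapse ht')).symm)
  refine ⟨w, fun p => ?_, fun p => ?_, fun p s hp => ?_⟩ <;>
    obtain ⟨t, rfl⟩ := qmap_surjective m p <;> rw [hw]
  · exact K.apply_zero t
  · exact K.apply_one t
  · exact hK t s (onBd_qmap.1 hp)

lemma exists_nullhomotopy {m : ℕ} {x : X} [Subsingleton (HomotopyGroup (Fin m) X x)]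
    {e : C(Sim m, X)} (h : BdConst x e) :
    ∃ H : C(Sim m × I, X), (∀ p, H (p, 0) = e p) ∧ (∀ p, H (p, 1) = x) ∧
      ∀ p s, OnBd p → H (p, s) = x :=
  exists_homotopy_of_cls_eq (e' := ContinuousMap.const _ x) h (fun _ _ => rfl)
    (Subsingleton.elim _ _)

/-- Filling of a cylinder with constant top. -/
lemma exists_cyl_fill {m : ℕ} {x : X} [Subsingleton (HomotopyGroup (Fin m) X x)]
    (b : C(Sim m, X)) (f : Sim m → C(I, X)) (hf : ContinuousOn f {p | OnBd p})
    (hb : ∀ p, OnBd p → f p 0 = b p) (h1 : ∀ p, OnBd p → f p 1 = x) :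
    ∃ H : C(Sim m × I, X), (∀ p, H (p, 0) = b p) ∧ (∀ p, H (p, 1) = x) ∧
      ∀ p s, OnBd p → H (p, s) = f p s := by
  classical
  have hset : {p : Sim m | (simGauge m).g p = 1} = {p | OnBd p} :=
    Set.ext fun p => simG_eq_one
  obtain ⟨H', h0', hs'⟩ := (simGauge m).extend b f (by rwa [hset])
    (fun p hp => hb p (simG_eq_one.1 hp))
  let e : C(Sim m, X) := ⟨fun p => H' (p, 1), by fun_prop⟩
  have he : BdConst x e := fun p hp => (hs' p 1 (simG_eq_one.2 hp)).trans (h1 p hp)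
  obtain ⟨h, hh0, hh1, hhs⟩ := exists_nullhomotopy he
  let φ : Sim m × I → C(I, X) := fun y =>
    if y.2 = 1 then h.curry y.1 else ContinuousMap.const _ (H' y)
  have hφ0 (y) : φ y 0 = H' y := by
    simp only [φ]
    split_ifs with hy
    · obtain ⟨p, s⟩ := y
      obtain rfl : s = 1 := hy
      exact hh0 p
    · rfl
  have hφc (y : Sim m × I) (hy : OnBd y.1 ∨ y.2 = 0) : φ y = ContinuousMap.const _ (H' y) := by
    simp only [φ]
    split_ifs with h2
    · obtain ⟨p, s⟩ := y
      obtain rfl : s = 1 := h2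
      rcases hy with hy | hy
      · ext r
        exact (hhs p r hy).trans (he p hy).symm
      · exact absurd hy one_ne_zero
    · rfl
  have hcl : IsClosed {p : Sim m | OnBd p} := by
    rw [← hset]
    exact isClosed_eq (simGauge m).cont continuous_const
  obtain ⟨W, hW0, hWs⟩ := (simGauge m).cyl.extend H' φ (by
    have : {y : Sim m × I | (simGauge m).cyl.g y = 1} =
        {y | y.2 = 1} ∪ {y | OnBd y.1 ∨ y.2 = 0} := by
      ext y
      change (simGauge m).cyl.g y = 1 ↔ y.2 = 1 ∨ (OnBd y.1 ∨ y.2 = 0)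
      rw [Gauge.cyl_eq_one]
      have : (simGauge m).g y.1 = 1 ↔ OnBd y.1 := simG_eq_one
      tauto
    rw [this]
    refine ContinuousOn.union_of_isClosed ?_ ?_ (isClosed_eq continuous_snd continuous_const) ?_
    · exact (h.curry.continuous.comp continuous_fst).continuousOn.congr fun y hy => if_pos hy
    · exact (ContinuousMap.continuous_const'.comp H'.continuous).continuousOn.congr hφc
    · exact (hcl.preimage continuous_fst).union (isClosed_eq continuous_snd continuous_const))
    (fun y _ => hφ0 y)
  refine ⟨⟨fun y => W (y, 1), by fun_prop⟩, fun p => ?_, fun p => ?_, fun p s hp => ?_⟩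
  · refine (hWs (p, 0) 1 ((simGauge m).cyl_eq_one.2 (by simp))).trans ?_
    rw [hφc _ (Or.inr rfl)]
    exact h0' p
  · refine (hWs (p, 1) 1 ((simGauge m).cyl_eq_one.2 (by simp))).trans ?_
    simp only [φ, if_true]
    exact hh1 p
  · refine (hWs (p, s) 1 ((simGauge m).cyl_eq_one.2 (Or.inl (simG_eq_one.2 hp)))).trans ?_
    rw [hφc _ (Or.inl hp)]
    exact hs' p s (simG_eq_one.2 hp)

/-- Homotopies given on the faces extend. -/
lemma exists_face_homotopy {m : ℕ} (b : C(Sim (m + 1), X))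
    (G : Fin (m + 2) → C(Sim m × I, X))
    (hG : ∀ i j x y s, dl i x = dl j y → G i (x, s) = G j (y, s))
    (h0 : ∀ i x, G i (x, 0) = b (dl i x)) :
    ∃ H : C(Sim (m + 1) × I, X), (∀ p, H (p, 0) = b p) ∧
      ∀ i x s, H (dl i x, s) = G i (x, s) := by
  have : Nonempty C(I, X) := ⟨ContinuousMap.const _ (b (Classical.arbitrary _))⟩
  obtain ⟨F, hF, hFi⟩ := exists_glue (X := C(I, X)) Set.univ (fun i => (G i).curry)
    (fun i _ j _ x y h => ContinuousMap.ext fun s => hG i j x y s h)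
  have hset : {p : Sim (m + 1) | (simGauge (m + 1)).g p = 1} =
      {p | ∃ i ∈ Set.univ, p i = 0} :=
    Set.ext fun p => by
      change simG p = 1 ↔ ∃ i ∈ Set.univ, p i = 0
      rw [simG_eq_one]
      simp
  obtain ⟨H, hH0, hHs⟩ := (simGauge (m + 1)).extend b F (by rwa [hset]) (by
    intro p hp
    obtain ⟨i, hi⟩ := simG_eq_one.1 hp
    obtain ⟨x, rfl⟩ := exists_dl_eq i p hi
    rw [hFi i trivial]
    exact h0 i x)
  refine ⟨H, hH0, fun i x s => ?_⟩
  rw [hHs _ s (simG_eq_one.2 ⟨i, dl_apply_self i x⟩), hFi i trivial]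
  rfl

lemma onBd_of_dl_eq {m : ℕ} {i j : Fin (m + 2)} (hij : i ≠ j) {x y : Sim m}
    (h : dl i x = dl j y) : OnBd x := by
  obtain ⟨l, rfl⟩ := Fin.exists_succAbove_eq hij.symm
  refine ⟨l, ?_⟩
  rw [← dl_apply_succAbove i x, h, dl_apply_self]

/-- The straight-line contraction of the simplex to a vertex. -/
noncomputable def contract (k : ℕ) : C(Sim k × I, Sim k) where
  toFun y := ⟨fun i => (1 - (y.2 : ℝ)) * y.1 i + y.2 * (if i = 0 then 1 else 0), fun i => by
    have h1 : 0 ≤ (1 - (y.2 : ℝ)) * y.1 i := mul_nonneg (sub_nonneg.2 y.2.2.2) (y.1.2.1 i)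
    have h2 := y.2.2.1
    dsimp only
    split_ifs <;> linarith, by
    rw [Finset.sum_add_distrib, ← Finset.mul_sum, ← Finset.mul_sum]
    have h2 : ∑ i, y.1 i = 1 := y.1.2.2
    simp [h2]⟩
  continuous_toFun := by
    refine Continuous.subtype_mk (continuous_pi fun i => ?_) _
    refine Continuous.add (Continuous.mul (by fun_prop)
      ((continuous_coord i).comp continuous_fst)) (by fun_prop)

lemma contract_zero {k : ℕ} (p : Sim k) : contract k (p, 0) = p := by
  ext i
  change (1 - ((0 : I) : ℝ)) * p i + ((0 : I) : ℝ) * (if i = 0 then 1 else 0) = p i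
  simp

lemma contract_one {k : ℕ} (p q : Sim k) : contract k (p, 1) = contract k (q, 1) := by
  ext i
  change (1 - ((1 : I) : ℝ)) * p i + ((1 : I) : ℝ) * (if i = 0 then 1 else 0) =
    (1 - ((1 : I) : ℝ)) * q i + ((1 : I) : ℝ) * (if i = 0 then 1 else 0)
  simp

/-- Filling of spheres. -/
lemma exists_sphere_fill {m : ℕ} (hX : ∀ x : X, Subsingleton (HomotopyGroup (Fin m) X x))
    (f : Fin (m + 2) → C(Sim m, X)) (hf : Compat Set.univ fun i => f i) :
    ∃ K : C(Sim (m + 1), X), ∀ i x, K (dl i x) = f i x := by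
  classical
  have : Nonempty X := ⟨f 0 (Classical.arbitrary _)⟩
  obtain ⟨K, hK⟩ := exists_horn 0 f fun i _ j _ x y h => hf i trivial j trivial x y h
  have hK0 (x) (hx : OnBd x) : K (dl 0 x) = f 0 x := by
    obtain ⟨l, hl⟩ := hx
    have h2 : dl 0 x (Fin.succAbove 0 l) = 0 := by rw [dl_apply_succAbove, hl]
    obtain ⟨y, hy⟩ := exists_dl_eq _ _ h2
    rw [← hy, hK _ (Fin.succAbove_ne 0 l)]
    exact hf _ trivial 0 trivial _ _ hy
  let G (i : Fin (m + 2)) : C(Sim m × I, X) :=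
    ⟨fun y => K (contract (m + 1) (dl i y.1, y.2)), by fun_prop⟩
  have hG0 (i x) : G i (x, 0) = K (dl i x) := congrArg K (contract_zero _)
  set x1 := K (contract (m + 1) (Classical.arbitrary _, 1)) with hx1
  have hG1 (i x) : G i (x, 1) = x1 := congrArg K (contract_one _ _)
  obtain ⟨H₀, h00, h0s⟩ := (simGauge m).extend (f 0) (G 0).curry
    (G 0).curry.continuous.continuousOn (fun x hx => by
      rw [← hK0 x (simG_eq_one.1 hx), ← hG0]
      rfl)
  let e : C(Sim m, X) := ⟨fun p => H₀ (p, 1), by fun_prop⟩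
  have he : BdConst x1 e := fun p hp => (h0s p 1 (simG_eq_one.2 hp)).trans (hG1 0 p)
  obtain ⟨h, hh0, hh1, hhs⟩ := exists_nullhomotopy he
  let hrev : C(Sim m × I, X) := ⟨fun y => h (y.1, unitInterval.symm y.2), by fun_prop⟩
  have compat (A : C(Sim m × I, X)) (B : Fin (m + 2) → C(Sim m × I, X))
      (hB : ∀ i j x y s, dl i x = dl j y → B i (x, s) = B j (y, s))
      (hA : ∀ x s, OnBd x → A (x, s) = B 0 (x, s)) :
      ∀ i j x y s, dl i x = dl j y → (if i = 0 then A else B i) (x, s) =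
        (if j = 0 then A else B j) (y, s) := by
    intro i j x y s hxy
    by_cases hij : i = j
    · subst hij
      rw [dl_injective i hxy]
    · have hx := onBd_of_dl_eq hij hxy
      have hy := onBd_of_dl_eq (Ne.symm hij) hxy.symm
      split_ifs with hi hj hj
      · exact absurd (hi.trans hj.symm) hij
      · subst hi
        rw [hA _ _ hx, hB _ _ _ _ _ hxy]
      · subst hj
        rw [hA _ _ hy, hB _ _ _ _ _ hxy]
      · exact hB _ _ _ _ _ hxy
  obtain ⟨H₁, -, h1i⟩ := exists_face_homotopy (ContinuousMap.const _ x1)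
    (fun i => if i = 0 then hrev else ContinuousMap.const _ x1)
    (compat hrev (fun _ => ContinuousMap.const _ x1) (fun _ _ _ _ _ _ => rfl)
      (fun x s hx => hhs _ _ hx)) (fun i x => by
        split_ifs
        · change h (x, unitInterval.symm 0) = x1
          rw [unitInterval.symm_zero, hh1]
        · rfl)
  let b₂ : C(Sim (m + 1), X) := ⟨fun p => H₁ (p, 1), by fun_prop⟩
  let R (A : C(Sim m × I, X)) : C(Sim m × I, X) :=
    ⟨fun y => A (y.1, unitInterval.symm y.2), by fun_prop⟩
  obtain ⟨H₂, -, h2i⟩ := exists_face_homotopy b₂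
    (fun i => if i = 0 then R H₀ else R (G i))
    (compat _ (fun i => R (G i)) (fun i j x y s hxy => congrArg
      (fun z => K (contract (m + 1) (z, unitInterval.symm s))) hxy)
      (fun x s hx => h0s x _ (simG_eq_one.2 hx))) (fun i x => by
        change _ = H₁ (dl i x, 1)
        rw [h1i]
        split_ifs
        · change H₀ (x, unitInterval.symm 0) = h (x, unitInterval.symm 1)
          rw [unitInterval.symm_zero, unitInterval.symm_one, hh0]
          rfl
        · change G i (x, unitInterval.symm 0) = x1
          rw [unitInterval.symm_zero, hG1])
  refine ⟨⟨fun p => H₂ (p, 1), by fun_prop⟩, fun i x => ?_⟩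
  change H₂ (dl i x, 1) = _
  rw [h2i]
  split_ifs with hi
  · subst hi
    change H₀ (x, unitInterval.symm 1) = _
    rw [unitInterval.symm_one, h00]
  · change G i (x, unitInterval.symm 1) = _
    rw [unitInterval.symm_one, hG0, hK i hi]

end Fill

end EMSpace

namespace EMSpace

open Opposite

open scoped unitInterval

section Skeleton

variable {X : Type} [TopologicalSpace X]

/-- A singular simplex whose `N`-dimensional faces are constant. -/
def SkelConst (N : ℕ) (x : X) {k : ℕ} (e : C(Sim k, X)) : Prop :=
  ∀ (ι : Fin (N + 1) →o Fin (k + 1)) (p : Sim N), e (simpMap ι p) = x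

lemma simpMap_simpMap {k l m : ℕ} (θ : Fin k → Fin l) (η : Fin l → Fin m)
    (x : stdSimplex ℝ (Fin k)) : simpMap η (simpMap θ x) = simpMap (η ∘ θ) x :=
  DFunLike.congr_fun (simpMap_comp θ η) x

lemma simpMap_id_apply {k : ℕ} (x : stdSimplex ℝ (Fin k)) :
    simpMap (fun i : Fin k => i) x = x :=
  DFunLike.congr_fun simpMap_id x

lemma SkelConst.comp {N : ℕ} {x : X} {k l : ℕ} {e : C(Sim k, X)} (h : SkelConst N x e)
    (θ : Fin (l + 1) →o Fin (k + 1)) : SkelConst N x (e.comp (simpMap θ)) := fun ι p => by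
  change e (simpMap θ (simpMap ι p)) = x
  rw [simpMap_simpMap]
  exact h (θ.comp ι) p

lemma skelConst_const (N : ℕ) (x : X) (k : ℕ) :
    SkelConst N x (ContinuousMap.const (Sim k) x) := fun _ _ => rfl

lemma SkelConst.eq_const {N : ℕ} {x : X} {k : ℕ} {e : C(Sim k, X)} (h : SkelConst N x e)
    (hk : k ≤ N) (p : Sim k) : e p = x := by
  have hι : Monotone fun i : Fin (N + 1) => (⟨min i.val k, by omega⟩ : Fin (k + 1)) := by
    intro i j hij
    have : i.val ≤ j.val := hij
    simp only [Fin.mk_le_mk]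
    omega
  have := h ⟨_, hι⟩ (simpMap (Fin.castLE (by omega)) p)
  rw [simpMap_simpMap] at this
  convert this using 2
  conv_lhs => rw [← simpMap_id_apply p]
  congr 2
  funext i
  ext
  simp
  omega

lemma exists_succAbove_comp {N m : ℕ} (h : N ≤ m) (ι : Fin (N + 1) →o Fin (m + 2)) :
    ∃ (i : Fin (m + 2)) (κ : Fin (N + 1) →o Fin (m + 1)), ∀ j, ι j = i.succAbove (κ j) := by
  have hns : ¬ Function.Surjective (SimplexCategory.Hom.toOrderHom
      (SimplexCategory.Hom.mk ι : SimplexCategory.mk N ⟶ SimplexCategory.mk (m + 1))) := by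
    intro hs
    have h2 := Fintype.card_le_of_surjective _ hs
    simp only [Fintype.card_fin, SimplexCategory.len_mk] at h2
    omega
  obtain ⟨i, θ, h⟩ := SimplexCategory.eq_comp_δ_of_not_surjective _ hns
  exact ⟨i, θ.toOrderHom, fun j => congrArg (fun w => w.toOrderHom j) h⟩

lemma skelConst_iff_faces {N : ℕ} {x : X} {m : ℕ} (h : N ≤ m) {e : C(Sim (m + 1), X)} :
    SkelConst N x e ↔ ∀ i, SkelConst N x (e.comp (dl i)) := by
  refine ⟨fun he i => he.comp (Fin.succAboveOrderEmb i).toOrderHom, fun he ι p => ?_⟩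
  obtain ⟨i, κ, hκ⟩ := exists_succAbove_comp h ι
  have := he i κ p
  change e (dl i (simpMap κ p)) = x at this
  rw [simpMap_simpMap] at this
  rw [← this]
  congr 3
  exact funext hκ

/-- Singular simplices with constant `N`-skeleton. -/
noncomputable def skel (N : ℕ) (x : X) : SSet.{0} where
  obj a := {e : C(Sim a.unop.len, X) // SkelConst N x e}
  map θ := ↾fun f => ⟨f.1.comp (simpMap θ.unop.toOrderHom), f.2.comp θ.unop.toOrderHom⟩
  map_id a := by
    refine ConcreteCategory.hom_ext _ _ fun f => Subtype.ext ?_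
    change f.1.comp (simpMap id) = f.1
    rw [simpMap_id, ContinuousMap.comp_id]
  map_comp θ η := by
    refine ConcreteCategory.hom_ext _ _ fun f => Subtype.ext ?_
    change f.1.comp (simpMap (θ.unop.toOrderHom ∘ η.unop.toOrderHom)) = _
    rw [← simpMap_comp]
    rfl

/-- Evaluation of a simplex of paths. -/
def evAt {k : ℕ} (e : C(Sim k, C(I, X))) (s : I) : C(Sim k, X) :=
  ⟨fun p => e p s, (continuous_eval_const s).comp e.continuous⟩

/-- Simplices of paths, whose end has constant `N`-skeleton. -/
noncomputable def pathSkel (N : ℕ) (x : X) : SSet.{0} where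
  obj a := {e : C(Sim a.unop.len, C(I, X)) // SkelConst N x (evAt e 1)}
  map θ := ↾fun f => ⟨f.1.comp (simpMap θ.unop.toOrderHom), f.2.comp θ.unop.toOrderHom⟩
  map_id a := by
    refine ConcreteCategory.hom_ext _ _ fun f => Subtype.ext ?_
    change f.1.comp (simpMap id) = f.1
    rw [simpMap_id, ContinuousMap.comp_id]
  map_comp θ η := by
    refine ConcreteCategory.hom_ext _ _ fun f => Subtype.ext ?_
    change f.1.comp (simpMap (θ.unop.toOrderHom ∘ η.unop.toOrderHom)) = _
    rw [← simpMap_comp]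
    rfl

/-- The start of a simplex of paths. -/
noncomputable def pathStart (N : ℕ) (x : X) : pathSkel N x ⟶ sing X where
  app _ := ↾fun f => evAt f.1 0

/-- The end of a simplex of paths. -/
noncomputable def pathEnd (N : ℕ) (x : X) : pathSkel N x ⟶ skel N x where
  app _ := ↾fun f => ⟨evAt f.1 1, f.2⟩

open scoped Simplicial in
lemma pathSkel_compat {N : ℕ} {x : X} {m : ℕ} {f : Fin (m + 2) → (pathSkel N x).obj (op ⦋m⦌)}
    (hf : FaceCompat (pathSkel N x) f) : Compat Set.univ fun i => (f i).1 :=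
  FaceCompat.compat (X := C(I, X)) (f := fun i => (f i).1)
    fun c u v i j h => congrArg Subtype.val (hf c u v i j h)

lemma not_onBd_zero (p : Sim 0) : ¬ OnBd p := by
  rintro ⟨i, hi⟩
  have := p.2.2
  rw [Fin.sum_univ_one] at this
  rw [Fin.fin_one_eq_zero i] at hi
  exact zero_ne_one (hi.symm.trans this)

lemma skelConst_of_const {N : ℕ} {x : X} {k : ℕ} {e : C(Sim k, X)} (h : ∀ p, e p = x) :
    SkelConst N x e := fun _ _ => h _

lemma pathStart_rlp {N : ℕ} {x : X}
    (hX : ∀ i, i ≤ N → Subsingleton (HomotopyGroup (Fin i) X x)) :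
    SSet.modelCategoryQuillen.I.rlp (pathStart N x) := by
  apply rlp_of_faces
  · intro b
    have := hX 0 (Nat.zero_le _)
    obtain ⟨H, h0, h1, -⟩ := exists_cyl_fill (x := x) (m := 0) b
      (fun _ => ContinuousMap.const _ x)
      (fun p hp => absurd hp (not_onBd_zero p)) (fun p hp => absurd hp (not_onBd_zero p))
      (fun p hp => absurd hp (not_onBd_zero p))
    exact ⟨⟨H.curry, skelConst_of_const h1⟩, ContinuousMap.ext h0⟩
  · intro m (b : C(Sim (m + 1), X)) f hf hb
    have hc := pathSkel_compat hf
    have hb' (i x) : (f i).1 x 0 = b (dl i x) :=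
      DFunLike.congr_fun (show (evAt (f i).1 0 : C(Sim m, X)) = b.comp (dl i) from hb i) x
    rcases Nat.lt_or_ge m N with hm | hm
    · have : Nonempty C(I, X) := ⟨(f 0).1 (Classical.arbitrary _)⟩
      have := hX (m + 1) hm
      obtain ⟨F, hF, hFi⟩ := exists_glue Set.univ _ hc
      have hset : {p : Sim (m + 1) | ∃ i ∈ Set.univ, p i = 0} = {p | OnBd p} :=
        Set.ext fun p => by
          change (∃ i ∈ Set.univ, p i = 0) ↔ OnBd p
          simp [OnBd]
      rw [hset] at hF
      obtain ⟨H, h0, h1, hs⟩ := exists_cyl_fill (x := x) b F hF (by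
        rintro p ⟨i, hi⟩
        obtain ⟨y, rfl⟩ := exists_dl_eq i p hi
        rw [hFi i trivial, hb']) (by
        rintro p ⟨i, hi⟩
        obtain ⟨y, rfl⟩ := exists_dl_eq i p hi
        rw [hFi i trivial]
        exact (f i).2.eq_const hm.le y)
      refine ⟨⟨H.curry, skelConst_of_const h1⟩, fun i => Subtype.ext ?_, ContinuousMap.ext h0⟩
      refine ContinuousMap.ext fun y => ContinuousMap.ext fun s => ?_
      refine (hs (dl i y) s ⟨i, dl_apply_self i y⟩).trans ?_
      rw [hFi i trivial]
    · obtain ⟨H, h0, hi⟩ := exists_face_homotopy b (fun i => (f i).1.uncurry)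
        (fun i j y z s h => DFunLike.congr_fun (hc i trivial j trivial y z h) s)
        (fun i y => hb' i y)
      have hf1 (i) : H.curry.comp (dl i) = (f i).1 :=
        ContinuousMap.ext fun y => ContinuousMap.ext fun s => hi i y s
      refine ⟨⟨H.curry, (skelConst_iff_faces hm).2 fun i => ?_⟩, fun i => Subtype.ext (hf1 i),
        ContinuousMap.ext h0⟩
      have : (evAt H.curry 1).comp (dl i) = evAt (f i).1 1 := by
        rw [← hf1]
        rfl
      rw [this]
      exact (f i).2

lemma pathEnd_rlp (N : ℕ) (x : X) :
    SSet.modelCategoryQuillen.I.rlp (pathEnd N x) := by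
  apply rlp_of_faces
  · intro b
    exact ⟨⟨⟨fun p => ContinuousMap.const _ (b.1 p),
      ContinuousMap.continuous_const'.comp b.1.continuous⟩, b.2⟩, rfl⟩
  · intro m b f hf hb
    have hc := pathSkel_compat hf
    have hb' (i x) : (f i).1 x 1 = b.1 (dl i x) :=
      DFunLike.congr_fun (congrArg Subtype.val (hb i) : evAt (f i).1 1 = b.1.comp (dl i)) x
    obtain ⟨H, h0, hi⟩ := exists_face_homotopy b.1
      (fun i => ⟨fun y => (f i).1 y.1 (unitInterval.symm y.2), by
        exact (f i).1.uncurry.continuous.comp (by fun_prop : Continuous fun y : Sim m × I =>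
          (y.1, unitInterval.symm y.2))⟩)
      (fun i j y z s h => DFunLike.congr_fun (hc i trivial j trivial y z h) (unitInterval.symm s))
      (fun i y => by
        change (f i).1 y (unitInterval.symm 0) = _
        rw [unitInterval.symm_zero, hb'])
    let K : C(Sim (m + 1) × I, X) := ⟨fun y => H (y.1, unitInterval.symm y.2), by fun_prop⟩
    have hK1 : evAt K.curry 1 = b.1 := by
      refine ContinuousMap.ext fun p => ?_
      change H (p, unitInterval.symm 1) = b.1 p
      rw [unitInterval.symm_one, h0]
    refine ⟨⟨K.curry, hK1 ▸ b.2⟩, fun i => Subtype.ext ?_, Subtype.ext hK1⟩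
    refine ContinuousMap.ext fun y => ContinuousMap.ext fun s => ?_
    refine (hi i y _).trans ?_
    change (f i).1 y (unitInterval.symm (unitInterval.symm s)) = _
    rw [unitInterval.symm_symm]

end Skeleton

end EMSpace

namespace EMSpace

section Filling

/-- The index of the `i`-th element different from `a`. -/
def skip (a i : ℕ) : ℕ := if i < a then i else i + 1

/-- The tuple with entries `x` at the indices `k` and `y` at `l`. -/
def tup {E : Type*} (pt : E) (k l : ℕ) (x y : E) (i : ℕ) : E :=
  if i = k then x else if i = l then y else pt

/-- Combinatorial properties of the boundaries of `(n+1)`-simplices with constant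
`(n-1)`-skeleton. -/
structure FillSystem (E : Type*) (n : ℕ) where
  /-- the constant simplex -/
  pt : E
  /-- being a boundary -/
  T : (ℕ → E) → Prop
  /-- the homotopy class -/
  c : E → ℤ
  c_pt : c pt = 0
  congr : ∀ f g : ℕ → E, (∀ i < n + 2, f i = g i) → T f → T g
  horn : ∀ k (f : ℕ → E), k < n + 2 → ∃ g, (∀ i, i ≠ k → g i = f i) ∧ T g
  sphere : ∀ (s : ℕ → ℕ → E) (k), k < n + 3 → (∀ a b, a ≠ b → s a b = s b a) →
    (∀ a < n + 3, a ≠ k → T fun i => s a (skip a i)) → T fun i => s k (skip k i)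
  degen : ∀ k f, k < n + 1 → T (tup pt k (k + 1) f f)
  homot : ∀ f f', c f = c f' → T (tup pt n (n + 1) f f')
  base : ∀ f : ℕ → E, (∀ i, i + 1 < n → f i = pt) → T f → c (f (n - 1)) + c (f (n + 1)) = c (f n)

namespace FillSystem

variable {E : Type*} {n : ℕ} (S : FillSystem E n)

/-- The alternating sum of the classes of the faces. -/
def del (f : ℕ → E) : ℤ := ∑ i ∈ Finset.range (n + 2), (-1) ^ i * S.c (f i)

lemma del_pt : S.del (fun _ => S.pt) = 0 := by simp [del, S.c_pt]

lemma del_tup {k : ℕ} (hk : k < n + 1) (f : E) : S.del (tup S.pt k (k + 1) f f) = 0 := by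
  rw [del, Finset.sum_eq_add_of_mem k (k + 1) (by simp; omega) (by simp; omega) (by omega)]
  · simp [tup, pow_succ]
  · intro i _ hi
    simp [tup, hi.1, hi.2, S.c_pt]

lemma T_pt (hn : 1 ≤ n) : S.T fun _ => S.pt :=
  S.congr _ _ (fun i _ => by simp [tup]) (S.degen 0 S.pt (by omega))

lemma del_sum (s : ℕ → ℕ → E) (hs : ∀ a b, a ≠ b → s a b = s b a) :
    ∑ a ∈ Finset.range (n + 3), (-1) ^ a * S.del (fun i => s a (skip a i)) = 0 := by
  simp only [del, Finset.mul_sum]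
  rw [← Finset.sum_product']
  have inv (a i : ℕ) : skip (skip a i) (if i < a then a - 1 else a) = a := by
    unfold skip
    split_ifs <;> omega
  have key (a i : ℕ) : s (skip a i) a = s a (skip a i) :=
    hs _ _ (by unfold skip; split_ifs <;> omega)
  refine Finset.sum_involution
    (fun (q : ℕ × ℕ) _ => ((skip q.1 q.2, if q.2 < q.1 then q.1 - 1 else q.1) : ℕ × ℕ)) ?_ ?_ ?_ ?_
  · rintro ⟨a, i⟩ -
    simp only [inv, key]
    unfold skip
    split_ifs with h
    · obtain ⟨b, rfl⟩ : ∃ b, a = b + 1 := ⟨a - 1, by omega⟩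
      simp only [Nat.add_sub_cancel]
      ring
    · ring
  · rintro ⟨a, i⟩ - - h
    have := congrArg Prod.fst h
    simp only [skip] at this
    split_ifs at this <;> omega
  · rintro ⟨a, i⟩ h
    simp only [Finset.mem_product, Finset.mem_range, skip] at h ⊢
    split_ifs <;> omega
  · rintro ⟨a, i⟩ -
    simp only [inv]
    refine Prod.ext rfl ?_
    simp only [skip]
    split_ifs <;> omega

/-- Boundaries with equal `j`-th and `p`-th faces have the same alternating sum. -/
lemma del_eq_of_eq (hn : 1 ≤ n) {j p : ℕ} (hj : j + 2 ≤ p) (hp : p < n + 2)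
    (ih : ∀ f, S.T f → (∀ i < j + 1, f i = S.pt) → S.del f = 0) {f g : ℕ → E} (hf : S.T f)
    (hg : S.T g) (hf0 : ∀ i < j, f i = S.pt) (hg0 : ∀ i < j, g i = S.pt) (hfg : f j = g j)
    (hfg' : f p = g p) : S.del f = S.del g := by
  let F (b : ℕ) : E := if b < p then f b else f (b - 1)
  let G (b : ℕ) : E := if b < p + 1 then g b else g (b - 1)
  choose u hu huT using fun b : ℕ => S.horn (j + 1) (fun i => if skip b i = p then F b else
    if skip b i = p + 1 then G b else S.pt) (by omega)
  let V (b : ℕ) : E := if b ≤ j then S.pt else u b (j + 1)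
  let s : ℕ → ℕ → E := fun a b =>
    if a = p then F b else if b = p then F a else if a = p + 1 then G b else
    if b = p + 1 then G a else if a = j + 1 then V b else if b = j + 1 then V a else S.pt
  have hpq : F (p + 1) = G p := by simp [F, G, hfg']
  have hsymm (a b) (h : a ≠ b) : s a b = s b a := by
    simp only [s]
    split_ifs <;> first | rfl | omega
  have row_lt (a) (ha : a < j) (i) : s a (skip a i) = S.pt := by
    have h1 : F a = S.pt := by
      simp only [F]
      rw [if_pos (by omega), hf0 a ha]
    have h2 : G a = S.pt := by
      simp only [G]
      rw [if_pos (by omega), hg0 a ha]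
    have h3 : V a = S.pt := if_pos (by omega)
    simp only [s, h1, h2, h3]
    split_ifs <;> first | rfl | omega
  have row_j (i) : s j (skip j i) = tup S.pt (p - 1) (p - 1 + 1) (f j) (f j) i := by
    have h1 : F j = f j := if_pos (by omega)
    have h2 : G j = f j := by
      simp only [G]
      rw [if_pos (by omega), hfg]
    have h3 : V j = S.pt := if_pos le_rfl
    simp only [s, h1, h2, h3, tup, skip]
    split_ifs <;> first | rfl | omega
  have row_p (i) : s p (skip p i) = f i := by
    simp only [s, F, skip, if_true]
    split_ifs <;> first | rfl | omega
  have row_q (i) : s (p + 1) (skip (p + 1) i) = g i := by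
    rcases eq_or_ne i p with rfl | hi
    · simp only [skip, s, lt_add_one, if_true, hpq]
      simp [G]
    · simp only [s, G, skip, if_true]
      split_ifs <;> first | rfl | omega
  have row_gt (a) (ha : j < a) (ha1 : a ≠ j + 1) (hap : a ≠ p) (haq : a ≠ p + 1) (i) :
      s a (skip a i) = u a i := by
    rcases eq_or_ne i (j + 1) with rfl | hi
    · have : skip a (j + 1) = j + 1 := if_pos (by omega)
      have h3 : V a = u a (j + 1) := if_neg (by omega)
      simp only [s, this, h3]
      split_ifs <;> first | rfl | omega
    · have : skip a i ≠ j + 1 := by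
        unfold skip
        split_ifs <;> omega
      rw [hu a i hi]
      simp only [s]
      split_ifs <;> first | rfl | omega
  have row_T (a) (ha : a < n + 3) (ha1 : a ≠ j + 1) : S.T fun i => s a (skip a i) := by
    rcases lt_trichotomy a j with h | rfl | h
    · simp only [row_lt a h]
      exact S.T_pt hn
    · simp only [row_j]
      exact S.degen _ _ (by omega)
    · by_cases hap : a = p
      · subst hap
        simpa only [row_p] using hf
      · by_cases haq : a = p + 1
        · subst haq
          simpa only [row_q] using hg
        · simp only [row_gt a h ha1 hap haq]
          exact huT a
  have row_T' (a) (ha : a < n + 3) : S.T fun i => s a (skip a i) := by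
    by_cases h : a = j + 1
    · subst h
      exact S.sphere s (j + 1) ha hsymm row_T
    · exact row_T a ha h
  have row_del (a) (ha : a < n + 3) (hap : a ≠ p) (haq : a ≠ p + 1) :
      S.del (fun i => s a (skip a i)) = 0 := by
    rcases lt_trichotomy a j with h | rfl | h
    · simp only [row_lt a h]
      exact S.del_pt
    · simp only [row_j]
      exact S.del_tup (by omega) _
    · refine ih _ (row_T' a ha) fun i hi => ?_
      have : skip a i = i := if_pos (by omega)
      simp only [this]
      rw [hsymm a i (by omega)]
      rcases Nat.lt_succ_iff_lt_or_eq.1 hi with h' | rfl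
      · have := row_lt i h' (a - 1)
        rwa [show skip i (a - 1) = a by unfold skip; split_ifs <;> omega] at this
      · have := row_j (a - 1)
        rw [show skip i (a - 1) = a by unfold skip; split_ifs <;> omega] at this
        rw [this]
        simp only [tup]
        rw [if_neg (by omega), if_neg (by omega)]
  have := S.del_sum s hsymm
  rw [Finset.sum_eq_add_of_mem p (p + 1) (by simp; omega) (by simp; omega) (by omega)] at this
  · simp only [row_p, row_q, pow_succ] at this
    have h1 : (-1 : ℤ) ^ p * (S.del f - S.del g) = 0 := by linarith
    rcases mul_eq_zero.1 h1 with h | h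
    · exact absurd h (pow_ne_zero _ (by norm_num))
    · exact sub_eq_zero.1 h
  · intro a ha h
    rw [row_del a (Finset.mem_range.1 ha) h.1 h.2, mul_zero]

/-- The homotopy addition theorem. -/
lemma del_eq_zero (hn : 1 ≤ n) {f : ℕ → E} (hf : S.T f) : S.del f = 0 := by
  have key (d : ℕ) : ∀ j, j + d + 1 = n → ∀ f, S.T f → (∀ i < j, f i = S.pt) → S.del f = 0 := by
    induction d with
    | zero =>
      intro j hj f hf h0
      have hb := S.base f (fun i hi => h0 i (by omega)) hf
      rw [show n - 1 = j by omega] at hb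
      have h1 : S.del f = (-1) ^ j * (S.c (f j) + S.c (f (n + 1)) - S.c (f n)) := by
        have : ∑ i ∈ Finset.range j, (-1) ^ i * S.c (f i) = 0 :=
          Finset.sum_eq_zero fun i hi => by
            rw [h0 i (Finset.mem_range.1 hi), S.c_pt, mul_zero]
        rw [del, show n + 2 = j + 3 by omega, Finset.sum_range_succ, Finset.sum_range_succ,
          Finset.sum_range_succ, this, show j + 1 = n by omega, show j + 2 = n + 1 by omega]
        rw [pow_succ, show (-1 : ℤ) ^ n = (-1) ^ j * (-1) by rw [← hj, add_zero, pow_succ]]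
        ring
      rw [h1, hb]
      ring
    | succ d ih =>
      intro j hj f hf h0
      have ih' := ih (j + 1) (by omega)
      obtain ⟨g, hg, hgT⟩ := S.horn (j + 1) (tup S.pt j (j + 2) (f j) (f (j + 2))) (by omega)
      rw [S.del_eq_of_eq hn le_rfl (by omega) ih' hf hgT h0
        (fun i hi => by
          rw [hg i (by omega), tup, if_neg (by omega), if_neg (by omega)])
        (by rw [hg j (by omega), tup, if_pos rfl])
        (by rw [hg (j + 2) (by omega), tup, if_neg (by omega), if_pos rfl])]
      rw [S.del_eq_of_eq hn (j := j) (p := j + 3) (by omega) (by omega) ih' hgT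
        (S.degen j (f j) (by omega))
        (fun i hi => by
          rw [hg i (by omega), tup, if_neg (by omega), if_neg (by omega)])
        (fun i hi => by rw [tup, if_neg (by omega), if_neg (by omega)])
        (by rw [hg j (by omega), tup, if_pos rfl, tup, if_pos rfl])
        (by
          rw [hg (j + 3) (by omega), tup, if_neg (by omega), if_neg (by omega), tup,
            if_neg (by omega), if_neg (by omega)])]
      exact S.del_tup (by omega) _
  exact key (n - 1) 0 (by omega) f hf (fun i hi => absurd hi (Nat.not_lt_zero i))

/-- Tuples with vanishing alternating sum are boundaries. -/
lemma T_of_del_eq_zero (hn : 1 ≤ n) {f : ℕ → E} (hf : S.del f = 0) : S.T f := by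
  obtain ⟨g, hg, hgT⟩ := S.horn 0 f (by omega)
  have hc : S.c (g 0) = S.c (f 0) := by
    have h1 := S.del_eq_zero hn hgT
    rw [del, Finset.sum_range_succ'] at h1 hf
    have : ∑ i ∈ Finset.range (n + 1), (-1) ^ (i + 1) * S.c (g (i + 1)) =
        ∑ i ∈ Finset.range (n + 1), (-1) ^ (i + 1) * S.c (f (i + 1)) :=
      Finset.sum_congr rfl fun i _ => by rw [hg _ (by omega)]
    simp only [pow_zero, one_mul] at h1 hf
    linarith
  let s : ℕ → ℕ → E := fun a b =>
    if a = n + 2 then f b else if b = n + 2 then f a else if a = n + 1 then g b else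
    if b = n + 1 then g a else S.pt
  have hsymm (a b) (h : a ≠ b) : s a b = s b a := by
    simp only [s]
    split_ifs <;> first | rfl | omega
  have := S.sphere s (n + 2) (by omega) hsymm (by
    intro a ha hne
    rcases Nat.eq_zero_or_pos a with rfl | h0
    · refine S.congr _ _ (fun i hi => ?_) (S.homot (g 0) (f 0) hc)
      change _ = s 0 (i + 1)
      simp only [s, tup]
      split_ifs <;> first | rfl | contradiction | omega
    · rcases eq_or_ne a (n + 1) with rfl | h1
      · refine S.congr _ _ (fun i hi => ?_) hgT
        rcases eq_or_ne i (n + 1) with rfl | hi1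
        · simp [s, skip, hg]
        · simp only [s, skip]
          split_ifs <;> first | rfl | omega
      · refine S.congr _ _ (fun i hi => ?_) (S.degen n (f a) (by omega))
        have := hg a (by omega)
        simp only [s, skip, tup, this]
        split_ifs <;> first | rfl | omega)
  refine S.congr _ _ (fun i hi => ?_) this
  simp only [s, skip, if_pos hi, if_true]

end FillSystem

end Filling

end EMSpace

namespace EMSpace

open scoped unitInterval

section Cells

variable {X : Type} [TopologicalSpace X]

lemma bdConst_iff_faces {m : ℕ} {x : X} {e : C(Sim (m + 1), X)} :
    BdConst x e ↔ ∀ i y, e (dl i y) = x := by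
  refine ⟨fun h i y => h _ ⟨i, dl_apply_self i y⟩, ?_⟩
  rintro h p ⟨i, hi⟩
  obtain ⟨y, rfl⟩ := exists_dl_eq i p hi
  exact h i y

lemma skelConst_iff_bdConst {N : ℕ} {x : X} {e : C(Sim (N + 1), X)} :
    SkelConst N x e ↔ BdConst x e := by
  rw [skelConst_iff_faces le_rfl, bdConst_iff_faces]
  exact forall_congr' fun i => ⟨fun h y => h.eq_const le_rfl y,
    fun h => skelConst_of_const h⟩

lemma coe_eq_of_hom_eq {a b : SimplexCategory} {f g : a ⟶ b} (h : f = g) :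
    ⇑f.toOrderHom = ⇑g.toOrderHom := by
  rw [h]

lemma dl_dl {m : ℕ} {i j : Fin (m + 2)} (h : i ≤ j) (y : Sim m) :
    dl j.succ (dl i y) = dl i.castSucc (dl j y) := by
  rw [simpMap_simpMap, simpMap_simpMap]
  congr 2
  exact coe_eq_of_hom_eq (SimplexCategory.δ_comp_δ h)

lemma exists_of_dl_eq {m : ℕ} {i j : Fin (m + 2)} (h : i ≤ j) {y z : Sim (m + 1)}
    (e : dl i.castSucc y = dl j.succ z) : ∃ u, y = dl j u ∧ z = dl i u := by
  have h1 : y j = 0 := by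
    have h2 : i.castSucc.succAbove j = j.succ := Fin.succAbove_of_le_castSucc _ _ (by simpa using h)
    rw [← dl_apply_succAbove i.castSucc y j, h2, e, dl_apply_self]
  obtain ⟨u, rfl⟩ := exists_dl_eq j y h1
  exact ⟨u, rfl, dl_injective _ (by rw [dl_dl h, e])⟩

/-- Simplices which are constant on the boundary. -/
abbrev Cell (m : ℕ) (x : X) : Type := {e : C(Sim m, X) // BdConst x e}

/-- The constant cell. -/
def Cell.pt (m : ℕ) (x : X) : Cell m x := ⟨ContinuousMap.const _ x, fun _ _ => rfl⟩

/-- A tuple of cells forms the boundary of a simplex. -/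
def IsBoundary {m : ℕ} {x : X} (f : ℕ → Cell m x) : Prop :=
  ∃ w : C(Sim (m + 1), X), ∀ (i : Fin (m + 2)) y, w (dl i y) = (f i).1 y

lemma isBoundary_congr {m : ℕ} {x : X} {f g : ℕ → Cell m x} (h : ∀ i < m + 2, f i = g i)
    (hf : IsBoundary f) : IsBoundary g := by
  obtain ⟨w, hw⟩ := hf
  exact ⟨w, fun i y => by rw [hw, h i i.2]⟩

lemma exists_isBoundary {m : ℕ} {x : X} (k : ℕ) (f : ℕ → Cell m x) (hk : k < m + 2) :
    ∃ g, (∀ i, i ≠ k → g i = f i) ∧ IsBoundary g := by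
  have : Nonempty X := ⟨x⟩
  obtain ⟨K, hK⟩ := exists_horn ⟨k, hk⟩ (fun i => (f i).1) (by
    intro i _ j _ y z h
    by_cases hij : i = j
    · subst hij
      rw [dl_injective i h]
    · exact ((f i).2 y (onBd_of_dl_eq hij h)).trans
        ((f j).2 z (onBd_of_dl_eq (Ne.symm hij) h.symm)).symm)
  have hbd (i) : BdConst x (K.comp (dl i)) := by
    intro y hy
    by_cases hi : i = ⟨k, hk⟩
    · subst hi
      obtain ⟨l, hl⟩ := hy
      obtain ⟨z, hz⟩ := exists_dl_eq (Fin.succAbove ⟨k, hk⟩ l) (dl ⟨k, hk⟩ y)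
        (by rw [dl_apply_succAbove, hl])
      change K (dl _ y) = x
      rw [← hz, hK _ (Fin.succAbove_ne _ l)]
      exact (f _).2 z (onBd_of_dl_eq (Fin.succAbove_ne _ l) hz)
    · change K (dl i y) = x
      rw [hK i hi]
      exact (f i).2 y hy
  refine ⟨fun i => if h : i < m + 2 then ⟨K.comp (dl ⟨i, h⟩), hbd _⟩ else f i, fun i hi => ?_,
    K, fun i y => ?_⟩
  · dsimp only
    split_ifs with h
    · exact Subtype.ext (ContinuousMap.ext (hK ⟨i, h⟩ (fun h => hi (congrArg Fin.val h))))
    · rfl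
  · dsimp only
    rw [dif_pos i.2]
    rfl

lemma isBoundary_of_sphere {m : ℕ} {x : X} (s : ℕ → ℕ → Cell m x) (k : ℕ) (hk : k < m + 3)
    (hs : ∀ a b, a ≠ b → s a b = s b a)
    (h : ∀ a < m + 3, a ≠ k → IsBoundary fun i => s a (skip a i)) :
    IsBoundary fun i => s k (skip k i) := by
  have : Nonempty X := ⟨x⟩
  have : Nonempty C(Sim (m + 1), X) := ⟨ContinuousMap.const _ x⟩
  have skip_lt {a i : ℕ} (h : i < a) : skip a i = i := if_pos h
  have skip_le {a i : ℕ} (h : a ≤ i) : skip a i = i + 1 := if_neg (by omega)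
  choose! w hw using h
  have key {i j : Fin (m + 2)} (hij : i ≤ j) (hi : i.val ≠ k) (hj : j.val + 1 ≠ k) (u : Sim m) :
      w i (dl j u) = w (j + 1) (dl i u) := by
    have hij' : i.val ≤ j.val := hij
    rw [hw _ (by omega) hi, hw _ (by omega) hj]
    dsimp only
    rw [skip_le hij', skip_lt (by omega),
      hs _ _ (by omega)]
  obtain ⟨K, hK⟩ := exists_horn ⟨k, hk⟩ (fun i => w i) (by
    intro a ha b hb y z e
    have ha : a.val ≠ k := fun h => ha (Fin.ext h)
    have hb : b.val ≠ k := fun h => hb (Fin.ext h)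
    rcases lt_trichotomy a b with hab | rfl | hab
    · obtain ⟨i, rfl⟩ := Fin.exists_castSucc_eq.2 (Fin.ne_last_of_lt hab)
      obtain ⟨j, rfl⟩ := Fin.exists_succ_eq.2 (Fin.ne_zero_of_lt hab)
      have hij : i ≤ j := Fin.castSucc_lt_succ_iff.1 hab
      obtain ⟨u, rfl, rfl⟩ := exists_of_dl_eq hij e
      exact key hij ha hb u
    · rw [dl_injective _ e]
    · obtain ⟨i, rfl⟩ := Fin.exists_castSucc_eq.2 (Fin.ne_last_of_lt hab)
      obtain ⟨j, rfl⟩ := Fin.exists_succ_eq.2 (Fin.ne_zero_of_lt hab)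
      have hij : i ≤ j := Fin.castSucc_lt_succ_iff.1 hab
      obtain ⟨u, rfl, rfl⟩ := exists_of_dl_eq hij e.symm
      exact (key hij hb ha u).symm)
  refine ⟨K.comp (dl ⟨k, hk⟩), fun i y => ?_⟩
  change K (dl ⟨k, hk⟩ (dl i y)) = _
  rcases Nat.lt_or_ge i k with hik | hik
  · obtain ⟨j, hj⟩ := Fin.exists_succ_eq.2 (show (⟨k, hk⟩ : Fin (m + 3)) ≠ 0 from
      fun h => by have := congrArg Fin.val h; simp at this; omega)
    have hj' : j.val + 1 = k := congrArg Fin.val hj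
    have hij : i ≤ j := Fin.le_def.2 (by omega)
    rw [← hj, dl_dl hij, hK _ (fun h => by have := congrArg Fin.val h; simp at this; omega)]
    refine (hw _ (by simp; omega) (by simp; omega) j y).trans ?_
    simp only [Fin.val_castSucc]
    rw [skip_lt hik, skip_le (Fin.le_def.1 hij), hj', hs _ _ (by omega)]
  · obtain ⟨j, hj⟩ := Fin.exists_castSucc_eq.2 (show (⟨k, hk⟩ : Fin (m + 3)) ≠ Fin.last _ from
      fun h => by have := congrArg Fin.val h; simp at this; omega)
    have hj' : j.val = k := congrArg Fin.val hj
    have hij : j ≤ i := Fin.le_def.2 (by omega)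
    rw [← hj, ← dl_dl hij, hK _ (fun h => by have := congrArg Fin.val h; simp at this; omega)]
    refine (hw _ (by simp) (by simp; omega) j y).trans ?_
    simp only [Fin.val_succ]
    rw [skip_le hik, hj', skip_lt (by omega), hs _ _ (by omega)]

lemma isBoundary_degen {m : ℕ} {x : X} (k : ℕ) (f : Cell m x) (hk : k < m + 1) :
    IsBoundary (tup (Cell.pt m x) k (k + 1) f f) := by
  let k' : Fin (m + 1) := ⟨k, hk⟩
  refine ⟨f.1.comp (simpMap (Fin.predAbove k')), fun i y => ?_⟩
  change f.1 (simpMap _ (dl i y)) = _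
  have hid (j : Fin (m + 2)) (hj : j.val = k ∨ j.val = k + 1) :
      simpMap (Fin.predAbove k') (dl j y) = y := by
    rw [simpMap_simpMap]
    conv_rhs => rw [← simpMap_id_apply y]
    congr 2
    rcases hj with hj | hj
    · obtain rfl : j = k'.castSucc := Fin.ext hj
      exact coe_eq_of_hom_eq (SimplexCategory.δ_comp_σ_self (i := k'))
    · obtain rfl : j = k'.succ := Fin.ext hj
      exact coe_eq_of_hom_eq (SimplexCategory.δ_comp_σ_succ (i := k'))
  by_cases h1 : i.val = k ∨ i.val = k + 1
  · rw [hid i h1]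
    simp only [tup]
    rcases h1 with h1 | h1 <;> simp [h1]
  · push Not at h1
    simp only [tup, if_neg h1.1, if_neg h1.2]
    refine f.2 _ ⟨k'.predAbove i, ?_⟩
    rw [simpMap_apply]
    refine Finset.sum_eq_zero fun l hl => ?_
    have hl := (Finset.mem_filter.1 hl).2
    have : l = i := by
      have hp (a : Fin (m + 2)) :
          (k'.predAbove a).val = if k < a.val then a.val - 1 else a.val := by
        simp only [Fin.predAbove, k', Fin.lt_def, Fin.val_castSucc]
        split_ifs <;> rfl
      have h2 := congrArg Fin.val hl
      rw [hp, hp] at h2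
      ext
      split_ifs at h2 <;> omega
    rw [this, dl_apply_self]

end Cells

end EMSpace

namespace EMSpace

open scoped unitInterval

section Classes

variable {X : Type} [TopologicalSpace X]

lemma qmap_snoc_zero {k : ℕ} (v : Fin k → I) :
    qmap (k + 1) (Fin.snoc v 0) = dl (Fin.last _) (qmap k v) := by
  rw [qmap_last _ (by simp)]
  simp

lemma qmap_insertNth_one {k : ℕ} (j : Fin (k + 1)) (v : Fin k → I) :
    qmap (k + 1) (j.insertNth (α := fun _ => I) 1 v) = dl j.castSucc (qmap k v) := by
  rw [qmap_one _ j (by simp)]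
  simp

lemma isBoundary_of_cls_eq {m : ℕ} {x : X} {f f' : Cell m x}
    (h : clsOf f.1 f.2 = clsOf f'.1 f'.2) :
    IsBoundary (tup (Cell.pt m x) m (m + 1) f f') := by
  obtain ⟨H, h0, h1, hs⟩ := exists_homotopy_of_cls_eq f'.2 f.2 h.symm
  obtain ⟨w, hw⟩ := exists_descend (k := m + 1) (Z := PUnit)
    (⟨fun y => H (qmap m (fun i => y.1 i.castSucc), y.1 (Fin.last m)), by fun_prop⟩ :
      C((Fin (m + 1) → I) × PUnit, X))
    (by
      have key (t : Fin (m + 1) → I) (ht : ∃ j : Fin (m + 1), j.val + 1 < m + 1 ∧ t j = 0) :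
          H (qmap m (fun i => t i.castSucc), t (Fin.last m)) = x := by
        obtain ⟨j, hj, h0⟩ := ht
        exact hs _ _ (onBd_qmap.2 ⟨⟨j, by omega⟩, Or.inl h0⟩)
      intro t t' z ht ht'
      exact (key t ht).trans (key t' ht').symm)
  refine ⟨⟨fun p => w (p, PUnit.unit), by fun_prop⟩, fun i y => ?_⟩
  change w (dl i y, PUnit.unit) = _
  obtain ⟨v, rfl⟩ := qmap_surjective m y
  refine Fin.lastCases ?_ (fun j => ?_) i
  · rw [← qmap_snoc_zero, hw]
    change H (qmap m (fun i => (Fin.snoc v 0 : Fin (m + 1) → I) i.castSucc),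
      (Fin.snoc v 0 : Fin (m + 1) → I) (Fin.last m)) = _
    simp only [Fin.snoc_castSucc, Fin.snoc_last, h0]
    simp [tup]
  · rw [← qmap_insertNth_one, hw]
    change H (qmap m (fun i => (j.insertNth 1 v : Fin (m + 1) → I) i.castSucc),
      (j.insertNth 1 v : Fin (m + 1) → I) (Fin.last m)) = _
    refine Fin.lastCases ?_ (fun j => ?_) j
    · simp only [Fin.insertNth_last', Fin.snoc_castSucc, Fin.snoc_last, h1]
      simp [tup]
    · rw [hs _ _ (onBd_qmap.2 ⟨j, Or.inr (by simp)⟩)]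
      have hj := j.2
      simp only [tup, Fin.val_castSucc]
      rw [if_neg (by omega), if_neg (by omega)]
      rfl

lemma exists_cls_eq {m : ℕ} {x : X} (g : HomotopyGroup (Fin m) X x) :
    ∃ f : Cell m x, clsOf f.1 f.2 = g := by
  induction g using Quotient.inductionOn with | _ g =>
  obtain ⟨w, hw⟩ := exists_descend (k := m) (Z := PUnit)
    (⟨fun y => g y.1, by fun_prop⟩ : C((Fin m → I) × PUnit, X))
    (fun t t' _ ht ht' => (g.2 t (onBd_of_collapse ht)).trans (g.2 t' (onBd_of_collapse ht')).symm)
  have hbd : BdConst x (⟨fun p => w (p, PUnit.unit), by fun_prop⟩ : C(Sim m, X)) := by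
    intro p hp
    obtain ⟨t, rfl⟩ := qmap_surjective m p
    exact (hw t _).trans (g.2 t (onBd_qmap.1 hp))
  refine ⟨⟨_, hbd⟩, congrArg (Quotient.mk _) ?_⟩
  ext t
  exact hw t _

/-- The last two coordinates of a point of the cube. -/
noncomputable def sqPt {N : ℕ} (t : Fin (N + 1) → I) (a b : I) : Fin (N + 2) → I :=
  Fin.snoc (Function.update t (Fin.last N) a) b

/-- Convex combinations in the interval. -/
noncomputable def mix (s a b : I) : I :=
  ⟨(1 - (s : ℝ)) * a + s * b, by
    have h1 : 0 ≤ 1 - (s : ℝ) := sub_nonneg.2 s.2.2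
    have h2 := mul_nonneg h1 a.2.1
    have h3 := mul_nonneg s.2.1 b.2.1
    have h4 := mul_le_mul_of_nonneg_left a.2.2 h1
    have h5 := mul_le_mul_of_nonneg_left b.2.2 s.2.1
    constructor <;> linarith⟩

lemma mix_zero (a b : I) : mix 0 a b = a := Subtype.ext (by simp [mix])

lemma mix_one (a b : I) : mix 1 a b = b := Subtype.ext (by simp [mix])

lemma mix_self (s a : I) : mix s a a = a := Subtype.ext (by simp only [mix]; ring)

lemma continuous_mix : Continuous fun y : I × I × I => mix y.1 y.2.1 y.2.2 :=
  Continuous.subtype_mk (by fun_prop) _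

/-- Truncation of `2 * u`. -/
noncomputable def dbl (u : I) : I := Set.projIcc 0 1 zero_le_one (2 * (u : ℝ))

/-- Truncation of `2 * u - 1`. -/
noncomputable def dbl' (u : I) : I := Set.projIcc 0 1 zero_le_one (2 * (u : ℝ) - 1)

lemma continuous_dbl : Continuous dbl := continuous_projIcc.comp (by fun_prop)

lemma continuous_dbl' : Continuous dbl' := continuous_projIcc.comp (by fun_prop)

lemma dbl_of_half_le {u : I} (h : 1 / 2 ≤ (u : ℝ)) : dbl u = 1 :=
  Set.projIcc_of_right_le _ (by linarith)

lemma dbl'_of_le_half {u : I} (h : (u : ℝ) ≤ 1 / 2) : dbl' u = 0 :=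
  Set.projIcc_of_le_left _ (by linarith)

section Square

variable {N : ℕ} {x : X} {f : ℕ → Cell (N + 1) x} {w : C(Sim (N + 2), X)}
  (hw : ∀ (i : Fin (N + 3)) y, w (dl i y) = (f i).1 y) (hf : ∀ i < N, f i = Cell.pt _ x)

lemma continuous_sqPt : Continuous fun y : (Fin (N + 1) → I) × I × I => sqPt y.1 y.2.1 y.2.2 :=
  Continuous.finSnoc (continuous_fst.update _ (by fun_prop)) (by fun_prop)

include hw

lemma sq_bot (t : Fin (N + 1) → I) (a : I) : w (qmap _ (sqPt t a 0)) =
    (f (N + 2)).1 (qmap _ (Function.update t (Fin.last N) a)) := by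
  rw [sqPt, qmap_snoc_zero, hw]
  rfl

lemma sq_top (t : Fin (N + 1) → I) (a : I) : w (qmap _ (sqPt t a 1)) =
    (f (N + 1)).1 (qmap _ (Function.update t (Fin.last N) a)) := by
  have := qmap_insertNth_one (Fin.last (N + 1)) (Function.update t (Fin.last N) a)
  rw [Fin.insertNth_last'] at this
  rw [sqPt, this, hw]
  rfl

lemma sq_right (t : Fin (N + 1) → I) (b : I) : w (qmap _ (sqPt t 1 b)) =
    (f N).1 (qmap _ (Function.update t (Fin.last N) b)) := by
  rw [qmap_one _ (Fin.last N).castSucc (by simp [sqPt]), hw]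
  have : (fun i => sqPt t 1 b ((Fin.last N).castSucc.succAbove i)) =
      Function.update t (Fin.last N) b := by
    funext i
    refine Fin.lastCases ?_ (fun i => ?_) i
    · have : (Fin.last N).castSucc.succAbove (Fin.last N) = Fin.last (N + 1) := by
        rw [Fin.succAbove_of_le_castSucc _ _ le_rfl, Fin.succ_last]
      rw [this]
      simp [sqPt]
    · have : (Fin.last N).castSucc.succAbove i.castSucc = i.castSucc.castSucc := by
        rw [Fin.succAbove_of_castSucc_lt]
        exact Fin.castSucc_lt_castSucc_iff.2 (Fin.castSucc_lt_last i)
      rw [this]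
      simp [sqPt, (Fin.castSucc_lt_last i).ne]
  rw [this]
  rfl

lemma sq_zero (v : Fin (N + 2) → I) (j : Fin (N + 1)) (h : v j.castSucc = 0) :
    w (qmap _ v) = x := by
  have hj := j.2
  have h1 : qmap (N + 2) v (Fin.last _) = 0 :=
    qfun_eq_zero_of_zero (N + 2) v j.castSucc (Fin.last (N + 2)) h (by simp; omega)
  obtain ⟨y, hy⟩ := exists_dl_eq _ _ h1
  rw [← hy, hw]
  refine (f _).2 y ⟨Fin.last _, ?_⟩
  rw [← dl_apply_succAbove (Fin.last _) y, hy]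
  have h2 : (Fin.last (N + 2)).succAbove (Fin.last (N + 1)) = (Fin.last (N + 1)).castSucc := by
    rw [Fin.succAbove_last]
  rw [h2]
  exact qfun_eq_zero_of_zero (N + 2) v j.castSucc (Fin.last (N + 1)).castSucc h
    (by simpa using hj)

include hf

lemma sq_one (v : Fin (N + 2) → I) (j : Fin N) (h : v j.castSucc.castSucc = 1) :
    w (qmap _ v) = x := by
  rw [qmap_one v _ h, hw]
  have := hf j j.2
  simp only [Fin.val_castSucc, this]
  rfl

lemma cls_square : clsOf (f N).1 (f N).2 * clsOf (f (N + 2)).1 (f (N + 2)).2 =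
    clsOf (f (N + 1)).1 (f (N + 1)).2 := by
  have e : clsOf (f (N + 1)).1 (f (N + 1)).2 =
      clsOf (f (N + 1)).1 (f (N + 1)).2 * (1 : HomotopyGroup (Fin (N + 1)) X x) := (mul_one _).symm
  rw [e, HomotopyGroup.one_def]
  refine (HomotopyGroup.mul_spec (i := Fin.last N)).trans
    (Eq.trans ?_ (HomotopyGroup.mul_spec (i := Fin.last N)).symm)
  apply Quotient.sound
  let K : C(I × (Fin (N + 1) → I), X) :=
    ⟨fun y => w (qmap _ (sqPt y.2 (mix y.1 (dbl (y.2 (Fin.last N))) (dbl' (y.2 (Fin.last N))))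
      (mix y.1 (dbl' (y.2 (Fin.last N))) (dbl (y.2 (Fin.last N)))))), by
      have h1 : Continuous fun y : I × (Fin (N + 1) → I) => dbl (y.2 (Fin.last N)) :=
        continuous_dbl.comp (by fun_prop)
      have h2 : Continuous fun y : I × (Fin (N + 1) → I) => dbl' (y.2 (Fin.last N)) :=
        continuous_dbl'.comp (by fun_prop)
      exact w.continuous.comp ((qmap _).continuous.comp (continuous_sqPt.comp
        (continuous_snd.prodMk ((continuous_mix.comp (continuous_fst.prodMk (h1.prodMk h2))).prodMk
          (continuous_mix.comp (continuous_fst.prodMk (h2.prodMk h1)))))))⟩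
  have hK0 (t) : K (0, t) = GenLoop.transAt (Fin.last N) (loopOf (f (N + 2)).1 (f (N + 2)).2)
      (loopOf (f N).1 (f N).2) t := by
    change w (qmap _ (sqPt t (mix 0 _ _) (mix 0 _ _))) = if _ then _ else _
    rw [mix_zero, mix_zero]
    split_ifs with h
    · rw [dbl'_of_le_half h, sq_bot hw]
      rfl
    · rw [dbl_of_half_le (not_le.1 h).le, sq_right hw]
      rfl
  have hK1 (t) : K (1, t) = GenLoop.transAt (Fin.last N) GenLoop.const
      (loopOf (f (N + 1)).1 (f (N + 1)).2) t := by
    change w (qmap _ (sqPt t (mix 1 _ _) (mix 1 _ _))) = if _ then _ else _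
    rw [mix_one, mix_one]
    split_ifs with h
    · rw [dbl'_of_le_half h]
      exact sq_zero hw _ (Fin.last N) (by simp [sqPt])
    · rw [dbl_of_half_le (not_le.1 h).le, sq_top hw]
      rfl
  have hKb (s t) (ht : t ∈ Cube.boundary (Fin (N + 1))) : K (s, t) = x := by
    obtain ⟨j, hj⟩ := ht
    change w (qmap _ (sqPt t _ _)) = x
    rcases Fin.eq_castSucc_or_eq_last j with ⟨j, rfl⟩ | rfl
    · rcases hj with hj | hj
      · exact sq_zero hw _ j.castSucc (by simp [sqPt, hj, (Fin.castSucc_lt_last j).ne])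
      · exact sq_one hw hf _ j (by simp [sqPt, hj, (Fin.castSucc_lt_last j).ne])
    · rcases hj with hj | hj
      · have h1 : dbl (t (Fin.last N)) = 0 := by
          rw [hj]
          exact Set.projIcc_of_le_left _ (by simp)
        have h2 : dbl' (t (Fin.last N)) = 0 := dbl'_of_le_half (by rw [hj]; simp)
        rw [h1, h2, mix_self]
        exact sq_zero hw _ (Fin.last N) (by simp [sqPt])
      · have h1 : dbl (t (Fin.last N)) = 1 := dbl_of_half_le (by rw [hj]; norm_num)
        have h2 : dbl' (t (Fin.last N)) = 1 := by
          rw [hj]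
          exact Set.projIcc_of_right_le _ (by norm_num)
        rw [h1, h2, mix_self, sq_right hw]
        exact (f N).2 _ (onBd_qmap.2 ⟨Fin.last N, Or.inr (by simp)⟩)
  exact ⟨⟨⟨K, hK0, hK1⟩, fun s t ht => (hKb s t ht).trans (GenLoop.boundary _ t ht).symm⟩⟩

end Square

/-- The combinatorics of cells in a space with infinite cyclic homotopy group. -/
noncomputable def cellSystem {N : ℕ} (x : X)
    (e : HomotopyGroup (Fin (N + 1)) X x ≃* Multiplicative (Fin 1 → ℤ)) :
    FillSystem (Cell (N + 1) x) (N + 1) where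
  pt := Cell.pt _ x
  T := IsBoundary
  c f := (e (clsOf f.1 f.2)).toAdd 0
  c_pt := by
    have : clsOf (Cell.pt (N + 1) x).1 (Cell.pt (N + 1) x).2 =
        (1 : HomotopyGroup (Fin (N + 1)) X x) := HomotopyGroup.one_def.symm
    rw [this, map_one]
    rfl
  congr _ _ := isBoundary_congr
  horn k f := exists_isBoundary k f
  sphere s k hk := isBoundary_of_sphere s k hk
  degen k f := isBoundary_degen k f
  homot f f' h := isBoundary_of_cls_eq (e.injective (by
    refine Multiplicative.toAdd.injective (funext fun i => ?_)
    rw [Fin.fin_one_eq_zero i]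
    exact h))
  base f hf := by
    rintro ⟨w, hw⟩
    have := cls_square hw (fun i hi => hf i (by omega))
    change _ = (e (clsOf (f (N + 1)).1 (f (N + 1)).2)).toAdd 0
    rw [← this, map_mul]
    rfl

lemma cellSystem_c_surjective {N : ℕ} (x : X)
    (e : HomotopyGroup (Fin (N + 1)) X x ≃* Multiplicative (Fin 1 → ℤ)) :
    Function.Surjective (cellSystem x e).c := fun z => by
  obtain ⟨f, hf⟩ := exists_cls_eq (e.symm (Multiplicative.ofAdd fun _ => z))
  refine ⟨f, ?_⟩
  change (e (clsOf f.1 f.2)).toAdd 0 = z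
  rw [hf, MulEquiv.apply_symm_apply]
  rfl

end Classes

end EMSpace

namespace EMSpace

section Cochains

open Opposite
open scoped Simplicial

variable (k : Type) [CommRing k]

/-- Normalized simplicial cochains of a standard simplex. -/
def Cochain (d : ℕ) (a : SimplexCategory) : Submodule k ((⦋d⦌ ⟶ a) → k) where
  carrier := {c | ∀ ι : ⦋d⦌ ⟶ a, ¬ Function.Injective ι.toOrderHom → c ι = 0}
  zero_mem' := fun _ _ => rfl
  add_mem' := fun {c c'} h h' ι hι => by
    change c ι + c' ι = 0
    rw [h ι hι, h' ι hι, add_zero]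
  smul_mem' := fun r c h ι hι => by
    change r * c ι = 0
    rw [h ι hι, mul_zero]

/-- The coboundary of cochains of a standard simplex. -/
def coboundary (d : ℕ) (a : SimplexCategory) :
    ((⦋d⦌ ⟶ a) → k) →ₗ[k] ((⦋d + 1⦌ ⟶ a) → k) where
  toFun c ι := ∑ i : Fin (d + 2), (-1) ^ (i : ℕ) * c (SimplexCategory.δ i ≫ ι)
  map_add' c c' := by
    funext ι
    simp only [Pi.add_apply, mul_add, Finset.sum_add_distrib]
  map_smul' r c := by
    funext ι
    simp only [Pi.smul_apply, smul_eq_mul, Finset.mul_sum, RingHom.id_apply]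
    exact Finset.sum_congr rfl fun i _ => by ring

/-- Normalized simplicial cocycles of a standard simplex. -/
def Cocycle (d : ℕ) (a : SimplexCategory) : Submodule k ((⦋d⦌ ⟶ a) → k) :=
  Cochain k d a ⊓ LinearMap.ker (coboundary k d a)

variable {k}

/-- Restriction of functions on simplices of a standard simplex. -/
def pull (d : ℕ) {a b : SimplexCategory} (θ : a ⟶ b) :
    ((⦋d⦌ ⟶ b) → k) →ₗ[k] ((⦋d⦌ ⟶ a) → k) :=
  LinearMap.funLeft k k fun ι => ι ≫ θ

lemma pull_mem_cochain {d : ℕ} {a b : SimplexCategory} (θ : a ⟶ b) {c : (⦋d⦌ ⟶ b) → k}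
    (hc : c ∈ Cochain k d b) : pull d θ c ∈ Cochain k d a := fun ι hι =>
  hc (ι ≫ θ) fun h => hι (Function.Injective.of_comp h)

lemma pull_mem_cocycle {d : ℕ} {a b : SimplexCategory} (θ : a ⟶ b) {c : (⦋d⦌ ⟶ b) → k}
    (hc : c ∈ Cocycle k d b) : pull d θ c ∈ Cocycle k d a := by
  refine ⟨pull_mem_cochain θ hc.1, ?_⟩
  funext ι
  have := congrFun hc.2 (ι ≫ θ)
  simpa [coboundary, pull, LinearMap.funLeft_apply] using this

lemma Cochain.eq_zero_of_lt {d : ℕ} {a : SimplexCategory} (h : a.len < d) {c : (⦋d⦌ ⟶ a) → k}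
    (hc : c ∈ Cochain k d a) : c = 0 := by
  funext ι
  refine hc ι fun hι => ?_
  have := Fintype.card_le_of_injective _ hι
  simp at this
  omega

/-- The simplicial set of cocycles. -/
def cocycleSet (k : Type) [CommRing k] (d : ℕ) : SSet.{0} where
  obj a := Cocycle k d a.unop
  map θ := ↾fun c => ⟨pull d θ.unop c.1, pull_mem_cocycle θ.unop c.2⟩
  map_id a := by
    refine ConcreteCategory.hom_ext _ _ fun c => Subtype.ext (funext fun ι => ?_)
    exact congrArg c.1 (Category.comp_id ι)
  map_comp θ η := by
    refine ConcreteCategory.hom_ext _ _ fun c => Subtype.ext (funext fun ι => ?_)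
    exact congrArg c.1 (Category.assoc ι η.unop θ.unop).symm

lemma eq_of_faces {d m : ℕ} (h : d ≤ m) {c c' : (⦋d⦌ ⟶ ⦋m + 1⦌) → k}
    (hc : ∀ i, pull d (SimplexCategory.δ i) c = pull d (SimplexCategory.δ i) c') : c = c' := by
  funext ι
  obtain ⟨i, κ, hκ⟩ := exists_succAbove_comp h ι.toOrderHom
  have hι : ι = SimplexCategory.Hom.mk κ ≫ SimplexCategory.δ i := by
    ext j
    exact congrArg Fin.val (hκ j)
  rw [hι]
  exact congrFun (hc i) (SimplexCategory.Hom.mk κ)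

end Cochains

section Geometry

open Opposite

variable {X : Type} [TopologicalSpace X]

/-- Restriction of a simplex with constant `N`-skeleton to an `(N+1)`-dimensional face. -/
noncomputable def cellOf {N : ℕ} {x : X} {k : ℕ} (f : {e : C(Sim k, X) // SkelConst N x e})
    (ι : Fin (N + 2) →o Fin (k + 1)) : Cell (N + 1) x :=
  ⟨f.1.comp (simpMap ι), skelConst_iff_bdConst.1 (f.2.comp ι)⟩

lemma cellOf_eq_pt {N : ℕ} {x : X} {k : ℕ} (f : {e : C(Sim k, X) // SkelConst N x e})
    (ι : Fin (N + 2) →o Fin (k + 1)) (h : ¬ Function.Injective ι) :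
    cellOf f ι = Cell.pt (N + 1) x := by
  obtain ⟨i, θ, hθ⟩ := SimplexCategory.eq_σ_comp_of_not_injective
    (SimplexCategory.Hom.mk ι : SimplexCategory.mk (N + 1) ⟶ SimplexCategory.mk k) h
  refine Subtype.ext (ContinuousMap.ext fun p => ?_)
  change f.1 (simpMap ι p) = x
  have h2 : (ι : Fin (N + 2) → Fin (k + 1)) =
      θ.toOrderHom ∘ (SimplexCategory.σ i).toOrderHom := by
    have := coe_eq_of_hom_eq hθ
    exact this
  rw [h2, ← simpMap_simpMap]
  exact f.2 θ.toOrderHom _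

variable {N : ℕ} (x : X) (e : HomotopyGroup (Fin (N + 1)) X x ≃* Multiplicative (Fin 1 → ℤ))

open scoped Simplicial in
lemma cls_mem_cocycle {a : SimplexCategory} (f : {e : C(Sim a.len, X) // SkelConst N x e}) :
    (fun ι : ⦋N + 1⦌ ⟶ a => (cellSystem x e).c (cellOf f ι.toOrderHom)) ∈
      Cocycle ℤ (N + 1) a := by
  refine ⟨fun ι hι => ?_, ?_⟩
  · change (cellSystem x e).c (cellOf f ι.toOrderHom) = 0
    rw [cellOf_eq_pt _ _ hι]
    exact (cellSystem x e).c_pt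
  · funext ι
    let g : ℕ → Cell (N + 1) x := fun i => if h : i < N + 3 then
      cellOf f (SimplexCategory.δ ⟨i, h⟩ ≫ ι).toOrderHom else Cell.pt _ x
    have hg : (cellSystem x e).T g := by
      refine ⟨f.1.comp (simpMap ι.toOrderHom), fun i y => ?_⟩
      have : g i = cellOf f (SimplexCategory.δ i ≫ ι).toOrderHom := dif_pos i.2
      rw [this]
      change f.1 (simpMap _ (dl i y)) = f.1 (simpMap _ y)
      rw [simpMap_simpMap]
      rfl
    have := (cellSystem x e).del_eq_zero (by omega) hg
    rw [FillSystem.del, Finset.sum_range] at this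
    refine Eq.trans ?_ this
    change ∑ i : Fin (N + 3), _ = _
    refine Finset.sum_congr rfl fun i _ => ?_
    have h : g i = cellOf f (SimplexCategory.δ i ≫ ι).toOrderHom := dif_pos i.2
    rw [h]

/-- The class of a simplex as a cocycle. -/
noncomputable def toCocycle : skel N x ⟶ cocycleSet ℤ (N + 1) where
  app a := ↾fun f => ⟨fun ι => (cellSystem x e).c (cellOf f ι.toOrderHom), cls_mem_cocycle x e f⟩
  naturality a b θ := by
    refine ConcreteCategory.hom_ext _ _ fun f => Subtype.ext (funext fun ι => ?_)
    change (cellSystem x e).c (cellOf _ _) = (cellSystem x e).c (cellOf _ _)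
    congr 1
    refine Subtype.ext (ContinuousMap.ext fun p => ?_)
    change f.1 (simpMap _ (simpMap _ p)) = f.1 (simpMap _ p)
    rw [simpMap_simpMap]
    rfl

open scoped Simplicial in
lemma toCocycle_rlp (hX : ∀ i, N + 1 < i → ∀ x : X, Subsingleton (HomotopyGroup (Fin i) X x)) :
    SSet.modelCategoryQuillen.I.rlp (toCocycle x e) := by
  apply rlp_of_faces
  · intro b
    refine ⟨⟨ContinuousMap.const _ x, skelConst_const N x 0⟩, Subtype.ext ?_⟩
    exact (Cochain.eq_zero_of_lt (by simp) ((toCocycle x e).app (op ⦋0⦌) _).2.1).trans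
      (Cochain.eq_zero_of_lt (by simp) b.2.1).symm
  · intro m b f hf hb
    have hcomp : Compat Set.univ fun i => (f i).1 :=
      FaceCompat.compat (X := X) (f := fun i => (f i).1)
        fun c u v i j h => congrArg Subtype.val (hf c u v i j h)
    have face (h : N + 1 ≤ m) (a : (skel N x).obj (op ⦋m + 1⦌))
        (ha : ∀ i, (skel N x).map (SimplexCategory.δ i).op a = f i) :
        (toCocycle x e).app _ a = b := by
      refine Subtype.ext (eq_of_faces h fun i => ?_)
      have h1 := ConcreteCategory.congr_hom ((toCocycle x e).naturality (SimplexCategory.δ i).op) a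
      have h2 : (toCocycle x e).app _ ((skel N x).map (SimplexCategory.δ i).op a) =
        (cocycleSet ℤ (N + 1)).map (SimplexCategory.δ i).op b := by rw [ha, hb]
      exact congrArg Subtype.val (h1.symm.trans h2)
    have mk (h : N ≤ m) (w : C(Sim (m + 1), X)) (hw : ∀ i y, w (dl i y) = (f i).1 y) :
        ∃ a : (skel N x).obj (op ⦋m + 1⦌), a.1 = w ∧
          ∀ i, (skel N x).map (SimplexCategory.δ i).op a = f i := by
      have h1 (i) : w.comp (dl i) = (f i).1 := ContinuousMap.ext (hw i)
      exact ⟨⟨w, (skelConst_iff_faces h).2 fun i => by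
        rw [h1]
        exact (f i).2⟩, rfl, fun i => Subtype.ext (h1 i)⟩
    rcases lt_trichotomy m N with h | rfl | h
    · refine ⟨⟨ContinuousMap.const _ x, skelConst_const N x (m + 1)⟩, fun i => Subtype.ext
        (ContinuousMap.ext fun p => ((f i).2.eq_const (by simpa using h.le) p).symm),
        Subtype.ext ?_⟩
      exact (Cochain.eq_zero_of_lt (by simpa using h)
        ((toCocycle x e).app (op ⦋m + 1⦌) _).2.1).trans
        (Cochain.eq_zero_of_lt (by simpa using h) b.2.1).symm
    · obtain ⟨g, hg⟩ := cellSystem_c_surjective x e (b.1 (𝟙 _))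
      obtain ⟨a, ha, ha'⟩ := mk le_rfl g.1 fun i y => by
        rw [(f i).2.eq_const le_rfl y]
        exact bdConst_iff_faces.1 g.2 i y
      refine ⟨a, ha', Subtype.ext (funext fun ι => ?_)⟩
      by_cases hι : Function.Injective ι.toOrderHom
      · have : Mono ι := SimplexCategory.mono_iff_injective.2 hι
        rw [SimplexCategory.eq_id_of_mono ι, ← hg]
        change (cellSystem x e).c _ = _
        congr 1
        refine Subtype.ext (ContinuousMap.ext fun p => ?_)
        change a.1 (simpMap (fun i => i) p) = _
        rw [simpMap_id_apply, ha]
      · exact (((toCocycle x e).app (op ⦋m + 1⦌) a).2.1 ι hι).trans (b.2.1 ι hι).symm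
    · obtain rfl | h := (Nat.succ_le_of_lt h).eq_or_lt
      · let g : ℕ → Cell (N + 1) x := fun i => if h : i < N + 3 then
          ⟨(f ⟨i, h⟩).1, skelConst_iff_bdConst.1 (f ⟨i, h⟩).2⟩ else Cell.pt _ x
        have hg (i : Fin (N + 3)) : g i = ⟨(f i).1, skelConst_iff_bdConst.1 (f i).2⟩ :=
          dif_pos i.2
        have hT : (cellSystem x e).T g := by
          apply (cellSystem x e).T_of_del_eq_zero (by omega)
          rw [FillSystem.del, Finset.sum_range]
          have := congrFun b.2.2 (𝟙 _)
          refine Eq.trans (Finset.sum_congr rfl fun i _ => ?_) this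
          rw [hg i, Category.comp_id]
          congr 1
          have h1 := congrFun (congrArg Subtype.val (hb i)) (𝟙 _)
          refine Eq.trans ?_ (h1.trans ?_)
          · change (cellSystem x e).c _ = (cellSystem x e).c _
            congr 1
            refine Subtype.ext (ContinuousMap.ext fun p => ?_)
            change (f i).1 p = (f i).1 (simpMap (fun i => i) p)
            rw [simpMap_id_apply]
          · change b.1 (𝟙 _ ≫ SimplexCategory.δ i) = _
            rw [Category.id_comp]
        obtain ⟨w, hw⟩ := hT
        obtain ⟨a, -, ha⟩ := mk (by omega) w fun i y => by rw [hw, hg]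
        exact ⟨a, ha, face le_rfl a ha⟩
      · obtain ⟨w, hw⟩ := exists_sphere_fill (hX m h) (fun i => (f i).1) hcomp
        obtain ⟨a, -, ha⟩ := mk (by omega) w hw
        exact ⟨a, ha, face (by omega) a ha⟩

end Geometry

end EMSpace

namespace EMSpace

/-- The free simplicial module on a simplicial set. -/
noncomputable abbrev freeS (F : Type) [Field F] : SSet.{0} ⥤ SMod F :=
  (SimplicialObject.whiskering _ _).obj (ModuleCat.free F)

lemma nonempty_homology_equiv_of_rlp (F : Type) [Field F] {A B : SSet.{0}} {p : A ⟶ B}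
    (hp : SSet.modelCategoryQuillen.I.rlp p) (d : ℕ) :
    Nonempty ((homologyFun F d).obj ((freeS F).obj A) ≃ₗ[F]
      (homologyFun F d).obj ((freeS F).obj B)) :=
  ⟨LinearEquiv.ofBijective _ (exists_homologyIso_of_rlp F p hp d)⟩

lemma nonempty_singular_equiv (F : Type) [Field F] (N : ℕ) (X : TopCat.{0}) (x : X)
    (hX : ∀ (x : X) (i : ℕ), i ≠ N + 1 → Subsingleton (HomotopyGroup (Fin i) X x))
    (e : HomotopyGroup (Fin (N + 1)) X x ≃* Multiplicative (Fin 1 → ℤ)) (d : ℕ) :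
    Nonempty ((homologyFun F d).obj ((freeS F).obj (TopCat.toSSet.obj X)) ≃ₗ[F]
      (homologyFun F d).obj ((freeS F).obj (cocycleSet ℤ (N + 1)))) := by
  have e1 := ((homologyFun F d).mapIso ((freeS F).mapIso (toSSetIso X))).toLinearEquiv
  obtain ⟨e2⟩ := nonempty_homology_equiv_of_rlp F
    (pathStart_rlp (N := N) (x := x) fun i hi => hX x i (by omega)) d
  obtain ⟨e3⟩ := nonempty_homology_equiv_of_rlp F (pathEnd_rlp N x) d
  obtain ⟨e4⟩ := nonempty_homology_equiv_of_rlp F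
    (toCocycle_rlp x e fun i hi y => hX y i (by omega)) d
  exact ⟨e1.trans (e2.symm.trans (e3.trans e4))⟩

end EMSpace

namespace EMSpace

section CochainAlgebra

open Opposite
open scoped Simplicial

variable {k : Type} [CommRing k] {d : ℕ} {a : SimplexCategory}

lemma coboundary_apply (c : (⦋d⦌ ⟶ a) → k) (ι : ⦋d + 1⦌ ⟶ a) :
    coboundary k d a c ι = ∑ i : Fin (d + 2), (-1) ^ (i : ℕ) * c (SimplexCategory.δ i ≫ ι) := rfl

lemma coboundary_mem_cochain {c : (⦋d⦌ ⟶ a) → k} (hc : c ∈ Cochain k d a) :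
    coboundary k d a c ∈ Cochain k (d + 1) a := by
  intro ι hι
  obtain ⟨j, θ, hθ⟩ := SimplexCategory.eq_σ_comp_of_not_injective ι hι
  rw [coboundary_apply, Finset.sum_eq_add j.castSucc j.succ Fin.castSucc_lt_succ.ne]
  · have h1 : SimplexCategory.δ j.castSucc ≫ ι = SimplexCategory.δ j.succ ≫ ι := by
      rw [hθ, ← Category.assoc, ← Category.assoc, SimplexCategory.δ_comp_σ_self,
        SimplexCategory.δ_comp_σ_succ]
    rw [h1, Fin.val_castSucc, Fin.val_succ, pow_succ]
    ring
  · intro i _ hi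
    rw [hc, mul_zero]
    intro hinj
    obtain ⟨u, hu⟩ := Fin.exists_succAbove_eq hi.1.symm
    obtain ⟨v, hv⟩ := Fin.exists_succAbove_eq hi.2.symm
    have h2 : ι.toOrderHom j.castSucc = ι.toOrderHom j.succ := by
      rw [hθ]
      have : (SimplexCategory.σ j).toOrderHom j.castSucc =
          (SimplexCategory.σ j).toOrderHom j.succ :=
        (Fin.predAbove_castSucc_self j).trans (Fin.predAbove_succ_self j).symm
      exact congrArg θ.toOrderHom this
    have h3 : u = v := hinj (by
      change ι.toOrderHom (i.succAbove u) = ι.toOrderHom (i.succAbove v)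
      rw [hu, hv, h2])
    rw [← hu, ← hv, h3] at h2
    have := hu.symm.trans ((congrArg _ h3).trans hv)
    exact absurd this Fin.castSucc_lt_succ.ne
  · simp
  · simp

/-- Functions on the simplices of a standard simplex as a cosimplicial module. -/
def cosimplicialFun (k : Type) [CommRing k] (a : SimplexCategory) :
    CosimplicialObject (ModuleCat.{0} k) where
  obj b := ModuleCat.of k ((b ⟶ a) → k)
  map θ := ModuleCat.ofHom (LinearMap.funLeft k k fun ι => θ ≫ ι)
  map_id b := by
    refine ConcreteCategory.hom_ext _ _ fun c => funext fun ι => ?_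
    exact congrArg c (Category.id_comp ι)
  map_comp θ η := by
    refine ConcreteCategory.hom_ext _ _ fun c => funext fun ι => ?_
    exact congrArg c (Category.assoc θ η ι)

lemma coboundary_coboundary (c : (⦋d⦌ ⟶ a) → k) :
    coboundary k (d + 1) a (coboundary k d a c) = 0 := by
  have key (n : ℕ) (c : (⦋n⦌ ⟶ a) → k) :
      (AlternatingCofaceMapComplex.objD (cosimplicialFun k a) n).hom c = coboundary k n a c := by
    funext ι
    let ev : ((cosimplicialFun k a).obj ⦋n⦌ ⟶ (cosimplicialFun k a).obj ⦋n + 1⦌) →+ k :=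
      { toFun := fun f => (f.hom c : (⦋n + 1⦌ ⟶ a) → k) ι
        map_zero' := rfl
        map_add' := fun _ _ => rfl }
    refine (map_sum ev _ _).trans (Finset.sum_congr rfl fun i _ => ?_)
    rw [map_zsmul, zsmul_eq_mul]
    push_cast
    rfl
  rw [← key, ← key]
  have := AlternatingCofaceMapComplex.d_squared (cosimplicialFun k a) d
  exact ConcreteCategory.congr_hom this c

lemma coboundary_mem_cocycle {c : (⦋d⦌ ⟶ a) → k} (hc : c ∈ Cochain k d a) :
    coboundary k d a c ∈ Cocycle k (d + 1) a :=
  ⟨coboundary_mem_cochain hc, coboundary_coboundary c⟩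

/-- The join of a simplex with the initial vertex. -/
def consZero (ι : ⦋d⦌ ⟶ a) : ⦋d + 1⦌ ⟶ a := SimplexCategory.Hom.mk
  { toFun := Fin.cons 0 ι.toOrderHom
    monotone' := by
      intro i j hij
      induction i using Fin.cases with
      | zero => exact Fin.zero_le _
      | succ i =>
        induction j using Fin.cases with
        | zero => exact absurd (Fin.succ_pos i) (not_lt.2 hij)
        | succ j => exact ι.toOrderHom.monotone (Fin.succ_le_succ_iff.1 hij) }

lemma hom_ext_apply {a b : SimplexCategory} {f g : a ⟶ b}
    (h : ∀ i, f.toOrderHom i = g.toOrderHom i) : f = g :=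
  SimplexCategory.Hom.ext _ _ (OrderHom.ext _ _ (funext h))

lemma δ_zero_consZero (ι : ⦋d⦌ ⟶ a) : SimplexCategory.δ 0 ≫ consZero ι = ι :=
  hom_ext_apply fun i => by
    change (Fin.cons 0 ι.toOrderHom : Fin (d + 2) → Fin (a.len + 1)) (Fin.succAbove 0 i) = _
    rw [Fin.zero_succAbove, Fin.cons_succ]

lemma δ_succ_consZero (ι : ⦋d + 1⦌ ⟶ a) (i : Fin (d + 2)) :
    SimplexCategory.δ i.succ ≫ consZero ι = consZero (SimplexCategory.δ i ≫ ι) :=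
  hom_ext_apply fun j => by
    change (Fin.cons 0 ι.toOrderHom : Fin (d + 3) → Fin (a.len + 1)) (Fin.succAbove i.succ j) =
      (Fin.cons 0 (SimplexCategory.δ i ≫ ι).toOrderHom : Fin (d + 2) → Fin (a.len + 1)) j
    induction j using Fin.cases with
    | zero => rw [Fin.succ_succAbove_zero, Fin.cons_zero, Fin.cons_zero]
    | succ j =>
      rw [Fin.succ_succAbove_succ, Fin.cons_succ, Fin.cons_succ]
      rfl

lemma consZero_injective_iff (ι : ⦋d⦌ ⟶ a) (h : Function.Injective (consZero ι).toOrderHom) :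
    Function.Injective ι.toOrderHom := fun i j hij =>
  Fin.succ_injective _ (h (hij : ι.toOrderHom i = ι.toOrderHom j))

/-- A cocycle is the coboundary of its contraction to the initial vertex. -/
lemma apply_eq_sum_consZero {z : (⦋d + 1⦌ ⟶ a) → k} (hz : z ∈ Cocycle k (d + 1) a)
    (ι : ⦋d + 1⦌ ⟶ a) :
    z ι = ∑ i : Fin (d + 2), (-1) ^ (i : ℕ) * z (consZero (SimplexCategory.δ i ≫ ι)) := by
  have h := congrFun hz.2 (consZero ι)
  rw [coboundary_apply, Fin.sum_univ_succ, δ_zero_consZero] at h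
  simp only [δ_succ_consZero, Fin.val_succ, pow_succ, Fin.val_zero, pow_zero, one_mul, mul_neg,
    mul_one, neg_mul, Finset.sum_neg_distrib] at h
  exact eq_of_sub_eq_zero ((sub_eq_add_neg _ _).trans h)

lemma exists_coboundary_eq {z : (⦋d + 1⦌ ⟶ a) → k} (hz : z ∈ Cocycle k (d + 1) a) :
    ∃ c ∈ Cochain k d a, coboundary k d a c = z :=
  ⟨fun ι => z (consZero ι), fun ι hι => hz.1 _ fun h => hι (consZero_injective_iff ι h),
    funext fun ι => (apply_eq_sum_consZero hz ι).symm⟩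

lemma Cocycle.apply_eq_of_zero {z : (⦋0⦌ ⟶ a) → k} (hz : z ∈ Cocycle k 0 a)
    (ι : ⦋0⦌ ⟶ a) : z ι = z (SimplexCategory.const ⦋0⦌ a 0) := by
  have h := congrFun hz.2 (consZero ι)
  rw [coboundary_apply, Fin.sum_univ_two, δ_zero_consZero] at h
  have h2 : SimplexCategory.δ 1 ≫ consZero ι = SimplexCategory.const ⦋0⦌ a 0 :=
    hom_ext_apply fun i => by
      have : i = 0 := Fin.fin_one_eq_zero i
      rw [this]
      rfl
  rw [h2] at h
  simp at h
  exact eq_of_sub_eq_zero ((sub_eq_add_neg _ _).trans h)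

/-- A cocycle vanishing on the simplices through the initial vertex is zero. -/
lemma Cocycle.eq_zero {z : (⦋d⦌ ⟶ a) → k} (hz : z ∈ Cocycle k d a)
    (h : ∀ ι : ⦋d⦌ ⟶ a, Function.Injective ι.toOrderHom → ι.toOrderHom 0 = 0 → z ι = 0) :
    z = 0 := by
  funext ι
  cases d with
  | zero =>
    rw [Cocycle.apply_eq_of_zero hz]
    exact h _ (fun i j _ => Subsingleton.elim (α := Fin 1) i j) rfl
  | succ d =>
    rw [apply_eq_sum_consZero hz]
    refine Finset.sum_eq_zero fun i _ => ?_
    by_cases hι : Function.Injective (consZero (SimplexCategory.δ i ≫ ι)).toOrderHom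
    · rw [h _ hι rfl, mul_zero]
    · rw [hz.1 _ hι, mul_zero]

end CochainAlgebra

end EMSpace

namespace EMSpace

section CocycleBasis

open scoped Simplicial

/-- The surjections of a simplex onto the standard `d`-simplex. -/
abbrev Surj (d : ℕ) (a : SimplexCategory) : Type :=
  {t : a ⟶ ⦋d⦌ // Function.Surjective t.toOrderHom}

variable {k : Type} [CommRing k] {d : ℕ} {a : SimplexCategory}

open scoped Classical in
/-- The indicator cocycle of a map to the standard `d`-simplex. -/
noncomputable def indic (k : Type) [CommRing k] {d : ℕ} {a : SimplexCategory} (t : a ⟶ ⦋d⦌) :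
    (⦋d⦌ ⟶ a) → k := fun ι => if ι ≫ t = 𝟙 _ then 1 else 0

lemma indic_of_eq {t : a ⟶ ⦋d⦌} {ι : ⦋d⦌ ⟶ a} (h : ι ≫ t = 𝟙 _) : indic k t ι = 1 := if_pos h

lemma indic_of_ne {t : a ⟶ ⦋d⦌} {ι : ⦋d⦌ ⟶ a} (h : ¬ ι ≫ t = 𝟙 _) : indic k t ι = 0 := if_neg h

lemma pull_indic {b : SimplexCategory} (θ : b ⟶ a) (t : a ⟶ ⦋d⦌) :
    pull d θ (indic k t) = indic k (θ ≫ t) := by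
  funext ι
  change indic k t (ι ≫ θ) = _
  simp [indic]

lemma indic_mem_cocycle (t : a ⟶ ⦋d⦌) : indic k t ∈ Cocycle k d a := by
  have h : indic k (𝟙 ⦋d⦌) ∈ Cocycle k d ⦋d⦌ := by
    have h1 : indic k (𝟙 ⦋d⦌) ∈ Cochain k d ⦋d⦌ := fun ι hι => indic_of_ne fun h => hι (by
      rw [Category.comp_id] at h
      rw [h]
      exact Function.injective_id)
    exact ⟨h1, Cochain.eq_zero_of_lt (by simp) (coboundary_mem_cochain h1)⟩
  have := pull_mem_cocycle t h
  rwa [pull_indic, Category.comp_id] at this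

lemma indic_eq_zero {t : a ⟶ ⦋d⦌} (ht : ¬ Function.Surjective t.toOrderHom) : indic k t = 0 := by
  funext ι
  refine indic_of_ne fun h => ht fun j => ⟨ι.toOrderHom j, ?_⟩
  exact congrFun (coe_eq_of_hom_eq h) j

/-- A Galois connection between a face and a surjection. -/
def Adj (ι : ⦋d⦌ ⟶ a) (t : a ⟶ ⦋d⦌) : Prop :=
  ∀ j x, ι.toOrderHom j ≤ x ↔ j ≤ t.toOrderHom x

lemma Adj.comp_eq_id {ι : ⦋d⦌ ⟶ a} {t : Surj d a} (h : Adj ι t.1) : ι ≫ t.1 = 𝟙 _ :=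
  hom_ext_apply fun j => by
    change t.1.toOrderHom (ι.toOrderHom j) = j
    obtain ⟨x, hx⟩ := t.2 j
    apply le_antisymm
    · exact (t.1.toOrderHom.monotone ((h j x).2 hx.ge)).trans hx.le
    · exact (h j _).1 le_rfl

lemma Adj.le {ι : ⦋d⦌ ⟶ a} {t t' : a ⟶ ⦋d⦌} (h : Adj ι t) (h' : ι ≫ t' = 𝟙 _) :
    (t.toOrderHom : Fin (a.len + 1) → Fin (d + 1)) ≤ t'.toOrderHom := fun x => by
  have h1 := congrFun (coe_eq_of_hom_eq h') (t.toOrderHom x)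
  have h2 := t'.toOrderHom.monotone ((h (t.toOrderHom x) x).2 le_rfl)
  exact h1.ge.trans h2

lemma exists_adj_left (t : Surj d a) : ∃ ι : ⦋d⦌ ⟶ a, Adj ι t.1 := by
  classical
  have hne (j : Fin (d + 1)) : (Finset.univ.filter fun x => j ≤ t.1.toOrderHom x).Nonempty := by
    obtain ⟨x, hx⟩ := t.2 j
    exact ⟨x, by simp [hx]⟩
  have key (j : Fin (d + 1)) (x) :
      (Finset.univ.filter fun x => j ≤ t.1.toOrderHom x).min' (hne j) ≤ x ↔
        j ≤ t.1.toOrderHom x := by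
    constructor
    · intro h
      have := Finset.min'_mem _ (hne j)
      exact (Finset.mem_filter.1 this).2.trans (t.1.toOrderHom.monotone h)
    · intro h
      exact Finset.min'_le _ _ (by simpa using h)
  refine ⟨SimplexCategory.Hom.mk ⟨fun j => _, fun i j hij => ?_⟩, key⟩
  exact (key i _).2 (hij.trans ((key j _).1 le_rfl))

lemma exists_adj_right (ι : ⦋d⦌ ⟶ a) (hι : Function.Injective ι.toOrderHom)
    (h0 : ι.toOrderHom 0 = 0) : ∃ t : Surj d a, Adj ι t.1 := by
  classical
  have hne (x : Fin (a.len + 1)) : (Finset.univ.filter fun j => ι.toOrderHom j ≤ x).Nonempty :=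
    ⟨0, by simp [h0]⟩
  have key (j : Fin (d + 1)) (x) : ι.toOrderHom j ≤ x ↔
      j ≤ (Finset.univ.filter fun j => ι.toOrderHom j ≤ x).max' (hne x) := by
    constructor
    · intro h
      exact Finset.le_max' _ _ (by simpa using h)
    · intro h
      have := Finset.max'_mem _ (hne x)
      exact (ι.toOrderHom.monotone h).trans (Finset.mem_filter.1 this).2
  refine ⟨⟨SimplexCategory.Hom.mk ⟨fun x => _, fun x y hxy => ?_⟩, fun j => ?_⟩, key⟩
  · exact (key _ y).1 (((key _ x).2 le_rfl).trans hxy)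
  · refine ⟨ι.toOrderHom j, ?_⟩
    have hs : StrictMono ι.toOrderHom := ι.toOrderHom.monotone.strictMono_of_injective hι
    apply le_antisymm
    · exact hs.le_iff_le.1 ((key _ _).2 le_rfl)
    · exact (key _ _).1 le_rfl

lemma Surj.coe_injective : Function.Injective
    fun t : Surj d a => (t.1.toOrderHom : Fin (a.len + 1) → Fin (d + 1)) := fun _ _ h =>
  Subtype.ext (hom_ext_apply fun i => congrFun h i)

/-- Pointwise order of surjections. -/
instance : PartialOrder (Surj d a) := PartialOrder.lift _ Surj.coe_injective

lemma indic_adj {ι : ⦋d⦌ ⟶ a} {t t' : Surj d a} (h : Adj ι t.1) (h' : ¬ t ≤ t') :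
    indic k t'.1 ι = 0 := indic_of_ne fun e => h' (h.le e)

lemma linearIndependent_indic :
    LinearIndependent k fun t : Surj d a => indic k t.1 := by
  classical
  have : Fintype (Surj d a) := Fintype.ofFinite _
  rw [Fintype.linearIndependent_iff]
  intro g hg
  by_contra! hne
  have hne' : (Finset.univ.filter fun t => g t ≠ 0).Nonempty := by
    obtain ⟨t, ht⟩ := hne
    exact ⟨t, by simpa using ht⟩
  obtain ⟨t, ht⟩ := Finset.exists_maximal hne'
  obtain ⟨ι, hι⟩ := exists_adj_left t
  have h := congrFun hg ι
  rw [Finset.sum_apply, Finset.sum_eq_single t] at h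
  · simp only [Pi.smul_apply, indic_of_eq hι.comp_eq_id, smul_eq_mul, mul_one, Pi.zero_apply] at h
    exact (Finset.mem_filter.1 ht.1).2 h
  · intro t' _ hne
    by_cases hg' : g t' = 0
    · simp [hg']
    · have h' : ¬ t ≤ t' := fun hle =>
        hne (le_antisymm (ht.2 (by simpa using hg') hle) hle)
      rw [Pi.smul_apply, indic_adj hι h', smul_zero]
  · simp

lemma mem_span_indic {z : (⦋d⦌ ⟶ a) → k} (hz : z ∈ Cocycle k d a) :
    z ∈ Submodule.span k (Set.range fun t : Surj d a => indic k t.1) := by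
  classical
  have : Fintype (Surj d a) := Fintype.ofFinite _
  have key (N : ℕ) : ∀ (D : Finset (Surj d a)) (z : (⦋d⦌ ⟶ a) → k), D.card = N →
      z ∈ Cocycle k d a → (∀ s t : Surj d a, s ≤ t → t ∈ D → s ∈ D) →
      (∀ (t : Surj d a) (ι : ⦋d⦌ ⟶ a), Adj ι t.1 → t ∉ D → z ι = 0) →
      z ∈ Submodule.span k (Set.range fun t : Surj d a => indic k t.1) := by
    induction N with
    | zero =>
      intro D z hD hz _ h
      rw [Finset.card_eq_zero] at hD
      have : z = 0 := Cocycle.eq_zero hz fun ι hι h0 => by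
        obtain ⟨t, ht⟩ := exists_adj_right ι hι h0
        exact h t ι ht (by simp [hD])
      rw [this]
      exact Submodule.zero_mem _
    | succ N ih =>
      intro D z hD hz hl h
      obtain ⟨t, ht⟩ := Finset.exists_maximal (s := D) (Finset.card_pos.1 (by omega))
      obtain ⟨κ, hκ⟩ := exists_adj_left t
      have hmem : indic k t.1 ∈ Submodule.span k (Set.range fun t : Surj d a => indic k t.1) :=
        Submodule.subset_span ⟨t, rfl⟩
      have := ih (D.erase t) (z - z κ • indic k t.1)
        (by rw [Finset.card_erase_of_mem ht.1, hD]; rfl)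
        (Submodule.sub_mem _ hz (Submodule.smul_mem _ _ (indic_mem_cocycle t.1)))
        (fun s s' hs hs' => by
          rw [Finset.mem_erase] at hs' ⊢
          refine ⟨?_, hl s s' hs hs'.2⟩
          rintro rfl
          exact hs'.1 (le_antisymm (ht.2 hs'.2 hs) hs))
        (fun s ι hs hsD => by
          change z ι - z κ * indic k t.1 ι = 0
          by_cases hst : s = t
          · subst hst
            have : ι = κ := hom_ext_apply fun j => le_antisymm
              ((hs _ _).2 ((hκ _ _).1 le_rfl)) ((hκ _ _).2 ((hs _ _).1 le_rfl))
            rw [this, indic_of_eq hκ.comp_eq_id, mul_one, sub_self]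
          · have hsD' : s ∉ D := fun h => hsD (Finset.mem_erase.2 ⟨hst, h⟩)
            rw [h s ι hs hsD', indic_adj hs fun hle => hsD' (hl s t hle ht.1), mul_zero, sub_zero])
      rw [← sub_add_cancel z (z κ • indic k t.1)]
      exact Submodule.add_mem _ this (Submodule.smul_mem _ _ hmem)
  exact key _ Finset.univ z rfl hz (fun _ _ _ _ => Finset.mem_univ _)
    fun t _ _ h => absurd (Finset.mem_univ t) h

/-- The basis of indicator cocycles. -/
noncomputable def cocycleBasis (k : Type) [CommRing k] (d : ℕ) (a : SimplexCategory) :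
    Module.Basis (Surj d a) k (Cocycle k d a) :=
  Module.Basis.mk (v := fun t => ⟨indic k t.1, indic_mem_cocycle t.1⟩)
    (LinearIndependent.of_comp (Cocycle k d a).subtype linearIndependent_indic) (by
      rintro ⟨z, hz⟩ -
      have h := mem_span_indic hz
      have h2 : (Set.range fun t : Surj d a => indic k t.1) = (Cocycle k d a).subtype ''
          Set.range fun t : Surj d a => (⟨indic k t.1, indic_mem_cocycle t.1⟩ : Cocycle k d a) := by
        rw [← Set.range_comp]
        rfl
      rw [h2, Submodule.span_image, Submodule.mem_map] at h
      obtain ⟨y, hy, hyz⟩ := h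
      have : y = ⟨z, hz⟩ := Subtype.ext hyz
      rwa [← this])

lemma cocycleBasis_apply (t : Surj d a) :
    (cocycleBasis k d a t : (⦋d⦌ ⟶ a) → k) = indic k t.1 := by
  rw [cocycleBasis, Module.Basis.mk_apply]

/-- Restriction of cocycles. -/
def cocyclePull (k : Type) [CommRing k] (d : ℕ) {a b : SimplexCategory} (θ : a ⟶ b) :
    Cocycle k d b →ₗ[k] Cocycle k d a :=
  (pull d θ).restrict fun _ hc => pull_mem_cocycle θ hc

/-- Restriction of cochains. -/
def cochainPull (k : Type) [CommRing k] (d : ℕ) {a b : SimplexCategory} (θ : a ⟶ b) :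
    Cochain k d b →ₗ[k] Cochain k d a :=
  (pull d θ).restrict fun _ hc => pull_mem_cochain θ hc

/-- The coboundary as a map from cochains to cocycles. -/
def coboundaryHom (k : Type) [CommRing k] (d : ℕ) (a : SimplexCategory) :
    Cochain k d a →ₗ[k] Cocycle k (d + 1) a :=
  (coboundary k d a).restrict fun _ hc => coboundary_mem_cocycle hc

lemma coboundaryHom_surjective : Function.Surjective (coboundaryHom k d a) := fun z => by
  obtain ⟨c, hc, h⟩ := exists_coboundary_eq z.2
  exact ⟨⟨c, hc⟩, Subtype.ext h⟩

lemma coboundary_pull {b : SimplexCategory} (θ : a ⟶ b) (c : (⦋d⦌ ⟶ b) → k) :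
    coboundary k d a (pull d θ c) = pull (d + 1) θ (coboundary k d b c) := by
  funext ι
  simp [coboundary, pull, LinearMap.funLeft_apply]

open scoped Classical in
/-- Truncation of cochains along a map to the interval. -/
noncomputable def trunc (k : Type) [CommRing k] (d : ℕ) {a : SimplexCategory} (φ : a ⟶ ⦋1⦌) :
    Cochain k d a →ₗ[k] Cochain k d a where
  toFun c := ⟨fun ι => if ∀ i, (ι ≫ φ).toOrderHom i = 1 then c.1 ι else 0, fun ι hι => by
    dsimp only
    rw [c.2 ι hι, ite_self]⟩
  map_add' c c' := by
    refine Subtype.ext (funext fun ι => ?_)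
    change (if _ then c.1 ι + c'.1 ι else 0) = (if _ then _ else _) + (if _ then _ else _)
    split_ifs <;> simp
  map_smul' r c := by
    refine Subtype.ext (funext fun ι => ?_)
    change (if _ then r * c.1 ι else 0) = r * (if _ then _ else _)
    split_ifs <;> simp

lemma trunc_one : trunc k d (SimplexCategory.const a ⦋1⦌ 1) = LinearMap.id :=
  LinearMap.ext fun _ => Subtype.ext (funext fun _ => if_pos fun _ => rfl)

lemma trunc_zero : trunc k d (SimplexCategory.const a ⦋1⦌ 0) = 0 :=
  LinearMap.ext fun c => Subtype.ext (funext fun _ => if_neg fun h =>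
    absurd (show (0 : Fin 2) = 1 from h 0) (by decide))

lemma trunc_pull {b : SimplexCategory} (θ : a ⟶ b) (φ : b ⟶ ⦋1⦌) :
    cochainPull k d θ ∘ₗ trunc k d φ = trunc k d (θ ≫ φ) ∘ₗ cochainPull k d θ := by
  refine LinearMap.ext fun c => Subtype.ext (funext fun ι => ?_)
  change (if ∀ i, ((ι ≫ θ) ≫ φ).toOrderHom i = 1 then _ else _) = _
  rw [Category.assoc]
  rfl

end CocycleBasis

end EMSpace

namespace EMSpace

section CocycleModule

open Opposite
open scoped Simplicial

variable {F : Type} [Field F]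

/-- The simplicial module given by a contravariant family of linear maps. -/
noncomputable def sMk (V : SimplexCategory → Type) [∀ a, AddCommGroup (V a)] [∀ a, Module F (V a)]
    (m : ∀ {a b : SimplexCategory}, (a ⟶ b) → V b →ₗ[F] V a)
    (hid : ∀ a, m (𝟙 a) = LinearMap.id)
    (hcomp : ∀ {a b c : SimplexCategory} (θ : a ⟶ b) (η : b ⟶ c), m (θ ≫ η) = m θ ∘ₗ m η) :
    SMod F where
  obj a := ModuleCat.of F (V a.unop)
  map θ := ModuleCat.ofHom (m θ.unop)
  map_id a := by
    rw [unop_id, hid]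
    rfl
  map_comp θ η := by
    rw [unop_comp, hcomp]
    rfl

lemma cocyclePull_id (k : Type) [CommRing k] (d : ℕ) (a : SimplexCategory) :
    cocyclePull k d (𝟙 a) = LinearMap.id :=
  LinearMap.ext fun c => Subtype.ext (funext fun ι => congrArg c.1 (Category.comp_id ι))

lemma cocyclePull_comp (k : Type) [CommRing k] (d : ℕ) {a b c : SimplexCategory} (θ : a ⟶ b)
    (η : b ⟶ c) : cocyclePull k d (θ ≫ η) = cocyclePull k d θ ∘ₗ cocyclePull k d η :=
  LinearMap.ext fun c => Subtype.ext (funext fun ι =>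
    congrArg c.1 (Category.assoc ι θ η).symm)

lemma cochainPull_id (k : Type) [CommRing k] (d : ℕ) (a : SimplexCategory) :
    cochainPull k d (𝟙 a) = LinearMap.id :=
  LinearMap.ext fun c => Subtype.ext (funext fun ι => congrArg c.1 (Category.comp_id ι))

lemma cochainPull_comp (k : Type) [CommRing k] (d : ℕ) {a b c : SimplexCategory} (θ : a ⟶ b)
    (η : b ⟶ c) : cochainPull k d (θ ≫ η) = cochainPull k d θ ∘ₗ cochainPull k d η :=
  LinearMap.ext fun c => Subtype.ext (funext fun ι =>
    congrArg c.1 (Category.assoc ι θ η).symm)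

variable (F) in
/-- The simplicial module of cocycles. -/
noncomputable def cocS (d : ℕ) : SMod F :=
  sMk (fun a => Cocycle F d a) (cocyclePull F d) (cocyclePull_id F d) (cocyclePull_comp F d)

variable (F) in
/-- The simplicial module of cochains. -/
noncomputable def cochS (d : ℕ) : SMod F :=
  sMk (fun a => Cochain F d a) (cochainPull F d) (cochainPull_id F d) (cochainPull_comp F d)

variable (F) in
/-- The inclusion of cocycles in cochains. -/
noncomputable def cocIncl (d : ℕ) : cocS F d ⟶ cochS F d where
  app a := ModuleCat.ofHom (Submodule.inclusion
    (inf_le_left : Cocycle F d a.unop ≤ Cochain F d a.unop))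
  naturality _ _ _ := rfl

variable (F) in
/-- The coboundary of cochains. -/
noncomputable def cocBd (d : ℕ) : cochS F d ⟶ cocS F (d + 1) where
  app a := ModuleCat.ofHom (coboundaryHom F d a.unop)
  naturality _ _ θ := ModuleCat.hom_ext (LinearMap.ext fun c =>
    Subtype.ext (coboundary_pull θ.unop c.1))

lemma isSES_coc (d : ℕ) : IsSES (cocIncl F d) (cocBd F d) where
  inj a := Submodule.inclusion_injective
    (inf_le_left : Cocycle F d a.unop ≤ Cochain F d a.unop)
  exact _ c := ⟨fun h => ⟨⟨c.1, c.2, congrArg Subtype.val h⟩, rfl⟩, by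
    rintro ⟨z, rfl⟩
    exact Subtype.ext z.2.2⟩
  surj _ := coboundaryHom_surjective

lemma subsingleton_homology_cochS (d s : ℕ) :
    Subsingleton ((homologyFun F s).obj (cochS F d)) :=
  HFamily.subsingleton
    { H := fun φ => ModuleCat.ofHom (trunc F d φ)
      nat := fun θ φ => ModuleCat.hom_ext (trunc_pull θ φ) }
    (fun _ => ModuleCat.hom_ext trunc_one) (fun _ => ModuleCat.hom_ext trunc_zero) s

lemma nontrivial_homology_cocS_zero : Nontrivial ((homologyFun F 0).obj (cocS F 0)) := by
  by_contra h
  rw [not_nontrivial_iff_subsingleton] at h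
  have h1 := ModuleCat.isZero_of_subsingleton ((homologyFun F 0).obj (cocS F 0))
  have h2 : ((alternatingFaceMapComplex _).obj (cocS F 0)).ExactAt 0 := by
    rw [HomologicalComplex.exactAt_iff_isZero_homology]
    exact h1
  rw [HomologicalComplex.exactAt_iff' _ 1 0 0 (by simp) (by simp),
    ShortComplex.moduleCat_exact_iff] at h2
  obtain ⟨y, hy⟩ := h2 (cocycleBasis F 0 ⦋0⦌ ⟨𝟙 _, Function.surjective_id⟩) (by
    change (((alternatingFaceMapComplex _).obj (cocS F 0)).d 0 0).hom _ = 0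
    rw [HomologicalComplex.shape _ _ _ (by simp)]
    rfl)
  have hd : ((alternatingFaceMapComplex _).obj (cocS F 0)).d 1 0 = 0 := by
    rw [alternatingFaceMapComplex_obj_d]
    change AlternatingFaceMapComplex.objD (cocS F 0) 0 = 0
    rw [AlternatingFaceMapComplex.objD, Fin.sum_univ_two]
    have : (cocS F 0).δ (0 : Fin 2) = (cocS F 0).δ 1 := by
      refine ModuleCat.hom_ext (LinearMap.ext fun c => Subtype.ext (funext fun ι => ?_))
      exact (Cocycle.apply_eq_of_zero c.2 _).trans (Cocycle.apply_eq_of_zero c.2 _).symm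
    rw [this]
    simp
  change (((alternatingFaceMapComplex _).obj (cocS F 0)).d 1 0).hom y = _ at hy
  rw [hd] at hy
  exact (cocycleBasis F 0 ⦋0⦌).ne_zero _ hy.symm

lemma nontrivial_homology_cocS (d : ℕ) : Nontrivial ((homologyFun F d).obj (cocS F d)) := by
  induction d with
  | zero => exact nontrivial_homology_cocS_zero
  | succ d ih =>
    obtain ⟨x, hx⟩ := exists_ne (0 : (homologyFun F d).obj (cocS F d))
    have := subsingleton_homology_cochS (F := F) d d
    obtain ⟨y, rfl⟩ := ((isSES_coc (F := F) d).exact₁ d x).1 (Subsingleton.elim _ _)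
    refine ⟨y, 0, ?_⟩
    rintro rfl
    exact hx (map_zero _)

end CocycleModule

end EMSpace

namespace EMSpace

section Koszul

/-- Operators of a Koszul complex on a graded module. -/
structure KoszulOps (F : Type) [Field F] (T : Type) (X : Type) [AddCommGroup X] [Module F X] where
  /-- the sequence of commuting operators -/
  D : T → X →ₗ[F] X
  /-- contraction operators -/
  ι : T → X →ₗ[F] X
  /-- exterior multiplication operators -/
  e : T → X →ₗ[F] X
  /-- the grading -/
  P : ℕ → Submodule F X
  D_comm : ∀ s t x, D s (D t x) = D t (D s x)
  ι_D : ∀ s t x, ι s (D t x) = D t (ι s x)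
  e_D : ∀ s t x, e s (D t x) = D t (e s x)
  ι_ι : ∀ s t x, ι s (ι t x) = - ι t (ι s x)
  ι_self : ∀ s x, ι s (ι s x) = 0
  ι_e_self : ∀ s x, ι s (e s x) = x - e s (ι s x)
  ι_e : ∀ s t x, s ≠ t → ι t (e s x) = - e s (ι t x)
  D_mem : ∀ t i x, x ∈ P i → D t x ∈ P i
  ι_mem : ∀ t i x, x ∈ P (i + 1) → ι t x ∈ P i
  ι_zero : ∀ t x, x ∈ P 0 → ι t x = 0
  e_mem : ∀ t i x, x ∈ P i → e t x ∈ P (i + 1)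
  eq_zero : ∀ i x, x ∈ P (i + 1) → (∀ t, ι t x = 0) → x = 0
  regular : ∀ (R : Finset T) (s : T), s ∉ R → ∀ c ∈ P 0, ∀ a : T → X, (∀ t, a t ∈ P 0) →
    D s c = ∑ t ∈ R, D t (a t) → ∃ a' : T → X, (∀ t, a' t ∈ P 0) ∧ c = ∑ t ∈ R, D t (a' t)

namespace KoszulOps

variable {F : Type} [Field F] {T : Type} [Fintype T] {X : Type} [AddCommGroup X] [Module F X]
  (O : KoszulOps F T X)

/-- The Koszul differential. -/
def d : X →ₗ[F] X := ∑ t, O.D t ∘ₗ O.ι t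

lemma d_apply (x : X) : O.d x = ∑ t, O.D t (O.ι t x) := by
  simp [d]

lemma d_mem {i : ℕ} {x : X} (hx : x ∈ O.P (i + 1)) : O.d x ∈ O.P i := by
  rw [d_apply]
  exact Submodule.sum_mem _ fun t _ => O.D_mem _ _ _ (O.ι_mem _ _ _ hx)

lemma d_d (x : X) : O.d (O.d x) = 0 := by
  classical
  simp only [d_apply, map_sum]
  rw [← Finset.sum_product']
  refine Finset.sum_involution (fun p _ => p.swap) ?_ ?_ ?_ ?_
  · rintro ⟨s, t⟩ -
    simp only [Prod.swap, O.ι_D]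
    rw [O.ι_ι s t, O.D_comm s t]
    simp
  · rintro ⟨s, t⟩ - h h'
    obtain rfl : t = s := congrArg Prod.fst h'
    refine h ?_
    simp [O.ι_D, O.ι_self]
  · simp
  · simp

lemma ι_d (s : T) (x : X) : O.ι s (O.d x) = - O.d (O.ι s x) := by
  simp only [d_apply, map_sum, O.ι_D, ← Finset.sum_neg_distrib]
  exact Finset.sum_congr rfl fun t _ => by rw [O.ι_ι s t, map_neg]

lemma d_e (s : T) (x : X) : O.d (O.e s x) = O.D s x - O.e s (O.d x) := by
  classical
  rw [d_apply, d_apply, map_sum, ← Finset.add_sum_erase _ _ (Finset.mem_univ s),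
    ← Finset.add_sum_erase (a := s) (f := fun t => O.e s _) _ (Finset.mem_univ s), O.ι_e_self,
    map_sub, O.e_D, ← sub_sub, sub_eq_add_neg (_ - _) (Finset.sum _ _), ← Finset.sum_neg_distrib]
  congr 1
  refine Finset.sum_congr rfl fun t ht => ?_
  rw [O.ι_e s t x (Finset.ne_of_mem_erase ht).symm, map_neg, O.e_D]

lemma d_sum_e (R : Finset T) {a : T → X} (ha : ∀ t, a t ∈ O.P 0) :
    O.d (∑ t ∈ R, O.e t (a t)) = ∑ t ∈ R, O.D t (a t) := by
  rw [map_sum]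
  refine Finset.sum_congr rfl fun t _ => ?_
  have : O.d (a t) = 0 := by
    rw [d_apply]
    exact Finset.sum_eq_zero fun s _ => by rw [O.ι_zero _ _ (ha t), map_zero]
  rw [d_e, this, map_zero, sub_zero]

lemma exists_d_eq_aux (R : Finset T) : ∀ (i : ℕ) (x : X), x ∈ O.P (i + 1) →
    (∀ t ∉ R, O.ι t x = 0) → O.d x = 0 →
    ∃ w ∈ O.P (i + 2), (∀ t ∉ R, O.ι t w = 0) ∧ O.d w = x := by
  classical
  induction R using Finset.induction_on with
  | empty =>
    intro i x hx h _
    refine ⟨0, Submodule.zero_mem _, fun t _ => map_zero _, ?_⟩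
    rw [map_zero, O.eq_zero i x hx fun t => h t (Finset.notMem_empty t)]
  | insert s R hs ih =>
    intro i x hx h hd
    have hz1 : O.ι s x ∈ O.P i := O.ι_mem _ _ _ hx
    have hz2 : ∀ t ∉ R, O.ι t (O.ι s x) = 0 := fun t ht => by
      by_cases hts : t = s
      · rw [hts, O.ι_self]
      · rw [O.ι_ι, h t (by simp [hts, ht]), map_zero, neg_zero]
    have hz3 : O.d (O.ι s x) = 0 := by
      rw [← neg_eq_zero, ← O.ι_d, hd, map_zero]
    obtain ⟨w, hw1, hw2, hw3⟩ : ∃ w ∈ O.P (i + 1), (∀ t ∉ R, O.ι t w = 0) ∧ O.d w = O.ι s x := by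
      cases i with
      | succ i => exact ih i _ hz1 hz2 hz3
      | zero =>
        have hu : O.d (x - O.e s (O.ι s x)) = - O.D s (O.ι s x) := by
          rw [map_sub, hd, d_e, hz3]
          simp
        have hu2 : ∀ t ∉ R, O.ι t (x - O.e s (O.ι s x)) = 0 := fun t ht => by
          by_cases hts : t = s
          · rw [hts, map_sub, O.ι_e_self, O.ι_self, map_zero, sub_zero, sub_self]
          · rw [map_sub, O.ι_e s t _ (Ne.symm hts), hz2 t ht, h t (by simp [hts, ht])]
            simp
        have hu1 : x - O.e s (O.ι s x) ∈ O.P 1 := Submodule.sub_mem _ hx (O.e_mem _ _ _ hz1)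
        obtain ⟨a, ha, hc⟩ := O.regular R s hs _ hz1
          (fun t => - O.ι t (x - O.e s (O.ι s x)))
          (fun t => Submodule.neg_mem _ (O.ι_mem _ _ _ hu1)) (by
            simp only [map_neg, Finset.sum_neg_distrib]
            rw [eq_neg_iff_add_eq_zero, ← neg_eq_iff_add_eq_zero, ← hu, d_apply]
            refine (Finset.sum_subset (Finset.subset_univ R) fun t _ ht => ?_).symm
            rw [hu2 t ht, map_zero])
        refine ⟨∑ t ∈ R, O.e t (a t), Submodule.sum_mem _ fun t _ => O.e_mem _ _ _ (ha t),
          fun t ht => ?_, by rw [O.d_sum_e R ha, ← hc]⟩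
        rw [map_sum]
        refine Finset.sum_eq_zero fun r hr => ?_
        rw [O.ι_e r t _ (by rintro rfl; exact ht hr), O.ι_zero _ _ (ha r), map_zero, neg_zero]
    have he : O.d (O.e s w) = O.D s w - O.e s (O.ι s x) := by rw [d_e, hw3]
    obtain ⟨v, hv1, hv2, hv3⟩ := ih i (x + O.d (O.e s w))
      (Submodule.add_mem _ hx (O.d_mem (O.e_mem _ _ _ hw1))) (fun t ht => by
        rw [he]
        by_cases hts : t = s
        · subst hts
          rw [map_add, map_sub, O.ι_D, hw2 t ht, O.ι_e_self, O.ι_self]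
          simp
        · rw [map_add, map_sub, O.ι_D, hw2 t ht, O.ι_e s t _ (Ne.symm hts), hz2 t ht,
            h t (by simp [hts, ht])]
          simp) (by rw [map_add, hd, O.d_d, add_zero])
    refine ⟨v - O.e s w, Submodule.sub_mem _ hv1 (O.e_mem _ _ _ hw1), fun t ht => ?_, ?_⟩
    · rw [Finset.mem_insert, not_or] at ht
      rw [map_sub, hv2 t ht.2, O.ι_e s t _ (Ne.symm ht.1), hw2 t ht.2]
      simp
    · rw [map_sub, hv3, add_sub_cancel_right]

/-- Exactness of a Koszul complex in positive degrees. -/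
lemma exists_d_eq {i : ℕ} {x : X} (hx : x ∈ O.P (i + 1)) (hd : O.d x = 0) :
    ∃ w ∈ O.P (i + 2), O.d w = x := by
  obtain ⟨w, h1, -, h3⟩ := O.exists_d_eq_aux Finset.univ i x hx
    (fun t ht => absurd (Finset.mem_univ t) ht) hd
  exact ⟨w, h1, h3⟩

end KoszulOps

end Koszul

end EMSpace

namespace EMSpace

section Exterior

open ExteriorAlgebra

variable {F : Type} [Field F] {V W : Type} [AddCommGroup V] [Module F V] [AddCommGroup W]
  [Module F W]

@[elab_as_elim]
lemma ext_induction {C : ExteriorAlgebra F V → Prop} (one : ∀ r, C (algebraMap F _ r))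
    (add : ∀ x y, C x → C y → C (x + y)) (mul : ∀ v x, C x → C (ι F v * x)) (x) : C x :=
  CliffordAlgebra.left_induction (Q := (0 : QuadraticForm F V)) one add (fun x v => mul v x) x

/-- Contraction with a linear form. -/
noncomputable def contr (φ : Module.Dual F V) : ExteriorAlgebra F V →ₗ[F] ExteriorAlgebra F V :=
  CliffordAlgebra.contractLeft (Q := (0 : QuadraticForm F V)) φ

lemma contr_ι_mul (φ : Module.Dual F V) (v : V) (x : ExteriorAlgebra F V) :
    contr φ (ι F v * x) = φ v • x - ι F v * contr φ x :=
  CliffordAlgebra.contractLeft_ι_mul (Q := 0) φ v x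

lemma contr_algebraMap (φ : Module.Dual F V) (r : F) : contr φ (algebraMap F _ r) = 0 :=
  CliffordAlgebra.contractLeft_algebraMap (0 : QuadraticForm F V) φ r

lemma contr_contr (φ : Module.Dual F V) (x : ExteriorAlgebra F V) : contr φ (contr φ x) = 0 :=
  CliffordAlgebra.contractLeft_contractLeft (Q := (0 : QuadraticForm F V)) φ x

lemma contr_comm (φ ψ : Module.Dual F V) (x : ExteriorAlgebra F V) :
    contr φ (contr ψ x) = - contr ψ (contr φ x) :=
  CliffordAlgebra.contractLeft_comm (Q := (0 : QuadraticForm F V)) φ ψ x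

lemma contr_sum {T : Type} (s : Finset T) (φ : T → Module.Dual F V) :
    contr (∑ t ∈ s, φ t) = ∑ t ∈ s, contr (φ t) :=
  map_sum (CliffordAlgebra.contractLeft (Q := (0 : QuadraticForm F V))) φ s

lemma contr_zero : contr (0 : Module.Dual F V) = 0 :=
  map_zero (CliffordAlgebra.contractLeft (Q := (0 : QuadraticForm F V)))

lemma contr_map (g : V →ₗ[F] W) (φ : Module.Dual F W) (x : ExteriorAlgebra F V) :
    contr φ (map g x) = map g (contr (φ ∘ₗ g) x) := by
  induction x using ext_induction with
  | one r => rw [AlgHom.commutes, contr_algebraMap, contr_algebraMap, map_zero]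
  | add x y hx hy => simp only [map_add, hx, hy]
  | mul v x hx =>
    rw [map_mul, map_apply_ι, contr_ι_mul, contr_ι_mul, hx, map_sub, map_smul, map_mul, map_apply_ι]
    rfl

lemma exteriorPower_zero : ⋀[F]^0 V = (1 : Submodule F (ExteriorAlgebra F V)) := pow_zero _

lemma exteriorPower_succ (i : ℕ) : ⋀[F]^(i + 1) V = LinearMap.range (ι F) * ⋀[F]^i V :=
  pow_succ' _ _

lemma algebraMap_mem_zero (r : F) : algebraMap F (ExteriorAlgebra F V) r ∈ ⋀[F]^0 V := by
  rw [exteriorPower_zero, Submodule.mem_one]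
  exact ⟨r, rfl⟩

lemma ι_mul_mem {i : ℕ} (v : V) {x : ExteriorAlgebra F V} (hx : x ∈ ⋀[F]^i V) :
    ι F v * x ∈ ⋀[F]^(i + 1) V := by
  rw [exteriorPower_succ]
  exact Submodule.mul_mem_mul ⟨v, rfl⟩ hx

lemma contr_mem {i : ℕ} (φ : Module.Dual F V) : ∀ {x : ExteriorAlgebra F V},
    x ∈ ⋀[F]^(i + 1) V → contr φ x ∈ ⋀[F]^i V := by
  induction i with
  | zero =>
    intro x hx
    rw [exteriorPower_succ, exteriorPower_zero, mul_one] at hx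
    obtain ⟨v, rfl⟩ := hx
    have := contr_ι_mul φ v 1
    rw [mul_one, ← map_one (algebraMap F _), contr_algebraMap, mul_zero, sub_zero,
      map_one, ← Algebra.algebraMap_eq_smul_one] at this
    rw [this]
    exact algebraMap_mem_zero _
  | succ i ih =>
    intro x hx
    rw [exteriorPower_succ] at hx
    induction hx using Submodule.mul_induction_on' with
    | mem_mul_mem m hm n hn =>
      obtain ⟨v, rfl⟩ := hm
      rw [contr_ι_mul]
      exact Submodule.sub_mem _ (Submodule.smul_mem _ _ hn) (ι_mul_mem v (ih hn))
    | add x _ y _ hx hy =>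
      rw [map_add]
      exact Submodule.add_mem _ hx hy

lemma contr_eq_zero (φ : Module.Dual F V) {x : ExteriorAlgebra F V} (hx : x ∈ ⋀[F]^0 V) :
    contr φ x = 0 := by
  rw [exteriorPower_zero, Submodule.mem_one] at hx
  obtain ⟨r, rfl⟩ := hx
  exact contr_algebraMap φ r

lemma map_mem {i : ℕ} (g : V →ₗ[F] W) {x : ExteriorAlgebra F V} (hx : x ∈ ⋀[F]^i V) :
    map g x ∈ ⋀[F]^i W := by
  induction i generalizing x with
  | zero =>
    rw [exteriorPower_zero, Submodule.mem_one] at hx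
    obtain ⟨r, rfl⟩ := hx
    rw [AlgHom.commutes]
    exact algebraMap_mem_zero r
  | succ i ih =>
    rw [exteriorPower_succ] at hx
    induction hx using Submodule.mul_induction_on' with
    | mem_mul_mem m hm n hn =>
      obtain ⟨v, rfl⟩ := hm
      rw [map_mul, map_apply_ι]
      exact ι_mul_mem _ (ih hn)
    | add x _ y _ hx hy =>
      rw [map_add]
      exact Submodule.add_mem _ hx hy

/-- The projection along a basis vector. -/
lemma map_sub_eq (b : V) (φ : Module.Dual F V) (x : ExteriorAlgebra F V) :
    map (LinearMap.id - φ.smulRight b) x = x - ι F b * contr φ x := by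
  induction x using ext_induction with
  | one r => rw [AlgHom.commutes, contr_algebraMap, mul_zero, sub_zero]
  | add x y hx hy => rw [map_add, map_add, hx, hy, mul_add]; abel
  | mul v x hx =>
    rw [map_mul, map_apply_ι, hx, contr_ι_mul]
    have h1 : ι F b * ι F v = - (ι F v * ι F b) := eq_neg_of_add_eq_zero_left (ι_add_mul_swap b v)
    have h2 : ι F b * (ι F b * contr φ x) = 0 := by rw [← mul_assoc, ι_sq_zero, zero_mul]
    simp only [LinearMap.sub_apply, LinearMap.id_apply, LinearMap.smulRight_apply, map_sub,
      map_smul, sub_mul, mul_sub, smul_mul_assoc, mul_smul_comm, h2]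
    rw [← mul_assoc (ι F b), h1, neg_mul, mul_assoc, smul_zero]
    abel

lemma map_zero_eq (x : ExteriorAlgebra F V) :
    map (0 : V →ₗ[F] W) x = algebraMap F _ (algebraMapInv x) := by
  have : map (0 : V →ₗ[F] W) = (Algebra.ofId F _).comp algebraMapInv := by
    ext v
    simp [algebraMapInv]
  rw [this]
  rfl

lemma eq_algebraMap_of_contr {T : Type} [Finite T] (b : Module.Basis T F V)
    {x : ExteriorAlgebra F V} (hx : ∀ t, contr (b.coord t) x = 0) :
    x = algebraMap F _ (algebraMapInv x) := by
  classical
  have := Fintype.ofFinite T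
  have key (R : Finset T) :
      map (LinearMap.id - ∑ t ∈ R, (b.coord t).smulRight (b t)) x = x := by
    induction R using Finset.induction_on with
    | empty => simp
    | insert s R hs ih =>
      have h : LinearMap.id - ∑ t ∈ insert s R, (b.coord t).smulRight (b t) =
          (LinearMap.id - (b.coord s).smulRight (b s)) ∘ₗ
            (LinearMap.id - ∑ t ∈ R, (b.coord t).smulRight (b t)) := by
        refine b.ext fun r => ?_
        rw [Finset.sum_insert hs]
        simp only [LinearMap.comp_apply, LinearMap.sub_apply, LinearMap.add_apply,
          LinearMap.sum_apply, LinearMap.smulRight_apply, LinearMap.id_apply, map_sub, map_sum,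
          map_smul, Module.Basis.coord_apply, Module.Basis.repr_self]
        rw [← sub_sub]
        congr 1
        refine Finset.sum_congr rfl fun t ht => ?_
        rw [Finsupp.single_apply (a := t), if_neg (by rintro rfl; exact hs ht), zero_smul, sub_zero]
      rw [h, ← map_comp_map, AlgHom.comp_apply, ih, map_sub_eq, hx, mul_zero, sub_zero]
  have h := key Finset.univ
  have h0 : (LinearMap.id - ∑ t, (b.coord t).smulRight (b t) : V →ₗ[F] V) = 0 := by
    refine b.ext fun r => ?_
    simp [LinearMap.sum_apply, Finsupp.single_apply]
  rw [h0, map_zero_eq] at h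
  exact h.symm

lemma eq_zero_of_contr {T : Type} [Finite T] (b : Module.Basis T F V) {i : ℕ}
    {x : ExteriorAlgebra F V} (hi : x ∈ ⋀[F]^(i + 1) V) (hx : ∀ t, contr (b.coord t) x = 0) :
    x = 0 := by
  have h0 : x ∈ ⋀[F]^0 V := by
    rw [eq_algebraMap_of_contr b hx]
    exact algebraMap_mem_zero _
  by_contra hne
  exact Nat.succ_ne_zero i
    (DirectSum.degree_eq_of_mem_mem (fun i => ⋀[F]^i V) hi h0 hne)

end Exterior

end EMSpace

namespace EMSpace

section Translation

open Finsupp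

variable {F : Type} [Field F] {W W' : Type} [AddCommGroup W] [Module F W] [AddCommGroup W']
  [Module F W'] {L K : Type} [AddCommGroup L] [AddCommGroup K]

variable (F W) in
/-- The translation difference operator on finitely supported functions. -/
noncomputable def transD (l : L) : (L →₀ W) →ₗ[F] (L →₀ W) :=
  lmapDomain W F (fun m => l + m) - LinearMap.id

lemma transD_single (l m : L) (w : W) :
    transD F W l (single m w) = single (l + m) w - single m w := by
  simp [transD]

lemma transD_zero : transD F W (0 : L) = 0 := by
  refine lhom_ext fun m w => ?_
  rw [transD_single, zero_add, sub_self, LinearMap.zero_apply]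

lemma transD_comm (l l' : L) (x : L →₀ W) :
    transD F W l (transD F W l' x) = transD F W l' (transD F W l x) := by
  suffices h : transD F W l ∘ₗ transD F W l' = transD F W l' ∘ₗ transD F W l from
    LinearMap.congr_fun h x
  refine lhom_ext fun m w => ?_
  simp only [LinearMap.comp_apply, transD_single, map_sub]
  rw [add_left_comm]
  abel

lemma mapDomain_transD (f : L →+ K) (l : L) (x : L →₀ W) :
    lmapDomain W F f (transD F W l x) = transD F W (f l) (lmapDomain W F f x) := by
  suffices h : lmapDomain W F f ∘ₗ transD F W l = transD F W (f l) ∘ₗ lmapDomain W F f from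
    LinearMap.congr_fun h x
  refine lhom_ext fun m w => ?_
  simp only [LinearMap.comp_apply, transD_single, map_sub, lmapDomain_apply, mapDomain_single,
    map_add]

lemma mapRange_transD (g : W →ₗ[F] W') (l : L) (x : L →₀ W) :
    mapRange.linearMap g (transD F W l x) = transD F W' l (mapRange.linearMap g x) := by
  suffices h : mapRange.linearMap g ∘ₗ transD F W l = transD F W' l ∘ₗ mapRange.linearMap g from
    LinearMap.congr_fun h x
  refine lhom_ext fun m w => ?_
  simp only [LinearMap.comp_apply, transD_single, map_sub, mapRange.linearMap_apply,
    mapRange_single]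

lemma mapDomain_transD_of_mem_ker (f : L →+ K) {l : L} (hl : f l = 0) (x : L →₀ W) :
    lmapDomain W F f (transD F W l x) = 0 := by
  rw [mapDomain_transD, hl, transD_zero, LinearMap.zero_apply]

variable {T : Type}

lemma exists_eq_sum_transD (ℓ : T → L) (R : Finset T) (f : L →+ K)
    (hf : f.ker ≤ AddSubgroup.closure (ℓ '' R)) {x : L →₀ W} (hx : lmapDomain W F f x = 0) :
    ∃ a : T → (L →₀ W), x = ∑ t ∈ R, transD F W (ℓ t) (a t) := by
  classical
  let I : Submodule F (L →₀ W) :=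
    { carrier := {x | ∃ a : T → (L →₀ W), x = ∑ t ∈ R, transD F W (ℓ t) (a t)}
      zero_mem' := ⟨0, by simp⟩
      add_mem' := by
        rintro _ _ ⟨a, rfl⟩ ⟨b, rfl⟩
        exact ⟨a + b, by simp [Finset.sum_add_distrib]⟩
      smul_mem' := by
        rintro r _ ⟨a, rfl⟩
        exact ⟨r • a, by simp [Finset.smul_sum]⟩ }
  change x ∈ I
  have hgen (t) (ht : t ∈ R) (y) : transD F W (ℓ t) y ∈ I := by
    refine ⟨fun s => if s = t then y else 0, ?_⟩
    rw [Finset.sum_eq_single t]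
    · simp
    · intro s _ hs
      simp [hs]
    · exact fun h => absurd ht h
  have hcl (l) (hl : l ∈ AddSubgroup.closure (ℓ '' R)) :
      ∀ (m : L) (w : W), single (l + m) w - single m w ∈ I := by
    induction hl using AddSubgroup.closure_induction with
    | mem l hl =>
      obtain ⟨t, ht, rfl⟩ := hl
      intro m w
      rw [← transD_single (F := F)]
      exact hgen t ht _
    | zero =>
      intro m w
      rw [zero_add, sub_self]
      exact I.zero_mem
    | add l l' _ _ h h' =>
      intro m w
      have := I.add_mem (h (l' + m) w) (h' m w)
      rwa [sub_add_sub_cancel, ← add_assoc] at this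
    | neg l _ h =>
      intro m w
      have := I.neg_mem (h (-l + m) w)
      rwa [add_neg_cancel_left, neg_sub] at this
  let σ : K → L := Function.invFun f
  have hσ (l : L) : f (σ (f l)) = f l := Function.invFun_eq ⟨l, rfl⟩
  have hred (y : L →₀ W) : y - mapDomain σ (mapDomain f y) ∈ I := by
    induction y using Finsupp.induction_linear with
    | zero => simp
    | add y z hy hz =>
      rw [mapDomain_add, mapDomain_add, add_sub_add_comm]
      exact I.add_mem hy hz
    | single l w =>
      rw [mapDomain_single, mapDomain_single]
      have := hcl (l - σ (f l)) (hf (by rw [AddMonoidHom.mem_ker, map_sub, hσ, sub_self]))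
        (σ (f l)) w
      rwa [sub_add_cancel] at this
  have := hred x
  rw [lmapDomain_apply] at hx
  rwa [hx, mapDomain_zero, sub_zero] at this

lemma eq_zero_of_transD_eq_zero {k : K} (hk : ∀ n : ℕ, n • k = 0 → n = 0) {x : K →₀ W}
    (hx : transD F W k x = 0) : x = 0 := by
  by_contra hne
  obtain ⟨m, hm⟩ := Finsupp.ne_iff.1 hne
  have hx' : mapDomain (fun m => k + m) x = x := sub_eq_zero.1 hx
  have hstep (m) : x (k + m) = x m := by
    conv_lhs => rw [← hx']
    exact mapDomain_apply (add_right_injective k) x m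
  have hall (n : ℕ) : x (n • k + m) = x m := by
    induction n with
    | zero => simp
    | succ n ih => rw [succ_nsmul', add_assoc, hstep, ih]
  have hinj : Function.Injective fun n : ℕ => n • k + m := fun n n' h => by
    rw [add_left_inj] at h
    rcases le_total n n' with hle | hle
    · have := hk (n' - n) (by rw [sub_nsmul _ hle, h]; simp)
      omega
    · have := hk (n - n') (by rw [sub_nsmul _ hle, h]; simp)
      omega
  refine (Set.infinite_range_of_injective hinj) (x.hasFiniteSupport.subset ?_)
  rintro _ ⟨n, rfl⟩
  change x (n • k + m) ≠ 0
  rw [hall]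
  exact hm

lemma transD_regular {ℓ : T → L} (hℓ : LinearIndependent ℤ ℓ) {R : Finset T} {s : T} (hs : s ∉ R)
    {x : L →₀ W} {a : T → (L →₀ W)}
    (hx : transD F W (ℓ s) x = ∑ t ∈ R, transD F W (ℓ t) (a t)) :
    ∃ b : T → (L →₀ W), x = ∑ t ∈ R, transD F W (ℓ t) (b t) := by
  let H := AddSubgroup.closure (ℓ '' R)
  refine exists_eq_sum_transD ℓ R (QuotientAddGroup.mk' H) (by rw [QuotientAddGroup.ker_mk']) ?_
  refine eq_zero_of_transD_eq_zero (F := F) (k := QuotientAddGroup.mk' H (ℓ s)) (fun n hn => ?_) ?_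
  · rw [← map_nsmul] at hn
    have h1 : n • ℓ s ∈ H := (QuotientAddGroup.eq_zero_iff _).1 hn
    have h2 : (n : ℤ) • ℓ s ∈ Submodule.span ℤ (ℓ '' R) := by
      rw [natCast_zsmul]
      rw [← Submodule.mem_toAddSubgroup, Submodule.span_int_eq_addSubgroupClosure]
      exact h1
    have hsub : ℓ '' R ⊆ ℓ '' (Set.univ \ {s}) := Set.image_mono
      fun t ht => ⟨Set.mem_univ t, by rintro rfl; exact hs ht⟩
    have := linearIndependent_iff_eq_zero_of_smul_mem_span.1 hℓ s (n : ℤ)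
      (Submodule.span_mono hsub h2)
    exact_mod_cast this
  · rw [← mapDomain_transD, hx, map_sum]
    refine Finset.sum_eq_zero fun t ht => mapDomain_transD_of_mem_ker _ ?_ _
    exact (QuotientAddGroup.eq_zero_iff _).2 (AddSubgroup.subset_closure ⟨t, ht, rfl⟩)

end Translation

end EMSpace

namespace EMSpace

section ExteriorKoszul

open Finsupp

/-- Finitely supported functions with values in a submodule. -/
def finsuppIn {F : Type} [Field F] {W : Type} [AddCommGroup W] [Module F W] (L : Type)
    (U : Submodule F W) : Submodule F (L →₀ W) where
  carrier := {x | ∀ l, x l ∈ U}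
  zero_mem' _ := U.zero_mem
  add_mem' hx hy l := U.add_mem (hx l) (hy l)
  smul_mem' r _ hx l := U.smul_mem r (hx l)

variable {F : Type} [Field F] {W W' : Type} [AddCommGroup W] [Module F W] [AddCommGroup W']
  [Module F W'] {L K : Type}

lemma mapDomain_mem_finsuppIn {U : Submodule F W} (f : L → K) {x : L →₀ W}
    (hx : x ∈ finsuppIn L U) : lmapDomain W F f x ∈ finsuppIn K U := by
  classical
  rw [lmapDomain_apply, mapDomain]
  refine Submodule.sum_mem _ fun l _ k => ?_
  dsimp only
  rw [single_apply]
  split_ifs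
  · exact hx l
  · exact U.zero_mem

lemma mapRange_mem_finsuppIn {U : Submodule F W} {U' : Submodule F W'} (g : W →ₗ[F] W')
    (hg : ∀ w ∈ U, g w ∈ U') {x : L →₀ W}
    (hx : x ∈ finsuppIn L U) : mapRange.linearMap g x ∈ finsuppIn L U' := fun l => hg _ (hx l)

lemma transD_mem_finsuppIn [AddCommGroup L] {U : Submodule F W} (l : L) {x : L →₀ W}
    (hx : x ∈ finsuppIn L U) : transD F W l x ∈ finsuppIn L U :=
  Submodule.sub_mem _ (mapDomain_mem_finsuppIn _ hx) hx

variable {V : Type} [AddCommGroup V] [Module F V]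

/-- The scalar part of a function with values in an exterior algebra. -/
noncomputable def scalarPart : (L →₀ ExteriorAlgebra F V) →ₗ[F] (L →₀ F) :=
  mapRange.linearMap (ExteriorAlgebra.algebraMapInv (R := F) (M := V)).toLinearMap

/-- Functions with scalar values in an exterior algebra. -/
noncomputable def ofScalar : (L →₀ F) →ₗ[F] (L →₀ ExteriorAlgebra F V) :=
  mapRange.linearMap (Algebra.linearMap F (ExteriorAlgebra F V))

lemma ofScalar_mem (x : L →₀ F) : (ofScalar x : L →₀ ExteriorAlgebra F V) ∈
    finsuppIn L (⋀[F]^0 V) := fun _ => algebraMap_mem_zero _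

lemma scalarPart_ofScalar (x : L →₀ F) :
    scalarPart (ofScalar x : L →₀ ExteriorAlgebra F V) = x := by
  ext l
  exact ExteriorAlgebra.algebraMap_leftInverse V (x l)

lemma ofScalar_scalarPart {x : L →₀ ExteriorAlgebra F V} (hx : x ∈ finsuppIn L (⋀[F]^0 V)) :
    ofScalar (scalarPart x) = x := by
  ext l
  have h := hx l
  rw [exteriorPower_zero, Submodule.mem_one] at h
  obtain ⟨r, hr⟩ := h
  change algebraMap F _ (ExteriorAlgebra.algebraMapInv (x l)) = x l
  rw [← hr, ExteriorAlgebra.algebraMap_leftInverse]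

variable {T : Type} [Fintype T] [AddCommGroup L] [AddCommGroup K] (b : Module.Basis T F V)
  (ℓ : T → L)

/-- The Koszul operators on functions with values in an exterior algebra. -/
noncomputable def extOps (hℓ : LinearIndependent ℤ ℓ) :
    KoszulOps F T (L →₀ ExteriorAlgebra F V) where
  D t := transD F _ (ℓ t)
  ι t := mapRange.linearMap (contr (b.coord t))
  e t := mapRange.linearMap (LinearMap.mulLeft F (ExteriorAlgebra.ι F (b t)))
  P i := finsuppIn L (⋀[F]^i V)
  D_comm _ _ _ := transD_comm _ _ _
  ι_D _ _ _ := mapRange_transD _ _ _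
  e_D _ _ _ := mapRange_transD _ _ _
  ι_ι s t x := by
    ext l
    exact contr_comm _ _ _
  ι_self s x := by
    ext l
    exact contr_contr _ _
  ι_e_self s x := by
    ext l
    rw [Finsupp.sub_apply]
    change contr (b.coord s) (ExteriorAlgebra.ι F (b s) * x l) =
      x l - ExteriorAlgebra.ι F (b s) * contr (b.coord s) (x l)
    rw [contr_ι_mul]
    simp
  ι_e s t x h := by
    ext l
    rw [Finsupp.neg_apply]
    change contr (b.coord t) (ExteriorAlgebra.ι F (b s) * x l) =
      - (ExteriorAlgebra.ι F (b s) * contr (b.coord t) (x l))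
    rw [contr_ι_mul]
    simp [h]
  D_mem _ _ _ hx := transD_mem_finsuppIn _ hx
  ι_mem _ _ _ hx := mapRange_mem_finsuppIn _ (fun _ h => contr_mem _ h) hx
  ι_zero t x hx := by
    ext l
    exact contr_eq_zero _ (hx l)
  e_mem _ _ _ hx := mapRange_mem_finsuppIn _ (fun _ h => ι_mul_mem _ h) hx
  eq_zero i x hx h := by
    ext l
    exact eq_zero_of_contr b (hx l) fun t => DFunLike.congr_fun (h t) l
  regular R s hs c hc a ha h := by
    have h' := congrArg scalarPart h
    rw [map_sum] at h'
    simp only [scalarPart, mapRange_transD] at h'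
    obtain ⟨a', ha'⟩ := transD_regular hℓ hs h'
    refine ⟨fun t => ofScalar (a' t), fun t => ofScalar_mem _, ?_⟩
    rw [← ofScalar_scalarPart hc, scalarPart, ha', map_sum]
    simp only [ofScalar, mapRange_transD]

lemma extOps_d_apply (hℓ : LinearIndependent ℤ ℓ) (x : L →₀ ExteriorAlgebra F V) :
    (extOps b ℓ hℓ).d x =
      ∑ t, transD F _ (ℓ t) (mapRange.linearMap (contr (b.coord t)) x) :=
  KoszulOps.d_apply _ _

lemma mapDomain_scalarPart_d (hℓ : LinearIndependent ℤ ℓ) (f : L →+ K) (hf : ∀ t, f (ℓ t) = 0)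
    (x : L →₀ ExteriorAlgebra F V) :
    lmapDomain F F f (scalarPart ((extOps b ℓ hℓ).d x)) = 0 := by
  rw [extOps_d_apply, map_sum, map_sum]
  refine Finset.sum_eq_zero fun t _ => ?_
  rw [scalarPart, mapRange_transD, mapDomain_transD_of_mem_ker _ (hf t)]

lemma exists_d_eq_of_mapDomain (hℓ : LinearIndependent ℤ ℓ) (f : L →+ K)
    (hf : f.ker ≤ AddSubgroup.closure (Set.range ℓ)) {x : L →₀ ExteriorAlgebra F V}
    (hx : x ∈ finsuppIn L (⋀[F]^0 V)) (h : lmapDomain F F f (scalarPart x) = 0) :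
    ∃ w ∈ finsuppIn L (⋀[F]^1 V), (extOps b ℓ hℓ).d w = x := by
  classical
  obtain ⟨a, ha⟩ := exists_eq_sum_transD ℓ Finset.univ f (by simpa using hf) h
  refine ⟨∑ t, (extOps b ℓ hℓ).e t (ofScalar (a t)), Submodule.sum_mem _ fun t _ =>
    (extOps b ℓ hℓ).e_mem t 0 _ (ofScalar_mem _), ?_⟩
  rw [KoszulOps.d_sum_e _ _ fun t => ofScalar_mem _, ← ofScalar_scalarPart hx, ha, map_sum]
  exact Finset.sum_congr rfl fun t _ => (mapRange_transD _ _ _).symm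

end ExteriorKoszul

end EMSpace

namespace EMSpace

section KoszulNaturality

open Finsupp

variable {F : Type} [Field F] {L L' T T' V V' : Type} [AddCommGroup V] [AddCommGroup V']
  [Module F V] [Module F V']

/-- The map induced on functions with values in exterior algebras. -/
noncomputable def extMap (h : L' → L) (g : V' →ₗ[F] V) :
    (L' →₀ ExteriorAlgebra F V') →ₗ[F] (L →₀ ExteriorAlgebra F V) :=
  mapRange.linearMap (ExteriorAlgebra.map g).toLinearMap ∘ₗ lmapDomain _ F h

lemma extMap_single (h : L' → L) (g : V' →ₗ[F] V) (m : L') (w : ExteriorAlgebra F V') :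
    extMap h g (single m w) = single (h m) (ExteriorAlgebra.map g w) := by
  simp [extMap]

lemma extMap_mem (h : L' → L) (g : V' →ₗ[F] V) {i : ℕ} {x : L' →₀ ExteriorAlgebra F V'}
    (hx : x ∈ finsuppIn L' (⋀[F]^i V')) : extMap h g x ∈ finsuppIn L (⋀[F]^i V) :=
  mapRange_mem_finsuppIn _ (fun _ hw => map_mem g hw) (mapDomain_mem_finsuppIn h hx)

lemma scalarPart_extMap (h : L' → L) (g : V' →ₗ[F] V) (x : L' →₀ ExteriorAlgebra F V') :
    scalarPart (extMap h g x) = lmapDomain F F h (scalarPart x) := by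
  suffices H : scalarPart ∘ₗ extMap h g = lmapDomain F F h ∘ₗ scalarPart from
    LinearMap.congr_fun H x
  refine lhom_ext fun m w => ?_
  have : ExteriorAlgebra.algebraMapInv (ExteriorAlgebra.map g w) =
      (ExteriorAlgebra.algebraMapInv w : F) := by
    rw [← AlgHom.comp_apply]
    congr 1
    ext v
    simp [ExteriorAlgebra.algebraMapInv]
  simp [extMap_single, scalarPart, this]

lemma coord_comp_eq [Fintype T'] (b : Module.Basis T F V) (b' : Module.Basis T' F V') (g : V' →ₗ[F] V)
    (r : T' → Option T) (hg : ∀ t, g (b' t) = (r t).elim 0 b) [DecidableEq T] (t : T) :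
    b.coord t ∘ₗ g = ∑ t', if r t' = some t then b'.coord t' else 0 := by
  classical
  refine b'.ext fun s => ?_
  rw [LinearMap.comp_apply, hg, LinearMap.sum_apply, Finset.sum_eq_single s]
  · cases h : r s with
    | none => simp
    | some u =>
      by_cases hu : u = t
      · simp [hu]
      · simp [hu]
  · intro t' _ ht'
    split_ifs
    · simp [ht'.symm]
    · simp
  · simp

lemma extOps_d_extMap [Fintype T] [Fintype T'] [AddCommGroup L] [AddCommGroup L'] (b : Module.Basis T F V) (b' : Module.Basis T' F V') {ℓ : T → L}
    {ℓ' : T' → L'} (hℓ : LinearIndependent ℤ ℓ) (hℓ' : LinearIndependent ℤ ℓ') (h : L' →+ L)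
    (g : V' →ₗ[F] V) (r : T' → Option T) (hh : ∀ t, h (ℓ' t) = (r t).elim 0 ℓ)
    (hg : ∀ t, g (b' t) = (r t).elim 0 b) (x : L' →₀ ExteriorAlgebra F V') :
    (extOps b ℓ hℓ).d (extMap h g x) = extMap h g ((extOps b' ℓ' hℓ').d x) := by
  classical
  suffices H : (extOps b ℓ hℓ).d ∘ₗ extMap h g = extMap h g ∘ₗ (extOps b' ℓ' hℓ').d from
    LinearMap.congr_fun H x
  refine lhom_ext fun m w => ?_
  simp only [LinearMap.comp_apply, extOps_d_apply, extMap_single, map_sum,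
    mapRange.linearMap_apply, mapRange_single, contr_map, transD_single, map_sub]
  have h1 (t : T) : ExteriorAlgebra.map g (contr (b.coord t ∘ₗ g) w) =
      ∑ t', if r t' = some t then ExteriorAlgebra.map g (contr (b'.coord t') w) else 0 := by
    rw [coord_comp_eq b b' g r hg, contr_sum, LinearMap.sum_apply, map_sum]
    refine Finset.sum_congr rfl fun t' _ => ?_
    split_ifs
    · rfl
    · rw [contr_zero, LinearMap.zero_apply, map_zero]
  simp only [h1, map_add, hh, ← lsingle_apply (R := F), map_sum, ← Finset.sum_sub_distrib]
  rw [Finset.sum_comm]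
  refine Finset.sum_congr rfl fun t' _ => ?_
  cases hr : r t' with
  | none => simp
  | some u =>
    rw [Finset.sum_eq_single u]
    · simp
    · intro t _ ht
      rw [if_neg (by simpa using ht.symm)]
      simp
    · simp

end KoszulNaturality

end EMSpace

namespace EMSpace

section CocycleResolution

open Opposite Finsupp
open scoped Simplicial

variable {F : Type} [Field F]

lemma extMap_id {L V : Type} [AddCommGroup V] [Module F V] :
    extMap (F := F) (id : L → L) (LinearMap.id : V →ₗ[F] V) = LinearMap.id :=
  lhom_ext fun m w => by simp [extMap_single]

lemma extMap_comp {L L' L'' V V' V'' : Type} [AddCommGroup V] [Module F V] [AddCommGroup V']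
    [Module F V'] [AddCommGroup V''] [Module F V''] (h : L' → L) (h' : L'' → L')
    (g : V' →ₗ[F] V) (g' : V'' →ₗ[F] V') :
    extMap (h ∘ h') (g ∘ₗ g') = extMap h g ∘ₗ extMap h' g' :=
  lhom_ext fun m w => by
    rw [LinearMap.comp_apply, extMap_single, extMap_single, extMap_single,
      ← ExteriorAlgebra.map_comp_map]
    rfl

/-- The basic cochain of a map to `⦋d⦌`. -/
noncomputable def cochIndic (k : Type) [CommRing k] {d : ℕ} {a : SimplexCategory} (t : a ⟶ ⦋d⦌) :
    Cochain k d a := ⟨indic k t, (indic_mem_cocycle t).1⟩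

lemma linearIndependent_cochIndic (k : Type) [CommRing k] (d : ℕ) (a : SimplexCategory) :
    LinearIndependent k fun t : Surj d a => cochIndic k t.1 :=
  LinearIndependent.of_comp (Cochain k d a).subtype linearIndependent_indic

open Classical in
/-- The restriction of surjections, where it is defined. -/
noncomputable def surjPull {d : ℕ} {a b : SimplexCategory} (θ : a ⟶ b) (t : Surj d b) :
    Option (Surj d a) :=
  if h : Function.Surjective (θ ≫ t.1).toOrderHom then some ⟨θ ≫ t.1, h⟩ else none

lemma cochainPull_cochIndic (k : Type) [CommRing k] {d : ℕ} {a b : SimplexCategory} (θ : a ⟶ b)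
    (t : Surj d b) : cochainPull k d θ (cochIndic k t.1) =
      (surjPull θ t).elim 0 fun t => cochIndic k t.1 := by
  refine Subtype.ext ((pull_indic θ t.1).trans ?_)
  rw [surjPull]
  split_ifs with h
  · rfl
  · exact indic_eq_zero h

lemma cocyclePull_cocycleBasis (k : Type) [CommRing k] {d : ℕ} {a b : SimplexCategory} (θ : a ⟶ b)
    (t : Surj d b) : cocyclePull k d θ (cocycleBasis k d b t) =
      (surjPull θ t).elim 0 (cocycleBasis k d a) := by
  refine Subtype.ext (((congrArg (pull d θ) (cocycleBasis_apply (k := k) t)).trans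
    (pull_indic θ t.1)).trans ?_)
  rw [surjPull]
  split_ifs with h
  · exact (cocycleBasis_apply (k := k) (⟨θ ≫ t.1, h⟩ : Surj d a)).symm
  · exact indic_eq_zero h

noncomputable instance (d : ℕ) (a : SimplexCategory) : Fintype (Surj d a) := Fintype.ofFinite _

variable (F) in
/-- The Koszul operators of the resolution of a cocycle simplicial set. -/
noncomputable def cocOps (d : ℕ) (a : SimplexCategory) :
    KoszulOps F (Surj d a) (Cochain ℤ d a →₀ ExteriorAlgebra F (Cocycle F d a)) :=
  extOps (cocycleBasis F d a) (fun t => cochIndic ℤ t.1) (linearIndependent_cochIndic ℤ d a)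

lemma cocOps_d_mem {d i : ℕ} {a : SimplexCategory}
    {x : Cochain ℤ d a →₀ ExteriorAlgebra F (Cocycle F d a)}
    (hx : x ∈ finsuppIn (Cochain ℤ d a) (⋀[F]^(i + 1) (Cocycle F d a))) :
    (cocOps F d a).d x ∈ finsuppIn (Cochain ℤ d a) (⋀[F]^i (Cocycle F d a)) :=
  (cocOps F d a).d_mem hx

variable (F) in
/-- The terms of the resolution of a cocycle simplicial set. -/
noncomputable def extP (d i : ℕ) : SMod F :=
  sMk (fun a => finsuppIn (Cochain ℤ d a) (⋀[F]^i (Cocycle F d a)))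
    (fun θ => (extMap (cochainPull ℤ d θ) (cocyclePull F d θ)).restrict
      fun _ hx => extMap_mem _ _ hx)
    (fun a => LinearMap.ext fun x => Subtype.ext (by
      change extMap (cochainPull ℤ d (𝟙 a)) (cocyclePull F d (𝟙 a)) x.1 = x.1
      rw [cochainPull_id, cocyclePull_id]
      exact LinearMap.congr_fun (extMap_id (F := F)) x.1))
    (fun θ η => LinearMap.ext fun x => Subtype.ext (by
      change extMap (cochainPull ℤ d (θ ≫ η)) (cocyclePull F d (θ ≫ η)) x.1 = _
      rw [cochainPull_comp, cocyclePull_comp]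
      exact LinearMap.congr_fun (extMap_comp (cochainPull ℤ d θ) (cochainPull ℤ d η)
        (cocyclePull F d θ) (cocyclePull F d η)) x.1))

variable (F) in
/-- The exterior powers of the simplicial module of cocycles. -/
noncomputable def extQ (d i : ℕ) : SMod F :=
  sMk (fun a => ⋀[F]^i (Cocycle F d a))
    (fun θ => (ExteriorAlgebra.map (cocyclePull F d θ)).toLinearMap.restrict
      fun _ hx => map_mem _ hx)
    (fun a => LinearMap.ext fun x => Subtype.ext (by
      change ExteriorAlgebra.map (cocyclePull F d (𝟙 a)) x.1 = x.1
      rw [cocyclePull_id, ExteriorAlgebra.map_id]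
      rfl))
    (fun θ η => LinearMap.ext fun x => Subtype.ext (by
      change ExteriorAlgebra.map (cocyclePull F d (θ ≫ η)) x.1 = _
      rw [cocyclePull_comp, ← ExteriorAlgebra.map_comp_map]
      rfl))

variable (F) in
/-- The differential of the resolution. -/
noncomputable def extD (d i : ℕ) : extP F d (i + 1) ⟶ extP F d i where
  app a := ModuleCat.ofHom ((cocOps F d a.unop).d.restrict fun _ hx => cocOps_d_mem hx)
  naturality _ _ θ := ModuleCat.hom_ext (LinearMap.ext fun x => Subtype.ext
    (extOps_d_extMap _ _ _ _ (cochainPull ℤ d θ.unop).toAddMonoidHom (cocyclePull F d θ.unop)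
      (surjPull θ.unop) (cochainPull_cochIndic ℤ θ.unop) (cocyclePull_cocycleBasis F θ.unop) x.1))

/-- The augmentation of finitely supported functions. -/
noncomputable def sumMap (L W : Type) [AddCommGroup W] [Module F W] : (L →₀ W) →ₗ[F] W :=
  Finsupp.lsum F fun _ => LinearMap.id

lemma sumMap_single {L W : Type} [AddCommGroup W] [Module F W] (l : L) (w : W) :
    sumMap (F := F) L W (single l w) = w := by simp [sumMap]

lemma sumMap_mem {L W : Type} [AddCommGroup W] [Module F W] {U : Submodule F W} {x : L →₀ W}
    (hx : x ∈ finsuppIn L U) : sumMap (F := F) L W x ∈ U := by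
  rw [sumMap, lsum_apply]
  exact Submodule.sum_mem _ fun l _ => hx l

lemma single_mem_finsuppIn {L W : Type} [AddCommGroup W] [Module F W] {U : Submodule F W} (l : L)
    {w : W} (hw : w ∈ U) : single l w ∈ finsuppIn L U := by
  classical
  intro m
  rw [single_apply]
  split_ifs
  · exact hw
  · exact U.zero_mem

variable (F) in
/-- The equivalence of the terms of the resolution with exterior powers. -/
noncomputable def extEps (d i : ℕ) : extP F d i ⟶ extQ F d i where
  app a := ModuleCat.ofHom ((sumMap (Cochain ℤ d a.unop) _).restrict fun _ hx => sumMap_mem hx)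
  naturality _ _ θ := ModuleCat.hom_ext (LinearMap.ext fun x => Subtype.ext (by
    refine LinearMap.congr_fun (?_ : sumMap _ _ ∘ₗ
      extMap (cochainPull ℤ d θ.unop) (cocyclePull F d θ.unop) =
      (ExteriorAlgebra.map (cocyclePull F d θ.unop)).toLinearMap ∘ₗ sumMap _ _) x.1
    refine lhom_ext fun m w => ?_
    simp only [LinearMap.comp_apply, extMap_single, sumMap_single]
    rfl))

variable (F) in
/-- The section of `extEps`. -/
noncomputable def extSec (d i : ℕ) : extQ F d i ⟶ extP F d i where
  app a := ModuleCat.ofHom ((lsingle (0 : Cochain ℤ d a.unop)).restrict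
    fun _ hx => single_mem_finsuppIn _ hx)
  naturality _ _ θ := ModuleCat.hom_ext (LinearMap.ext fun x => Subtype.ext (by
    refine Eq.trans ?_ (extMap_single (cochainPull ℤ d θ.unop) (cocyclePull F d θ.unop) 0 x.1).symm
    rw [map_zero]
    rfl))

lemma isHIso_extEps (d i : ℕ) : IsHIso (extEps F d i) := by
  refine HFamily.isHIso
    { H := fun {a} φ => ModuleCat.ofHom ((lmapDomain _ F (trunc ℤ d φ)).restrict
        fun _ hx => mapDomain_mem_finsuppIn (U := ⋀[F]^i (Cocycle F d a)) _ hx)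
      nat := fun {a b} θ φ => ModuleCat.hom_ext (LinearMap.ext fun x => Subtype.ext (?_)) }
    (extEps F d i) (extSec F d i) ?_ (fun a => ?_) fun a => ?_
  · refine LinearMap.congr_fun (?_ : extMap (cochainPull ℤ d θ) (cocyclePull F d θ) ∘ₗ
      lmapDomain _ F (trunc ℤ d φ) = lmapDomain _ F (trunc ℤ d (θ ≫ φ)) ∘ₗ
        extMap (cochainPull ℤ d θ) (cocyclePull F d θ)) x.1
    refine lhom_ext fun m w => ?_
    simp only [LinearMap.comp_apply, extMap_single, lmapDomain_apply, mapDomain_single]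
    rw [show cochainPull ℤ d θ (trunc ℤ d φ m) = _ from LinearMap.congr_fun (trunc_pull θ φ) m]
    rfl
  · exact NatTrans.ext (funext fun a => ModuleCat.hom_ext (LinearMap.ext fun x =>
      Subtype.ext (sumMap_single _ _)))
  · refine ModuleCat.hom_ext (LinearMap.ext fun x => Subtype.ext ?_)
    change mapDomain (trunc ℤ d (SimplexCategory.const a ⦋1⦌ 1)) x.1 = x.1
    rw [trunc_one]
    exact mapDomain_id
  · refine ModuleCat.hom_ext (LinearMap.ext fun x => Subtype.ext ?_)
    refine LinearMap.congr_fun (?_ : lmapDomain _ F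
      (trunc ℤ d (SimplexCategory.const a ⦋1⦌ 0)) = lsingle 0 ∘ₗ
        sumMap (Cochain ℤ d a) (ExteriorAlgebra F (Cocycle F d a))) x.1
    refine lhom_ext fun m w => ?_
    rw [trunc_zero, LinearMap.comp_apply, sumMap_single]
    simp

variable (F) in
/-- The augmentation of the resolution. -/
noncomputable def extPi (d : ℕ) : extP F d 0 ⟶ (freeS F).obj (cocycleSet ℤ (d + 1)) where
  app a := ModuleCat.ofHom
    ((lmapDomain F F (coboundaryHom ℤ d a.unop) ∘ₗ scalarPart).domRestrict _)
  naturality _ _ θ := ModuleCat.hom_ext (LinearMap.ext fun x => by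
    change lmapDomain F F (coboundaryHom ℤ d _) (scalarPart (extMap _ _ x.1)) =
      lmapDomain F F (cocyclePull ℤ (d + 1) θ.unop) (lmapDomain F F (coboundaryHom ℤ d _)
        (scalarPart x.1))
    rw [scalarPart_extMap]
    refine LinearMap.congr_fun (?_ : lmapDomain F F (coboundaryHom ℤ d _) ∘ₗ
      lmapDomain F F (cochainPull ℤ d θ.unop) = lmapDomain F F (cocyclePull ℤ (d + 1) θ.unop) ∘ₗ
        lmapDomain F F (coboundaryHom ℤ d _)) (scalarPart x.1)
    rw [← lmapDomain_comp, ← lmapDomain_comp]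
    rfl)

lemma ker_coboundaryHom_le (d : ℕ) (a : SimplexCategory) :
    (coboundaryHom ℤ d a).toAddMonoidHom.ker ≤
      AddSubgroup.closure (Set.range fun t : Surj d a => cochIndic ℤ t.1) := by
  intro c hc
  have h := mem_span_indic (k := ℤ) (z := c.1) ⟨c.2, congrArg Subtype.val hc⟩
  rw [show (Set.range fun t : Surj d a => indic ℤ t.1) = (Cochain ℤ d a).subtype ''
    Set.range fun t : Surj d a => cochIndic ℤ t.1 by rw [← Set.range_comp]; rfl,
    ← Submodule.map_span] at h
  obtain ⟨c', h1, h2⟩ := h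
  rw [← Subtype.ext h2, ← Submodule.span_int_eq_addSubgroupClosure]
  exact h1

variable (F) in
/-- The resolution of a cocycle simplicial set by exterior powers. -/
noncomputable def cocycleResolution (d : ℕ) :
    Resolution ((freeS F).obj (cocycleSet ℤ (d + 1))) (extP F d) (extQ F d) where
  d := extD F d
  π := extPi F d
  ε := extEps F d
  surj a := by
    intro y
    obtain ⟨x, hx⟩ := mapDomain_surjective (M := F)
      (coboundaryHom_surjective (k := ℤ) (d := d) (a := a.unop)) y
    refine ⟨⟨ofScalar x, ofScalar_mem x⟩, ?_⟩
    change lmapDomain F F (coboundaryHom ℤ d _) (scalarPart (ofScalar x)) = y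
    rw [scalarPart_ofScalar]
    exact hx
  exact_zero a x := by
    constructor
    · intro h
      obtain ⟨w, hw, e⟩ := exists_d_eq_of_mapDomain (cocycleBasis F d a.unop)
        (fun t => cochIndic ℤ t.1) (linearIndependent_cochIndic ℤ d a.unop)
        (coboundaryHom ℤ d a.unop).toAddMonoidHom (ker_coboundaryHom_le d a.unop) x.2 h
      exact ⟨⟨w, hw⟩, Subtype.ext e⟩
    · rintro ⟨w, rfl⟩
      exact mapDomain_scalarPart_d (cocycleBasis F d a.unop)
        (fun t => cochIndic ℤ t.1) (linearIndependent_cochIndic ℤ d a.unop)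
        (coboundaryHom ℤ d a.unop).toAddMonoidHom
        (fun t => Subtype.ext (indic_mem_cocycle t.1).2) w.1
  exact_succ i a x := by
    constructor
    · intro h
      obtain ⟨w, hw, e⟩ := KoszulOps.exists_d_eq (cocOps F d a.unop) x.2 (congrArg Subtype.val h)
      exact ⟨⟨w, hw⟩, Subtype.ext e⟩
    · rintro ⟨w, rfl⟩
      exact Subtype.ext (KoszulOps.d_d (cocOps F d a.unop) w.1)
  hIso i := isHIso_extEps d i
  comp_zero i := by
    refine NatTrans.ext (funext fun a => ModuleCat.hom_ext (LinearMap.ext fun x =>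
      Subtype.ext ?_))
    change sumMap _ _ ((cocOps F d a.unop).d x.1) = 0
    rw [cocOps, extOps_d_apply, map_sum]
    refine Finset.sum_eq_zero fun t _ => ?_
    refine LinearMap.congr_fun (?_ : sumMap _ _ ∘ₗ transD F _ (cochIndic ℤ t.1) = 0)
      (mapRange.linearMap (contr ((cocycleBasis F d a.unop).coord t)) x.1)
    refine lhom_ext fun m w => ?_
    rw [LinearMap.comp_apply, transD_single, map_sub, sumMap_single, sumMap_single, sub_self]
    rfl

end CocycleResolution

end EMSpace

namespace EMSpace

section DividedKoszul

open MvPolynomial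

variable {F : Type} [Field F] {T : Type}

/-- Division of polynomials by a variable, discarding the remainder. -/
noncomputable def divX (s : T) : MvPolynomial T F →ₗ[F] MvPolynomial T F where
  toFun f := f.divMonomial (Finsupp.single s 1)
  map_add' f g := add_divMonomial f g _
  map_smul' r f := by
    ext m
    simp [coeff_divMonomial]

lemma coeff_divX (s : T) (f : MvPolynomial T F) (m : T →₀ ℕ) :
    coeff m (divX s f) = coeff (Finsupp.single s 1 + m) f := coeff_divMonomial _ _ _

lemma divX_X_mul (s : T) (f : MvPolynomial T F) : divX s (X s * f) = f :=
  X_mul_divMonomial s f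

lemma divX_X_mul_of_ne {s t : T} (h : t ≠ s) (f : MvPolynomial T F) :
    divX s (X t * f) = X t * divX s f := by
  classical
  ext m
  rw [coeff_divX, coeff_X_mul', coeff_X_mul', coeff_divX]
  have h1 : t ∈ (Finsupp.single s 1 + m).support ↔ t ∈ m.support := by
    simp [h]
  simp only [h1]
  split_ifs with h2
  · congr 1
    rw [add_tsub_assoc_of_le]
    simpa [Nat.one_le_iff_ne_zero] using h2
  · rfl

lemma isHomogeneous_divX {s : T} {j : ℕ} {f : MvPolynomial T F} (hf : f.IsHomogeneous (j + 1)) :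
    (divX s f).IsHomogeneous j := by
  intro m hm
  rw [coeff_divX] at hm
  have := hf hm
  rw [map_add, Finsupp.weight_single] at this
  simp only [Pi.one_apply, smul_eq_mul, mul_one] at this
  omega

lemma divX_eq_zero {s : T} {f : MvPolynomial T F} (hf : f.IsHomogeneous 0) : divX s f = 0 := by
  ext m
  rw [coeff_divX, hf.coeff_eq_zero, coeff_zero]
  simp

/-- Linear maps on polynomials supported in a given degree. -/
def polyIn (T : Type) {W : Type} [AddCommGroup W] [Module F W] (i : ℕ) :
    Submodule F (MvPolynomial T F →ₗ[F] W) where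
  carrier := {u | ∀ j ≠ i, ∀ f : MvPolynomial T F, f.IsHomogeneous j → u f = 0}
  zero_mem' _ _ _ _ := rfl
  add_mem' hu hv j hj f hf := by rw [LinearMap.add_apply, hu j hj f hf, hv j hj f hf, add_zero]
  smul_mem' r u hu j hj f hf := by rw [LinearMap.smul_apply, hu j hj f hf, smul_zero]

lemma polyIn_ext {W : Type} [AddCommGroup W] [Module F W] {i : ℕ}
    {u v : MvPolynomial T F →ₗ[F] W} (hu : u ∈ polyIn T i) (hv : v ∈ polyIn T i)
    (h : ∀ m : T →₀ ℕ, m.degree = i → u (monomial m 1) = v (monomial m 1)) : u = v := by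
  refine linearMap_ext fun m => LinearMap.ext_ring ?_
  change u (monomial m 1) = v (monomial m 1)
  by_cases hm : m.degree = i
  · exact h m hm
  · rw [hu _ hm _ (isHomogeneous_monomial 1 rfl), hv _ hm _ (isHomogeneous_monomial 1 rfl)]

section

variable {C W : Type} [AddCommGroup C] [Module F C] [AddCommGroup W] [Module F W]

/-- Composition with linear maps on both sides. -/
noncomputable def polyMap {T' W' : Type} [AddCommGroup W'] [Module F W'] (g : W →ₗ[F] W')
    (q : MvPolynomial T F →ₗ[F] MvPolynomial T' F) :
    (MvPolynomial T' F →ₗ[F] W) →ₗ[F] (MvPolynomial T F →ₗ[F] W') where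
  toFun u := g ∘ₗ u ∘ₗ q
  map_add' _ _ := LinearMap.ext fun _ => map_add g _ _
  map_smul' _ _ := LinearMap.ext fun _ => map_smul g _ _

lemma polyMap_mem {T' W' : Type} [AddCommGroup W'] [Module F W'] (g : W →ₗ[F] W')
    {q : MvPolynomial T F →ₗ[F] MvPolynomial T' F}
    (hq : ∀ (j : ℕ) (f : MvPolynomial T F), f.IsHomogeneous j → (q f).IsHomogeneous j) {i : ℕ}
    {u : MvPolynomial T' F →ₗ[F] W} (hu : u ∈ polyIn T' i) : polyMap g q u ∈ polyIn T i :=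
  fun j hj f hf => (congrArg g (hu j hj _ (hq j f hf))).trans (map_zero g)

variable [Fintype T]

/-- The Koszul differential on maps from polynomials to an exterior algebra. -/
noncomputable def divD (ℓ : T → C) : (MvPolynomial T F →ₗ[F] ExteriorAlgebra F C) →ₗ[F]
    (MvPolynomial T F →ₗ[F] ExteriorAlgebra F C) where
  toFun u := ∑ t, LinearMap.mulLeft F (ExteriorAlgebra.ι F (ℓ t)) ∘ₗ u ∘ₗ
    LinearMap.mulLeft F (X t)
  map_add' u v := by
    ext : 2
    simp [mul_add, Finset.sum_add_distrib]
  map_smul' r u := by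
    ext : 2
    simp [Finset.smul_sum]

lemma divD_apply (ℓ : T → C) (u : MvPolynomial T F →ₗ[F] ExteriorAlgebra F C)
    (f : MvPolynomial T F) : divD ℓ u f = ∑ t, ExteriorAlgebra.ι F (ℓ t) * u (X t * f) := by
  simp [divD]

lemma divD_mem (ℓ : T → C) {i : ℕ} {u : MvPolynomial T F →ₗ[F] ExteriorAlgebra F C}
    (hu : u ∈ polyIn T (i + 1)) : divD ℓ u ∈ polyIn T i := by
  intro j hj f hf
  rw [divD_apply]
  refine Finset.sum_eq_zero fun t _ => ?_
  rw [hu (1 + j) (by omega) _ ((isHomogeneous_X F t).mul hf), mul_zero]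

lemma ι_mul_ι_mul (v w : C) (x : ExteriorAlgebra F C) :
    ExteriorAlgebra.ι F v * (ExteriorAlgebra.ι F w * x) =
      - (ExteriorAlgebra.ι F w * (ExteriorAlgebra.ι F v * x)) := by
  rw [← mul_assoc, ← mul_assoc, ← neg_mul, eq_neg_of_add_eq_zero_left
    (ExteriorAlgebra.ι_add_mul_swap v w)]

lemma divD_divD (ℓ : T → C) (u : MvPolynomial T F →ₗ[F] ExteriorAlgebra F C) :
    divD ℓ (divD ℓ u) = 0 := by
  classical
  refine LinearMap.ext fun f => ?_
  simp only [divD_apply, Finset.mul_sum, LinearMap.zero_apply]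
  rw [← Finset.sum_product']
  refine Finset.sum_involution (fun q _ => (q.2, q.1)) (fun q _ => ?_) (fun q _ h1 h2 => h1 ?_)
    (fun _ _ => Finset.mem_univ _) fun _ _ => rfl
  · dsimp only
    rw [ι_mul_ι_mul, mul_left_comm (X q.2), neg_add_cancel]
  · have h3 : q.2 = q.1 := congrArg Prod.fst h2
    rw [h3, ← mul_assoc, ExteriorAlgebra.ι_sq_zero, zero_mul]

variable {ℓ : T → C} {φ : T → Module.Dual F C}

lemma divD_elim [DecidableEq T] (hφ : ∀ s t, φ s (ℓ t) = if s = t then 1 else 0)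
    {u : MvPolynomial T F →ₗ[F] ExteriorAlgebra F C} (hu : divD ℓ u = 0) (s : T)
    (f : MvPolynomial T F) :
    divD ℓ (contr (φ s) ∘ₗ u ∘ₗ divX s) f =
      ExteriorAlgebra.ι F (ℓ s) * contr (φ s) (u (f - X s * divX s f)) + u (X s * divX s f) := by
  have h1 (g : MvPolynomial T F) :
      u (X s * g) = ∑ t, ExteriorAlgebra.ι F (ℓ t) * contr (φ s) (u (X t * g)) := by
    have h := congrArg (contr (φ s)) (LinearMap.congr_fun hu g)
    rw [divD_apply, map_sum, LinearMap.zero_apply, map_zero] at h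
    simp only [contr_ι_mul, hφ, ite_smul, one_smul, zero_smul, Finset.sum_sub_distrib] at h
    rw [Finset.sum_ite_eq, if_pos (Finset.mem_univ s)] at h
    exact sub_eq_zero.1 h
  rw [h1, divD_apply, ← Finset.add_sum_erase _ _ (Finset.mem_univ s),
    ← Finset.add_sum_erase _ (fun t => ExteriorAlgebra.ι F (ℓ t) *
      contr (φ s) (u (X t * divX s f))) (Finset.mem_univ s)]
  have h2 : ∀ t ∈ Finset.univ.erase s, ExteriorAlgebra.ι F (ℓ t) *
      (contr (φ s) ∘ₗ u ∘ₗ divX s) (X t * f) =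
      ExteriorAlgebra.ι F (ℓ t) * contr (φ s) (u (X t * divX s f)) := fun t ht => by
    rw [LinearMap.comp_apply, LinearMap.comp_apply, divX_X_mul_of_ne (Finset.ne_of_mem_erase ht)]
  rw [Finset.sum_congr rfl h2, LinearMap.comp_apply, LinearMap.comp_apply, divX_X_mul, map_sub,
    map_sub, mul_sub]
  abel

lemma exists_divD_eq (hℓ : LinearIndependent F ℓ) {i : ℕ}
    {u : MvPolynomial T F →ₗ[F] ExteriorAlgebra F C} (hu : u ∈ polyIn T (i + 1))
    (h : divD ℓ u = 0) : ∃ w ∈ polyIn T (i + 2), divD ℓ w = u := by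
  classical
  obtain ⟨φ, hφ⟩ : ∃ φ : T → Module.Dual F C, ∀ s t, φ s (ℓ t) = if s = t then 1 else 0 := by
    obtain ⟨g, hg⟩ := LinearMap.exists_leftInverse_of_injective (Finsupp.linearCombination F ℓ)
      (LinearMap.ker_eq_bot.2 hℓ)
    refine ⟨fun s => Finsupp.lapply s ∘ₗ g, fun s t => ?_⟩
    have := LinearMap.congr_fun hg (Finsupp.single t 1)
    rw [LinearMap.comp_apply, Finsupp.linearCombination_single, one_smul] at this
    rw [LinearMap.comp_apply, this]
    simp [Finsupp.single_apply, eq_comm]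
  suffices H : ∀ (R : Finset T) (u : MvPolynomial T F →ₗ[F] ExteriorAlgebra F C),
      u ∈ polyIn T (i + 1) → divD ℓ u = 0 → (∀ t ∉ R, ∀ f, u (X t * f) = 0) →
      ∃ w ∈ polyIn T (i + 2), divD ℓ w = u from
    H Finset.univ u hu h fun t ht => absurd (Finset.mem_univ t) ht
  clear h hu u
  intro R
  induction R using Finset.induction with
  | empty =>
    intro u hu _ h
    refine ⟨0, Submodule.zero_mem _, ?_⟩
    rw [map_zero]
    refine polyIn_ext (Submodule.zero_mem _) hu fun m hm => ?_
    obtain ⟨t, ht⟩ : ∃ t, m t ≠ 0 := by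
      by_contra! h0
      rw [show m = 0 from Finsupp.ext h0] at hm
      simp at hm
    obtain ⟨f, hf⟩ := X_dvd_monomial (R := F) (r := 1).2 (Or.inr ht)
    rw [hf, h t (Finset.notMem_empty t)]
    rfl
  | insert s R hs ih =>
    intro u hu hd h
    let z := contr (φ s) ∘ₗ u ∘ₗ divX s
    have hz : z ∈ polyIn T (i + 2) := fun j hj f hf => by
      change contr (φ s) (u (divX s f)) = 0
      cases j with
      | zero => rw [divX_eq_zero hf, map_zero, map_zero]
      | succ j => rw [hu j (by omega) _ (isHomogeneous_divX hf), map_zero]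
    obtain ⟨w, hw, e⟩ := ih (u - divD ℓ z) (Submodule.sub_mem _ hu (divD_mem ℓ hz))
      (by rw [map_sub, hd, divD_divD, sub_zero]) fun t ht f => by
        rw [LinearMap.sub_apply, divD_elim hφ hd]
        by_cases hts : t = s
        · subst hts
          rw [divX_X_mul, sub_self, map_zero, map_zero, mul_zero, zero_add, sub_self]
        · have ht' : t ∉ insert s R := by simp [hts, ht]
          rw [divX_X_mul_of_ne hts, mul_left_comm, ← mul_sub, h t ht', h t ht', h t ht', map_zero,
            mul_zero, zero_add, sub_zero]
    exact ⟨w + z, Submodule.add_mem _ hw hz, by rw [map_add, e, sub_add_cancel]⟩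

lemma sub_map_mem (ℓ : T → C) (h : C →ₗ[F] C)
    (hh : ∀ c, c - h c ∈ Submodule.span F (Set.range ℓ)) (x : ExteriorAlgebra F C) :
    ∃ y : T → ExteriorAlgebra F C,
      x - ExteriorAlgebra.map h x = ∑ t, ExteriorAlgebra.ι F (ℓ t) * y t := by
  induction x using ext_induction with
  | one r => exact ⟨0, by simp⟩
  | add x x' hx hx' =>
    obtain ⟨y, hy⟩ := hx
    obtain ⟨y', hy'⟩ := hx'
    refine ⟨y + y', ?_⟩
    rw [map_add, add_sub_add_comm, hy, hy', ← Finset.sum_add_distrib]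
    simp [mul_add]
  | mul v x hx =>
    obtain ⟨y, hy⟩ := hx
    obtain ⟨a, ha⟩ := (Submodule.mem_span_range_iff_exists_fun F).1 (hh v)
    refine ⟨fun t => a t • x - ExteriorAlgebra.ι F (h v) * y t, ?_⟩
    have h1 : ExteriorAlgebra.ι F v = ExteriorAlgebra.ι F (h v) +
        ∑ t, a t • ExteriorAlgebra.ι F (ℓ t) := by
      rw [← sub_eq_iff_eq_add', ← map_sub, ← ha, map_sum]
      simp
    have h2 (t : T) : ExteriorAlgebra.ι F (ℓ t) * (a t • x - ExteriorAlgebra.ι F (h v) * y t) =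
        a t • ExteriorAlgebra.ι F (ℓ t) * x +
          ExteriorAlgebra.ι F (h v) * (ExteriorAlgebra.ι F (ℓ t) * y t) := by
      rw [mul_sub, ι_mul_ι_mul, sub_neg_eq_add, mul_smul_comm, smul_mul_assoc]
    simp only [h2, Finset.sum_add_distrib, ← Finset.mul_sum, ← Finset.sum_mul]
    rw [← hy, map_mul, ExteriorAlgebra.map_apply_ι, h1, mul_sub, add_mul]
    abel

lemma exists_divD_eq_of_map {Z : Type} [AddCommGroup Z] [Module F Z] (g : C →ₗ[F] Z)
    (hg : Function.Surjective g) (hk : LinearMap.ker g ≤ Submodule.span F (Set.range ℓ))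
    {u : MvPolynomial T F →ₗ[F] ExteriorAlgebra F C} (hu : u ∈ polyIn T 0)
    (h : ExteriorAlgebra.map g (u 1) = 0) : ∃ w ∈ polyIn T 1, divD ℓ w = u := by
  classical
  obtain ⟨σ, hσ⟩ := LinearMap.exists_rightInverse_of_surjective g (LinearMap.range_eq_top.2 hg)
  obtain ⟨y, hy⟩ := sub_map_mem ℓ (σ ∘ₗ g) (fun c => hk (by
    rw [LinearMap.mem_ker, map_sub, LinearMap.comp_apply,
      show g (σ (g c)) = g c from LinearMap.congr_fun hσ _, sub_self])) (u 1)
  rw [← ExteriorAlgebra.map_comp_map, AlgHom.comp_apply, h, map_zero, sub_zero] at hy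
  let w : MvPolynomial T F →ₗ[F] ExteriorAlgebra F C :=
    ∑ t, (lcoeff F (Finsupp.single t 1)).smulRight (y t)
  have hw (f) : w f = ∑ t, coeff (Finsupp.single t 1) f • y t := by simp [w]
  have hw1 : w ∈ polyIn T 1 := fun j hj f hf => by
    rw [hw]
    refine Finset.sum_eq_zero fun t _ => ?_
    rw [hf.coeff_eq_zero (by simpa using hj.symm), zero_smul]
  refine ⟨w, hw1, polyIn_ext (divD_mem ℓ hw1) hu fun m hm => ?_⟩
  have hm0 : m = 0 := m.degree_eq_zero_iff.1 hm
  subst hm0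
  rw [divD_apply]
  change _ = u 1
  rw [hy]
  refine Finset.sum_congr rfl fun t _ => ?_
  rw [hw, Finset.sum_eq_single t]
  · change _ * (coeff _ (X t * 1) • _) = _
    rw [mul_one, coeff_X, if_pos rfl, one_smul]
  · intro s _ hs
    change coeff _ (X t * 1) • _ = _
    rw [mul_one, coeff_X, if_neg, zero_smul]
    intro h
    exact hs (Finsupp.single_left_injective one_ne_zero h).symm
  · simp

end

end DividedKoszul

end EMSpace

namespace EMSpace

section DividedResolution

open Opposite MvPolynomial
open scoped Simplicial

variable {F : Type} [Field F]

section

variable {T T' T'' : Type} [Fintype T'] [Fintype T'']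

open Classical in
/-- The map of polynomial algebras dual to a partial map. -/
noncomputable def polyPull (F : Type) [Field F] (r : T' → Option T) :
    MvPolynomial T F →ₐ[F] MvPolynomial T' F :=
  aeval fun t => ∑ t', if r t' = some t then X t' else 0

open Classical in
lemma polyPull_X (r : T' → Option T) (t : T) :
    polyPull F r (X t) = ∑ t', if r t' = some t then X t' else 0 := aeval_X _ _

lemma polyPull_some [Fintype T] : polyPull F (some : T → Option T) = AlgHom.id F _ := by
  classical
  refine algHom_ext fun t => ?_
  simp [polyPull_X]

lemma polyPull_bind (r : T' → Option T) (r' : T'' → Option T') :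
    polyPull F (fun t => (r' t).bind r) = (polyPull F r').comp (polyPull F r) := by
  classical
  refine algHom_ext fun t => ?_
  rw [AlgHom.comp_apply, polyPull_X, polyPull_X, map_sum]
  have h (t' : T') : polyPull F r' (if r t' = some t then X t' else 0) =
      ∑ s, if r t' = some t ∧ r' s = some t' then (X s : MvPolynomial T'' F) else 0 := by
    split_ifs with h
    · simp [polyPull_X, h]
    · simp [h]
  simp only [h]
  rw [Finset.sum_comm]
  refine Finset.sum_congr rfl fun s _ => ?_
  cases hs : r' s with
  | none => simp
  | some t' =>
    rw [Finset.sum_eq_single t']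
    · simp
    · intro u _ hu
      rw [if_neg fun h => hu (by simpa using h.2.symm)]
    · simp

lemma isHomogeneous_polyPull (r : T' → Option T) (j : ℕ) (f : MvPolynomial T F)
    (hf : f.IsHomogeneous j) : (polyPull F r f).IsHomogeneous j := by
  classical
  have := hf.aeval (fun t => ∑ t', if r t' = some t then (X t' : MvPolynomial T' F) else 0)
    (n := 1) fun t => IsHomogeneous.sum _ _ _ fun t' _ => by
      split_ifs
      · exact isHomogeneous_X F t'
      · exact isHomogeneous_zero _ _ _
  rwa [one_mul] at this

lemma divD_polyMap [Fintype T] {C C' : Type} [AddCommGroup C] [Module F C] [AddCommGroup C'] [Module F C']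
    (ℓ : T → C) (ℓ' : T' → C') (r : T' → Option T) (g : C' →ₗ[F] C)
    (hg : ∀ t, g (ℓ' t) = (r t).elim 0 ℓ) (u : MvPolynomial T' F →ₗ[F] ExteriorAlgebra F C') :
    divD ℓ (polyMap (ExteriorAlgebra.map g).toLinearMap (polyPull F r).toLinearMap u) =
      polyMap (ExteriorAlgebra.map g).toLinearMap (polyPull F r).toLinearMap (divD ℓ' u) := by
  classical
  refine LinearMap.ext fun f => ?_
  change _ = ExteriorAlgebra.map g (divD ℓ' u (polyPull F r f))
  rw [divD_apply, divD_apply, map_sum]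
  have h1 (t : T) : polyMap (ExteriorAlgebra.map g).toLinearMap (polyPull F r).toLinearMap u
      (X t * f) = ∑ t', if r t' = some t then
        ExteriorAlgebra.map g (u (X t' * polyPull F r f)) else 0 := by
    change ExteriorAlgebra.map g (u (polyPull F r (X t * f))) = _
    rw [map_mul, polyPull_X, Finset.sum_mul, map_sum, map_sum]
    refine Finset.sum_congr rfl fun t' _ => ?_
    split_ifs <;> simp
  simp only [h1, Finset.mul_sum]
  rw [Finset.sum_comm]
  refine Finset.sum_congr rfl fun t' _ => ?_
  rw [map_mul (ExteriorAlgebra.map g), ExteriorAlgebra.map_apply_ι, hg]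
  cases hr : r t' with
  | none => simp
  | some s =>
    rw [Finset.sum_eq_single s]
    · simp
    · intro t _ ht
      rw [if_neg (by simpa using ht.symm), mul_zero]
    · simp

end

lemma surjPull_id {d : ℕ} (a : SimplexCategory) : surjPull (d := d) (𝟙 a) = some := by
  funext t
  have h : 𝟙 a ≫ t.1 = t.1 := Category.id_comp _
  rw [surjPull, dif_pos (by rw [h]; exact t.2)]
  exact congrArg some (Subtype.ext h)

lemma surjPull_comp {d : ℕ} {a b c : SimplexCategory} (θ : a ⟶ b) (η : b ⟶ c) (t : Surj d c) :
    surjPull (θ ≫ η) t = (surjPull η t).bind (surjPull θ) := by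
  by_cases h : Function.Surjective (η ≫ t.1).toOrderHom
  · rw [surjPull.eq_def η, dif_pos h, Option.bind_some]
    simp only [surjPull, Category.assoc]
  · rw [surjPull.eq_def η, dif_neg h, Option.bind_none, surjPull, dif_neg]
    intro h'
    refine h fun j => ?_
    obtain ⟨x, hx⟩ := h' j
    exact ⟨θ.toOrderHom x, hx⟩

/-- The simplicial module of maps from polynomials to a contravariant family of modules. -/
noncomputable def polyS (F : Type) [Field F] (d i : ℕ) (W : SimplexCategory → Type)
    [∀ a, AddCommGroup (W a)] [∀ a, Module F (W a)]
    (m : ∀ {a b : SimplexCategory}, (a ⟶ b) → W b →ₗ[F] W a) (hid : ∀ a, m (𝟙 a) = LinearMap.id)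
    (hcomp : ∀ {a b c : SimplexCategory} (θ : a ⟶ b) (η : b ⟶ c), m (θ ≫ η) = m θ ∘ₗ m η) :
    SMod F :=
  sMk (fun a => polyIn (F := F) (Surj d a) (W := W a) i)
    (fun θ => (polyMap (m θ) (polyPull F (surjPull θ)).toLinearMap).restrict
      fun _ hx => polyMap_mem _ (isHomogeneous_polyPull _) hx)
    (fun a => LinearMap.ext fun x => Subtype.ext (LinearMap.ext fun f => by
      change m (𝟙 a) (x.1 (polyPull F (surjPull (𝟙 a)) f)) = x.1 f
      rw [hid, surjPull_id, polyPull_some]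
      rfl))
    (fun θ η => LinearMap.ext fun x => Subtype.ext (LinearMap.ext fun f => by
      change m (θ ≫ η) (x.1 (polyPull F (surjPull (θ ≫ η)) f)) =
        m θ (m η (x.1 (polyPull F (surjPull η) (polyPull F (surjPull θ) f))))
      rw [hcomp, show surjPull (θ ≫ η) = _ from funext (surjPull_comp θ η), polyPull_bind]
      rfl))

variable (F) in
/-- The simplicial module of divided powers. -/
noncomputable def gammaS (d i : ℕ) : SMod F :=
  polyS F d i (fun _ => F) (fun _ => LinearMap.id) (fun _ => rfl) (fun _ _ => rfl)

variable (F) in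
/-- The terms of the resolution of the exterior algebra. -/
noncomputable def divP (d i : ℕ) : SMod F :=
  polyS F d i (fun a => ExteriorAlgebra F (Cochain F d a))
    (fun θ => (ExteriorAlgebra.map (cochainPull F d θ)).toLinearMap)
    (fun a => by
      rw [cochainPull_id, ExteriorAlgebra.map_id]
      rfl)
    (fun θ η => by
      rw [cochainPull_comp, ← ExteriorAlgebra.map_comp_map]
      rfl)

variable (F) in
/-- The exterior algebra of the simplicial module of cocycles. -/
noncomputable def extS (d : ℕ) : SMod F :=
  sMk (fun a => ExteriorAlgebra F (Cocycle F d a))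
    (fun θ => (ExteriorAlgebra.map (cocyclePull F d θ)).toLinearMap)
    (fun a => by
      rw [cocyclePull_id, ExteriorAlgebra.map_id]
      rfl)
    (fun θ η => by
      rw [cocyclePull_comp, ← ExteriorAlgebra.map_comp_map]
      rfl)

/-- The basic cochains of surjections. -/
noncomputable abbrev surjIndic (F : Type) [Field F] {d : ℕ} {a : SimplexCategory} (t : Surj d a) :
    Cochain F d a := cochIndic F t.1

variable (F) in
/-- The differential of the resolution of the exterior algebra. -/
noncomputable def divDS (d i : ℕ) : divP F d (i + 1) ⟶ divP F d i where
  app a := ModuleCat.ofHom ((divD (surjIndic F (d := d) (a := a.unop))).restrict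
    fun _ hx => divD_mem _ hx)
  naturality _ _ θ := ModuleCat.hom_ext (LinearMap.ext fun x => Subtype.ext
    (divD_polyMap _ _ (surjPull θ.unop) (cochainPull F d θ.unop)
      (cochainPull_cochIndic F θ.unop) x.1))

variable (F) in
/-- The equivalence of the terms of the resolution with divided powers. -/
noncomputable def divEps (d i : ℕ) : divP F d i ⟶ gammaS F d i where
  app a := ModuleCat.ofHom ((polyMap (ExteriorAlgebra.algebraMapInv (R := F)
    (M := Cochain F d a.unop)).toLinearMap LinearMap.id).restrict
      fun _ hx => polyMap_mem _ (fun _ _ => id) hx)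
  naturality _ _ θ := ModuleCat.hom_ext (LinearMap.ext fun x => Subtype.ext
    (LinearMap.ext fun f => by
    change ExteriorAlgebra.algebraMapInv (ExteriorAlgebra.map (cochainPull F d θ.unop) _) =
      ExteriorAlgebra.algebraMapInv _
    rw [← AlgHom.comp_apply]
    congr 1
    ext v
    simp [ExteriorAlgebra.algebraMapInv]))

variable (F) in
/-- The section of `divEps`. -/
noncomputable def divSec (d i : ℕ) : gammaS F d i ⟶ divP F d i where
  app a := ModuleCat.ofHom ((polyMap (Algebra.linearMap F (ExteriorAlgebra F (Cochain F d a.unop)))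
    LinearMap.id).restrict fun _ hx => polyMap_mem _ (fun _ _ => id) hx)
  naturality _ _ θ := ModuleCat.hom_ext (LinearMap.ext fun _ => Subtype.ext (LinearMap.ext fun _ =>
    ((ExteriorAlgebra.map (cochainPull F d θ.unop)).commutes _).symm))

lemma isHIso_divEps (d i : ℕ) : IsHIso (divEps F d i) := by
  refine HFamily.isHIso
    { H := fun {a} φ => ModuleCat.ofHom ((polyMap
        (ExteriorAlgebra.map (trunc F d φ)).toLinearMap LinearMap.id).restrict
        fun _ hx => polyMap_mem (T := Surj d a) (i := i) _ (fun _ _ => id) hx)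
      nat := fun {a b} θ φ => ModuleCat.hom_ext (LinearMap.ext fun x => Subtype.ext
        (LinearMap.ext fun f => ?_)) }
    (divEps F d i) (divSec F d i) ?_ (fun a => ?_) fun a => ?_
  · change ((ExteriorAlgebra.map (cochainPull F d θ)).comp (ExteriorAlgebra.map (trunc F d φ))) _ =
      ((ExteriorAlgebra.map (trunc F d (θ ≫ φ))).comp (ExteriorAlgebra.map (cochainPull F d θ))) _
    rw [ExteriorAlgebra.map_comp_map, ExteriorAlgebra.map_comp_map, trunc_pull]
    rfl
  · exact NatTrans.ext (funext fun a => ModuleCat.hom_ext (LinearMap.ext fun x =>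
      Subtype.ext (LinearMap.ext fun f => ExteriorAlgebra.algebraMap_leftInverse _ _)))
  · refine ModuleCat.hom_ext (LinearMap.ext fun x => Subtype.ext (LinearMap.ext fun f => ?_))
    change ExteriorAlgebra.map (trunc F d (SimplexCategory.const a ⦋1⦌ 1)) _ = x.1 f
    rw [trunc_one, ExteriorAlgebra.map_id]
    rfl
  · refine ModuleCat.hom_ext (LinearMap.ext fun x => Subtype.ext (LinearMap.ext fun f => ?_))
    change ExteriorAlgebra.map (trunc F d (SimplexCategory.const a ⦋1⦌ 0)) _ = _
    rw [trunc_zero, map_zero_eq]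
    rfl

variable (F) in
/-- The augmentation of the resolution of the exterior algebra. -/
noncomputable def divPi (d : ℕ) : divP F d 0 ⟶ extS F (d + 1) where
  app a := ModuleCat.ofHom (((ExteriorAlgebra.map (coboundaryHom F d a.unop)).toLinearMap ∘ₗ
    LinearMap.applyₗ (1 : MvPolynomial (Surj d a.unop) F)).domRestrict _)
  naturality _ _ θ := ModuleCat.hom_ext (LinearMap.ext fun x => by
    change ((ExteriorAlgebra.map (coboundaryHom F d _)).comp
      (ExteriorAlgebra.map (cochainPull F d θ.unop))) (x.1 (polyPull F (surjPull θ.unop) 1)) =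
      ((ExteriorAlgebra.map (cocyclePull F (d + 1) θ.unop)).comp
        (ExteriorAlgebra.map (coboundaryHom F d _))) (x.1 1)
    rw [map_one, ExteriorAlgebra.map_comp_map, ExteriorAlgebra.map_comp_map]
    rfl)

lemma ker_coboundaryHom_le_span (d : ℕ) (a : SimplexCategory) :
    LinearMap.ker (coboundaryHom F d a) ≤
      Submodule.span F (Set.range (surjIndic F (d := d) (a := a))) := by
  intro c hc
  have h := mem_span_indic (k := F) (z := c.1) ⟨c.2, congrArg Subtype.val hc⟩
  rw [show (Set.range fun t : Surj d a => indic F t.1) = (Cochain F d a).subtype ''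
    Set.range (surjIndic F) by rw [← Set.range_comp]; rfl, ← Submodule.map_span] at h
  obtain ⟨c', h1, h2⟩ := h
  rw [← Subtype.ext h2]
  exact h1

variable (F) in
/-- The resolution of the exterior algebra of cocycles by divided powers. -/
noncomputable def exteriorResolution (d : ℕ) :
    Resolution (extS F (d + 1)) (divP F d) (gammaS F d) where
  d := divDS F d
  π := divPi F d
  ε := divEps F d
  surj a := by
    intro y
    obtain ⟨x, rfl⟩ := ExteriorAlgebra.map_surjective_iff.2
      (coboundaryHom_surjective (k := F) (d := d) (a := a.unop)) y
    refine ⟨⟨(lcoeff F 0).smulRight x, fun j hj f hf => ?_⟩, ?_⟩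
    · change coeff 0 f • x = 0
      rw [hf.coeff_eq_zero (by simpa using hj.symm), zero_smul]
    · change ExteriorAlgebra.map (coboundaryHom F d a.unop)
        (coeff 0 (1 : MvPolynomial (Surj d a.unop) F) • x) = _
      rw [coeff_zero_one, one_smul]
  exact_zero a x := by
    constructor
    · intro h
      obtain ⟨w, hw, e⟩ := exists_divD_eq_of_map (ℓ := surjIndic F) (coboundaryHom F d a.unop)
        coboundaryHom_surjective (ker_coboundaryHom_le_span d a.unop) x.2 h
      exact ⟨⟨w, hw⟩, Subtype.ext e⟩
    · rintro ⟨w, rfl⟩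
      change ExteriorAlgebra.map (coboundaryHom F d a.unop) (divD (surjIndic F) w.1 1) = 0
      rw [divD_apply, map_sum]
      refine Finset.sum_eq_zero fun t _ => ?_
      rw [map_mul, ExteriorAlgebra.map_apply_ι,
        show coboundaryHom F d a.unop (surjIndic F t) = 0 from
          Subtype.ext (indic_mem_cocycle t.1).2, map_zero, zero_mul]
  exact_succ i a x := by
    constructor
    · intro h
      obtain ⟨w, hw, e⟩ := exists_divD_eq (linearIndependent_cochIndic F d a.unop) x.2
        (congrArg Subtype.val h)
      exact ⟨⟨w, hw⟩, Subtype.ext e⟩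
    · rintro ⟨w, rfl⟩
      exact Subtype.ext (divD_divD _ w.1)
  hIso i := isHIso_divEps d i
  comp_zero i := by
    refine NatTrans.ext (funext fun a => ModuleCat.hom_ext (LinearMap.ext fun x =>
      Subtype.ext (LinearMap.ext fun f => ?_)))
    change ExteriorAlgebra.algebraMapInv (divD (surjIndic F) x.1 f) = 0
    rw [divD_apply, map_sum]
    refine Finset.sum_eq_zero fun t _ => ?_
    rw [map_mul]
    simp [ExteriorAlgebra.algebraMapInv]

end DividedResolution

end EMSpace

namespace EMSpace

section DividedRetract

open Opposite MvPolynomial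
open scoped Simplicial

variable {F : Type} [Field F]

section

variable {T T' : Type} [Fintype T] [Fintype T'] {k : ℕ}

open Classical in
lemma coeff_single_eq (t : T) (f : MvPolynomial T F) :
    coeff (Finsupp.single t k) f =
      (aeval (fun s => if s = t then (Polynomial.X : Polynomial F) else 0) f).coeff k := by
  suffices H : lcoeff F (Finsupp.single t k) = Polynomial.lcoeff F k ∘ₗ
      (aeval (fun s => if s = t then (Polynomial.X : Polynomial F) else 0)).toLinearMap from
    LinearMap.congr_fun H f
  refine linearMap_ext fun m => LinearMap.ext_ring ?_
  change coeff _ (monomial m 1) = (aeval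
    (fun s => if s = t then (Polynomial.X : Polynomial F) else 0) (monomial m 1)).coeff k
  rw [coeff_monomial, aeval_monomial, map_one, one_mul]
  by_cases h : ∃ s ≠ t, m s ≠ 0
  · obtain ⟨s, hs, hm⟩ := h
    rw [Finsupp.prod, Finset.prod_eq_zero (i := s) (by simpa using hm) (by simp [hs, hm]),
      Polynomial.coeff_zero, if_neg]
    rintro rfl
    exact hm (by simp [hs.symm])
  · push Not at h
    obtain ⟨j, rfl⟩ : ∃ j, m = Finsupp.single t j := ⟨m t, Finsupp.ext fun s => by
      by_cases hs : s = t
      · rw [hs, Finsupp.single_eq_same]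
      · rw [h s hs, Finsupp.single_eq_of_ne hs]⟩
    rw [Finsupp.prod_single_index (by simp), if_pos rfl, Polynomial.coeff_X_pow]
    have := (Finsupp.single_injective t).eq_iff (a := j) (b := k)
    simp only [this, eq_comm]

lemma coeff_polyPull (hk : k ≠ 0) (r : T' → Option T) (t' : T') (f : MvPolynomial T F) :
    coeff (Finsupp.single t' k) (polyPull F r f) =
      (r t').elim 0 fun t => coeff (Finsupp.single t k) f := by
  classical
  rw [coeff_single_eq, ← AlgHom.comp_apply]
  have h : (aeval fun s => if s = t' then (Polynomial.X : Polynomial F) else 0).comp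
      (polyPull F r) = aeval fun s => if r t' = some s then (Polynomial.X : Polynomial F) else 0 := by
    refine algHom_ext fun s => ?_
    rw [AlgHom.comp_apply, polyPull_X, map_sum, aeval_X, Finset.sum_eq_single t']
    · split_ifs <;> simp
    · intro t _ ht
      split_ifs <;> simp [ht]
    · simp
  rw [h]
  cases hr : r t' with
  | none =>
    have h0 : (aeval fun s => if none = some s then (Polynomial.X : Polynomial F) else 0) =
        (Algebra.ofId F (Polynomial F)).comp (aeval fun _ : T => (0 : F)) := by
      refine algHom_ext fun s => ?_
      simp
    rw [h0]
    change (Polynomial.C _).coeff k = 0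
    rw [Polynomial.coeff_C, if_neg hk]
  | some t =>
    rw [Option.elim_some, coeff_single_eq]
    simp only [Option.some.injEq, eq_comm]

end

section

variable {V V' T T' : Type} [AddCommGroup V] [Module F V] [AddCommGroup V'] [Module F V']
  (b : Module.Basis T F V) (b' : Module.Basis T' F V') {k : ℕ}

/-- The divided powers of the elements of a basis. -/
noncomputable def powIncl (k : ℕ) : V →ₗ[F] (MvPolynomial T F →ₗ[F] F) :=
  b.constr F fun t => lcoeff F (Finsupp.single t k)

lemma powIncl_basis (t : T) : powIncl b k (b t) = lcoeff F (Finsupp.single t k) :=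
  b.constr_basis F _ t

variable [Fintype T] [Fintype T']

lemma powIncl_mem (v : V) : powIncl b k v ∈ polyIn T k := by
  rw [powIncl, Module.Basis.constr_apply_fintype]
  refine Submodule.sum_mem _ fun t _ => Submodule.smul_mem _ _ fun j hj f hf => ?_
  exact hf.coeff_eq_zero (by simpa using hj.symm)

/-- The evaluation on powers of variables. -/
noncomputable def powEval (k : ℕ) : (MvPolynomial T F →ₗ[F] F) →ₗ[F] V where
  toFun u := ∑ t, u (X t ^ k) • b t
  map_add' u v := by simp [add_smul, Finset.sum_add_distrib]
  map_smul' r u := by simp [Finset.smul_sum, mul_smul]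

lemma powEval_apply (u : MvPolynomial T F →ₗ[F] F) : powEval b k u = ∑ t, u (X t ^ k) • b t := rfl

lemma powEval_powIncl (hk : k ≠ 0) (v : V) : powEval b k (powIncl b k v) = v := by
  classical
  suffices H : powEval b k ∘ₗ powIncl b k = LinearMap.id from LinearMap.congr_fun H v
  refine b.ext fun t => ?_
  rw [LinearMap.comp_apply, powIncl_basis, powEval_apply, Finset.sum_eq_single t]
  · simp [coeff_X_pow]
  · intro s _ hs
    rw [lcoeff_apply, coeff_X_pow, if_neg, zero_smul]
    exact fun h => hs (Finsupp.single_left_injective hk h)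
  · simp

variable (r : T' → Option T) (g : V' →ₗ[F] V) (hg : ∀ t, g (b' t) = (r t).elim 0 b)

include hg

lemma powIncl_naturality (hk : k ≠ 0) (v : V') : powIncl b k (g v) =
    polyMap LinearMap.id (polyPull F r).toLinearMap (powIncl b' k v) := by
  suffices H : powIncl b k ∘ₗ g =
      polyMap LinearMap.id (polyPull F r).toLinearMap ∘ₗ powIncl b' k from
    LinearMap.congr_fun H v
  refine b'.ext fun t' => LinearMap.ext fun f => ?_
  rw [LinearMap.comp_apply, LinearMap.comp_apply, powIncl_basis, hg]
  refine Eq.trans ?_ (coeff_polyPull hk r t' f).symm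
  cases r t' with
  | none => rw [Option.elim_none, map_zero]; rfl
  | some t => rw [Option.elim_some, powIncl_basis]; rfl

lemma powEval_naturality {p : ℕ} [Fact p.Prime] [CharP F p] (m : ℕ)
    (u : MvPolynomial T' F →ₗ[F] F) :
    powEval b (p ^ m) (polyMap LinearMap.id (polyPull F r).toLinearMap u) =
      g (powEval b' (p ^ m) u) := by
  classical
  have hp : p ^ m ≠ 0 := pow_ne_zero _ (Fact.out : p.Prime).ne_zero
  rw [powEval_apply, powEval_apply, map_sum]
  have h1 (t : T) : polyMap LinearMap.id (polyPull F r).toLinearMap u (X t ^ p ^ m) • b t =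
      ∑ t', if r t' = some t then u (X t' ^ p ^ m) • b t else 0 := by
    change u (polyPull F r (X t ^ p ^ m)) • b t = _
    rw [map_pow, polyPull_X, sum_pow_char_pow p m, map_sum, Finset.sum_smul]
    refine Finset.sum_congr rfl fun t' _ => ?_
    split_ifs
    · rfl
    · rw [zero_pow hp, map_zero, zero_smul]
  simp only [h1]
  rw [Finset.sum_comm]
  refine Finset.sum_congr rfl fun t' _ => ?_
  rw [map_smul, hg]
  cases hr : r t' with
  | none => simp
  | some s =>
    rw [Finset.sum_eq_single s]
    · simp
    · intro t _ ht
      rw [if_neg (by simpa using ht.symm)]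
    · simp

end

lemma nontrivial_of_retract {P Q : SMod F} (f : P ⟶ Q) (g : Q ⟶ P) (h : f ≫ g = 𝟙 P) (s : ℕ)
    (hP : Nontrivial ((homologyFun F s).obj P)) : Nontrivial ((homologyFun F s).obj Q) := by
  have h1 : (homologyFun F s).map f ≫ (homologyFun F s).map g = 𝟙 _ := by
    rw [← CategoryTheory.Functor.map_comp, h, CategoryTheory.Functor.map_id]
  exact Function.Injective.nontrivial (f := ((homologyFun F s).map f).hom)
    (Function.LeftInverse.injective (g := ((homologyFun F s).map g).hom) fun x =>
      congrArg (fun q => q.hom x) h1)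

lemma nontrivial_homology_gammaS {p : ℕ} [Fact p.Prime] [CharP F p] (d m : ℕ) :
    Nontrivial ((homologyFun F d).obj (gammaS F d (p ^ m))) := by
  have hp : p ^ m ≠ 0 := pow_ne_zero _ (Fact.out : p.Prime).ne_zero
  let f : cocS F d ⟶ gammaS F d (p ^ m) :=
    { app := fun a => ModuleCat.ofHom ((powIncl (cocycleBasis F d a.unop) (p ^ m)).codRestrict _
        fun v => powIncl_mem _ v)
      naturality := fun _ _ θ => ModuleCat.hom_ext (LinearMap.ext fun v => Subtype.ext
        (powIncl_naturality _ _ (surjPull θ.unop) (cocyclePull F d θ.unop)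
          (cocyclePull_cocycleBasis F θ.unop) hp v)) }
  let g : gammaS F d (p ^ m) ⟶ cocS F d :=
    { app := fun a => ModuleCat.ofHom ((powEval (cocycleBasis F d a.unop) (p ^ m)).domRestrict _)
      naturality := fun _ _ θ => ModuleCat.hom_ext (LinearMap.ext fun u =>
        powEval_naturality _ _ (surjPull θ.unop) (cocyclePull F d θ.unop)
          (cocyclePull_cocycleBasis F θ.unop) m u.1) }
  exact nontrivial_of_retract f g (NatTrans.ext (funext fun a => ModuleCat.hom_ext
    (LinearMap.ext fun v => powEval_powIncl _ hp v))) d (nontrivial_homology_cocS d)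

end DividedRetract

end EMSpace

namespace EMSpace

section ExteriorSplitting

open Opposite
open scoped Simplicial DirectSum

variable {F : Type} [Field F]

section

variable {V W : Type} [AddCommGroup V] [Module F V] [AddCommGroup W] [Module F W]

/-- The homogeneous components in the exterior algebra. -/
noncomputable def extProj (i : ℕ) : ExteriorAlgebra F V →ₗ[F] ExteriorAlgebra F V :=
  GradedAlgebra.proj (fun i : ℕ => ⋀[F]^i V) i

lemma extProj_mem (i : ℕ) (x : ExteriorAlgebra F V) : extProj i x ∈ ⋀[F]^i V :=
  SetLike.coe_mem (DirectSum.decompose (fun i : ℕ => ⋀[F]^i V) x i)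

lemma extProj_map (i : ℕ) (g : V →ₗ[F] W) (x : ExteriorAlgebra F V) :
    extProj i (ExteriorAlgebra.map g x) = ExteriorAlgebra.map g (extProj i x) := by
  induction x using DirectSum.Decomposition.inductionOn fun i : ℕ => ⋀[F]^i V with
  | zero => simp only [map_zero]
  | add x y hx hy => simp only [map_add, hx, hy]
  | @homogeneous j x =>
    have hx : ExteriorAlgebra.map g x.1 ∈ ⋀[F]^j W := map_mem g x.2
    by_cases h : j = i
    · subst h
      exact (DirectSum.decompose_of_mem_same (fun i : ℕ => ⋀[F]^i W) hx).trans
        (congrArg _ (DirectSum.decompose_of_mem_same (fun i : ℕ => ⋀[F]^i V) x.2).symm)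
    · refine (DirectSum.decompose_of_mem_ne (fun i : ℕ => ⋀[F]^i W) hx h).trans ?_
      refine ((congrArg (ExteriorAlgebra.map g) (?_ : extProj i x.1 = 0)).trans (map_zero _)).symm
      exact DirectSum.decompose_of_mem_ne (fun i : ℕ => ⋀[F]^i V) x.2 h

lemma exists_sum_extProj (x : ExteriorAlgebra F V) :
    ∃ S : Finset ℕ, ∑ i ∈ S, extProj i x = x := by
  classical
  exact ⟨_, DirectSum.sum_support_decompose (fun i : ℕ => ⋀[F]^i V) x⟩

end

variable (F) in
/-- The homogeneous components of the exterior algebra of cocycles. -/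
noncomputable def extSProj (d i : ℕ) : extS F d ⟶ extQ F d i where
  app _ := ModuleCat.ofHom ((extProj i).codRestrict _ fun x => extProj_mem i x)
  naturality _ _ θ := ModuleCat.hom_ext (LinearMap.ext fun x => Subtype.ext
    (extProj_map i (cocyclePull F d θ.unop) x))

variable (F) in
/-- The inclusion of the exterior powers of cocycles. -/
noncomputable def extSIncl (d i : ℕ) : extQ F d i ⟶ extS F d where
  app _ := ModuleCat.ofHom (Submodule.subtype _)
  naturality _ _ _ := rfl

lemma exists_nontrivial_extQ (d m : ℕ) (h : Nontrivial ((homologyFun F m).obj (extS F d))) :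
    ∃ i, Nontrivial ((homologyFun F m).obj (extQ F d i)) := by
  by_contra! hQ
  let A := alternatingFaceMapComplex (ModuleCat.{0} F)
  let K := A.obj (extS F d)
  let f (i : ℕ) : K ⟶ K := A.map (extSProj F d i ≫ extSIncl F d i)
  have hf (i : ℕ) : HomologicalComplex.homologyMap (f i) m = 0 := by
    change (homologyFun F m).map (extSProj F d i ≫ extSIncl F d i) = 0
    rw [CategoryTheory.Functor.map_comp]
    refine ModuleCat.hom_ext (LinearMap.ext fun x => ?_)
    change ((homologyFun F m).map _).hom (((homologyFun F m).map _).hom x) = 0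
    rw [@Subsingleton.elim _ (hQ i) (((homologyFun F m).map _).hom x) 0, map_zero]
  refine (not_subsingleton_iff_nontrivial.2 h) (subsingleton_of_forall_eq 0 fun x => ?_)
  obtain ⟨z, rfl⟩ := (ModuleCat.epi_iff_surjective (K.homologyπ m)).1 inferInstance x
  obtain ⟨S, hS⟩ := exists_sum_extProj (show ExteriorAlgebra F (Cocycle F d ⦋m⦌) from
    (K.iCycles m).hom z)
  have hz : z = ∑ i ∈ S, (HomologicalComplex.cyclesMap (f i) m).hom z := by
    refine (ModuleCat.mono_iff_injective (K.iCycles m)).1 inferInstance ?_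
    rw [map_sum]
    refine hS.symm.trans (Finset.sum_congr rfl fun i _ => ?_)
    exact (congrArg (fun q => q.hom z) (HomologicalComplex.cyclesMap_i (f i) m)).symm
  rw [hz, map_sum]
  refine Finset.sum_eq_zero fun i _ => ?_
  refine (congrArg (fun q => q.hom z) (HomologicalComplex.homologyπ_naturality (f i) m)).symm.trans
    ?_
  rw [hf]
  rfl

end ExteriorSplitting

section Assembly

open Opposite
open scoped Simplicial

variable (F : Type) [Field F]

lemma nontrivial_homology_cocycleSet {p : ℕ} [Fact p.Prime] [CharP F p] (d m : ℕ) :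
    ∃ s, p ^ m ≤ s ∧
      Nontrivial ((homologyFun F s).obj ((freeS F).obj (cocycleSet ℤ (d + 2)))) := by
  obtain ⟨i, hi⟩ := exists_nontrivial_extQ (d + 1) (p ^ m + d)
    ((exteriorResolution F d).nontrivial (p ^ m) d (nontrivial_homology_gammaS d m))
  exact ⟨i + (p ^ m + d), by omega, (cocycleResolution F (d + 1)).nontrivial i _ hi⟩

lemma finite_homology_cocycleSet (d s : ℕ) :
    Module.Finite F ((homologyFun F s).obj ((freeS F).obj (cocycleSet ℤ (d + 1)))) := by
  refine (cocycleResolution F d).finite s fun i s => finite_homology _ s ?_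
  have : Module.Finite F (Cocycle F d ⦋s⦌) := Module.Finite.of_basis (cocycleBasis F d ⦋s⦌)
  exact exteriorPower.instFinite (M := Cocycle F d ⦋s⦌) (n := i)

end Assembly

lemma exists_lt_sum_mul_pow (f : ℕ → ℕ) (hf : ∀ N, ∃ s, N ≤ s ∧ f s ≠ 0) (C : ℝ) :
    ∃ t : ℝ, 0 ≤ t ∧ t < 1 ∧ ∃ m : ℕ, C < ∑ s ∈ Finset.range m, (f s : ℝ) * t ^ s := by
  have hsum : ∀ N : ℕ, ∃ m : ℕ, (N : ℝ) ≤ ∑ s ∈ Finset.range m, (f s : ℝ) := by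
    intro N
    induction N with
    | zero => exact ⟨0, by simp⟩
    | succ N ih =>
      obtain ⟨m, hm⟩ := ih
      obtain ⟨s, hs, h0⟩ := hf m
      refine ⟨s + 1, ?_⟩
      rw [Finset.sum_range_succ]
      have h1 : ∑ s ∈ Finset.range m, (f s : ℝ) ≤ ∑ s ∈ Finset.range s, (f s : ℝ) :=
        Finset.sum_le_sum_of_subset_of_nonneg (Finset.range_mono hs) fun _ _ _ => by positivity
      have h2 : (1 : ℝ) ≤ f s := by exact_mod_cast Nat.one_le_iff_ne_zero.2 h0
      push_cast
      linarith
  obtain ⟨N, hN⟩ := exists_nat_gt C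
  obtain ⟨m, hm⟩ := hsum N
  have hc : Continuous fun t : ℝ => ∑ s ∈ Finset.range m, (f s : ℝ) * t ^ s := by fun_prop
  have h1 : ∀ᶠ t in nhdsWithin (1 : ℝ) (Set.Iio 1),
      C < ∑ s ∈ Finset.range m, (f s : ℝ) * t ^ s :=
    (hc.tendsto 1).eventually_const_lt (by simpa using hN.trans_le hm) |>.filter_mono
      nhdsWithin_le_nhds
  obtain ⟨t, ht, h0, h2⟩ := (h1.and (Ioo_mem_nhdsLT (zero_lt_one' ℝ))).exists
  exact ⟨t, h0.le, h2, m, ht⟩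

end EMSpace

/-!
STATEMENT 18: For `F` a field of characteristic `p > 0` and `n ≥ 2`, the
Poincaré series `θ(ℤ,n,t) = Σ_s dim_F H_s(K(ℤ,n);F) t^s` is not bounded on
`[0,1)`: its values (equivalently, its partial sums) are unbounded as
`t → 1⁻`.
-/
theorem poincare_series_EM_space_unbounded
    (F : Type) [Field F] (p : ℕ) (hp : p.Prime) [CharP F p]
    (n : ℕ) (hn : 2 ≤ n) (X : TopCat) (hX : IsEilenbergMacLane X 1 n) :
    ∀ C : ℝ, ∃ t : ℝ, 0 ≤ t ∧ t < 1 ∧ ∃ m : ℕ,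
      C < ∑ s ∈ Finset.range m,
        (Module.finrank F (singularHomologyF F X s) : ℝ) * t ^ s := by
  have hp' : Fact p.Prime := ⟨hp⟩
  obtain ⟨⟨x⟩, -, h1, h2⟩ := hX
  obtain ⟨d, rfl⟩ : ∃ d, n = d + 2 := ⟨n - 2, by omega⟩
  obtain ⟨N, hN, ⟨e⟩⟩ := h2 x
  obtain rfl : N = d + 1 := by omega
  have key (s : ℕ) : Nonempty (singularHomologyF F X s ≃ₗ[F] (EMSpace.homologyFun F s).obj
      ((EMSpace.freeS F).obj (EMSpace.cocycleSet ℤ (d + 2)))) :=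
    EMSpace.nonempty_singular_equiv F (d + 1) X x
      (fun x i hi => (h1 x i hi).some.subsingleton) e s
  refine EMSpace.exists_lt_sum_mul_pow _ fun M => ?_
  obtain ⟨s, hs, hH⟩ := EMSpace.nontrivial_homology_cocycleSet F (p := p) d M
  have := EMSpace.finite_homology_cocycleSet F (d + 1) s
  refine ⟨s, (Nat.lt_pow_self hp.one_lt).le.trans hs, ?_⟩
  rw [(key s).some.finrank_eq]
  exact Module.finrank_pos.ne'
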